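/- Let p, q, r ≥ 0 be integers with at most one of them equal to 0. If G is any simple graph whose Laplacian permanental polynomial equals that of θ(p,q,r), i.e., per(xI − L(G)) = per(xI − L(θ(p,q,r))) as polynomials in x, then G is isomorphic to θ(p,q,r). -/

import Mathlib

open scoped Classical
open Polynomial

noncomputable section

/-- The Laplacian permanental polynomial `per(x·I − L(G))` of a graph `G`,
where `L(G) = D(G) − A(G)` is the Laplacian matrix. -/
def lapPermPoly {V : Type*} [Fintype V] (G : SimpleGraph V) : Polynomial ℚ :=
  Matrix.permanent
    (Matrix.diagonal (fun _ : V => (X : Polynomial ℚ)) - (G.lapMatrix ℚ).map Polynomial.C)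

/-- The bicyclic graph `θ(p,q,r)` on `p + q + r + 2` vertices: the two hub vertices `0`
and `1` are joined by three internally disjoint paths having `p`, `q` and `r` internal
vertices respectively (internal vertices `2, …, p+1`, then `p+2, …, p+q+1`, then
`p+q+2, …, p+q+r+1`); a path with `0` internal vertices is the edge `{0, 1}`. -/
def thetaGraph (p q r : ℕ) : SimpleGraph (Fin (p + q + r + 2)) :=
  SimpleGraph.fromRel (fun i j =>
    (p = 0 ∧ i.val = 0 ∧ j.val = 1) ∨
    (0 < p ∧ i.val = 0 ∧ j.val = 2) ∨
    (2 ≤ i.val ∧ i.val + 1 = j.val ∧ j.val < p + 2) ∨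
    (0 < p ∧ i.val = p + 1 ∧ j.val = 1) ∨
    (q = 0 ∧ i.val = 0 ∧ j.val = 1) ∨
    (0 < q ∧ i.val = 0 ∧ j.val = p + 2) ∨
    (p + 2 ≤ i.val ∧ i.val + 1 = j.val ∧ j.val < p + q + 2) ∨
    (0 < q ∧ i.val = p + q + 1 ∧ j.val = 1) ∨
    (r = 0 ∧ i.val = 0 ∧ j.val = 1) ∨
    (0 < r ∧ i.val = 0 ∧ j.val = p + q + 2) ∨
    (p + q + 2 ≤ i.val ∧ i.val + 1 = j.val) ∨
    (0 < r ∧ i.val = p + q + r + 1 ∧ j.val = 1))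


/-! ## Permanents by rows -/

section PermRows

variable {V : Type*} [Fintype V] {R : Type*} [CommRing R]

/-- The permanent of a family of rows. -/
def pr (c : V → V → R) : R := ∑ σ : Equiv.Perm V, ∏ i, c i (σ i)

/-- The unit row. -/
abbrev ee (R : Type*) [CommRing R] {V : Type*} (x : V) : V → R := Pi.single x 1

theorem prod_update_row (c : V → V → R) (x : V) (r : V → R) (σ : Equiv.Perm V) :
    ∏ i, Function.update c x r i (σ i) = r (σ x) * ∏ i ∈ Finset.univ.erase x, c i (σ i) := by
  rw [← Finset.mul_prod_erase _ _ (Finset.mem_univ x)]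
  congr 1
  · simp
  · apply Finset.prod_congr rfl
    intro i hi
    rw [Function.update_of_ne (Finset.ne_of_mem_erase hi)]

theorem pr_update_add (c : V → V → R) (x : V) (r r' : V → R) :
    pr (Function.update c x (r + r')) = pr (Function.update c x r) + pr (Function.update c x r') := by
  simp only [pr, prod_update_row, Pi.add_apply, add_mul, Finset.sum_add_distrib]

theorem pr_update_smul (c : V → V → R) (x : V) (a : R) (r : V → R) :
    pr (Function.update c x (a • r)) = a * pr (Function.update c x r) := by
  simp only [pr, prod_update_row, Pi.smul_apply, smul_eq_mul, mul_assoc, Finset.mul_sum]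

theorem pr_zero_col (c : V → V → R) (y : V) (h : ∀ z, c z y = 0) : pr c = 0 := by
  unfold pr
  apply Finset.sum_eq_zero
  intro σ _
  apply Finset.prod_eq_zero (Finset.mem_univ (σ.symm y))
  simp [h]

theorem pr_dup (c : V → V → R) (x z y : V) (hxz : x ≠ z) (hx : c x = ee R y) (hz : c z = ee R y) :
    pr c = 0 := by
  unfold pr
  apply Finset.sum_eq_zero
  intro σ _
  by_cases h : σ x = y
  · apply Finset.prod_eq_zero (Finset.mem_univ z)
    rw [hz]
    apply Pi.single_eq_of_ne
    intro h'
    exact hxz (σ.injective (h.trans h'.symm))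
  · apply Finset.prod_eq_zero (Finset.mem_univ x)
    rw [hx]
    exact Pi.single_eq_of_ne h _

theorem pr_comp_equiv (c : V → V → R) (τ : Equiv.Perm V) : pr (fun i => c (τ i)) = pr c := by
  unfold pr
  apply Fintype.sum_equiv (Equiv.mulRight τ⁻¹)
  intro σ
  apply Fintype.prod_equiv τ
  intro i
  simp

theorem pr_swap (c : V → V → R) (x v : V) (hxv : x ≠ v) (r r' : V → R) :
    pr (Function.update (Function.update c x r) v r') =
      pr (Function.update (Function.update c x r') v r) := by
  rw [← pr_comp_equiv _ (Equiv.swap x v)]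
  congr 1
  funext i
  by_cases h1 : i = x
  · subst h1; simp [hxv]
  · by_cases h2 : i = v
    · subst h2; simp [hxv]
    · rw [Equiv.swap_apply_of_ne_of_ne h1 h2]; simp [h1, h2]

/-- Adding a new vertex `x` (isolated with weight one in `N`) with weight `Y`, joined to `u`. -/
def addV (Y α : R) (N : V → V → R) (u x : V) : V → V → R :=
  Function.update (Function.update N x (Y • ee R x + ee R u)) u (N u + α • ee R x)

/-- `x` is isolated in `N`, with weight one. -/
def Iso1 (N : V → V → R) (x : V) : Prop := N x = ee R x ∧ ∀ z, z ≠ x → N z x = 0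

theorem Iso1.update {N : V → V → R} {x : V} (h : Iso1 N x) {z : V} (hz : z ≠ x) {r : V → R}
    (hr : r x = 0) : Iso1 (Function.update N z r) x := by
  refine ⟨?_, ?_⟩
  · rw [Function.update_of_ne hz.symm]; exact h.1
  · intro t ht
    by_cases htz : t = z
    · subst htz; simpa using hr
    · rw [Function.update_of_ne htz]; exact h.2 t ht

theorem addV_update (Y α : R) (N : V → V → R) {u x z : V} (hu : z ≠ u) (hx : z ≠ x) (r : V → R) :
    Function.update (addV Y α N u x) z r = addV Y α (Function.update N z r) u x := by
  unfold addV
  rw [Function.update_comm hu.symm, Function.update_comm hx.symm]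
  rw [Function.update_of_ne hu.symm]

theorem pr_addV (Y α : R) (N : V → V → R) {u x : V} (hux : u ≠ x) (hN : Iso1 N x) :
    pr (addV Y α N u x) = Y * pr N + α * pr (Function.update N u (ee R u)) := by
  unfold addV
  have e1 : Function.update N x (ee R x) = N := by rw [← hN.1, Function.update_eq_self]
  rw [pr_update_add, pr_update_smul]
  have h1 : Function.update (Function.update N x (Y • ee R x + ee R u)) u (N u) =
      Function.update N x (Y • ee R x + ee R u) := by
    conv_rhs => rw [← Function.update_eq_self u (Function.update N x (Y • ee R x + ee R u))]
    rw [Function.update_of_ne hux]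
  rw [h1, pr_update_add, pr_update_smul, e1]
  have h2 : pr (Function.update N x (ee R u)) = 0 := by
    apply pr_zero_col _ x
    intro z
    by_cases hz : z = x
    · subst hz; simp [hux.symm]
    · rw [Function.update_of_ne hz]; exact hN.2 z hz
  rw [h2, Function.update_comm hux.symm, pr_update_add, pr_update_smul]
  have h3 : pr (Function.update (Function.update N u (ee R x)) x (ee R x)) = 0 := by
    apply pr_dup _ u x x hux <;> simp [hux]
  rw [h3, pr_swap _ _ _ hux, Function.update_comm hux, e1]
  ring

theorem pr_addV_x (Y α : R) (N : V → V → R) {u x : V} (hux : u ≠ x) (hN : Iso1 N x) :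
    pr (Function.update (addV Y α N u x) x (ee R x)) = pr N := by
  unfold addV
  have e1 : Function.update N x (ee R x) = N := by rw [← hN.1, Function.update_eq_self]
  rw [Function.update_comm hux, Function.update_idem, e1, pr_update_add, pr_update_smul,
    Function.update_eq_self]
  have : pr (Function.update N u (ee R x)) = 0 := by
    apply pr_dup _ u x x hux
    · simp
    · rw [Function.update_of_ne hux.symm]; exact hN.1
  rw [this]; ring

theorem pr_addV_xv (Y α : R) (N : V → V → R) {u x v : V} (hux : u ≠ x) (hvx : v ≠ x)
    (hN : Iso1 N x) :
    pr (Function.update (addV Y α N u x) x (ee R v)) = α * pr (Function.update N u (ee R v)) := by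
  unfold addV
  have e1 : Function.update N x (ee R x) = N := by rw [← hN.1, Function.update_eq_self]
  rw [Function.update_comm hux, Function.update_idem, pr_update_add, pr_update_smul]
  have h1 : Function.update (Function.update N x (ee R v)) u (N u) =
      Function.update N x (ee R v) := by
    conv_rhs => rw [← Function.update_eq_self u (Function.update N x (ee R v))]
    rw [Function.update_of_ne hux]
  have h2 : pr (Function.update N x (ee R v)) = 0 := by
    apply pr_zero_col _ x
    intro z
    by_cases hz : z = x
    · subst hz; simp [hvx.symm]
    · rw [Function.update_of_ne hz]; exact hN.2 z hz
  rw [h1, h2, pr_swap _ _ _ hux.symm, e1]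
  ring

theorem pr_addV_vx (Y α : R) (N : V → V → R) {u x v : V} (hux : u ≠ x) (hvx : v ≠ x)
    (huv : u ≠ v) (hN : Iso1 N x) :
    pr (Function.update (addV Y α N u x) v (ee R x)) = pr (Function.update N v (ee R u)) := by
  unfold addV
  have e1 : Function.update N x (ee R x) = N := by rw [← hN.1, Function.update_eq_self]
  rw [Function.update_comm huv, pr_update_add, pr_update_smul]
  have h0 : pr (Function.update (Function.update (Function.update N x (Y • ee R x + ee R u)) v
      (ee R x)) u (ee R x)) = 0 := by
    apply pr_dup _ u v x huv
    · simp
    · rw [Function.update_of_ne huv.symm]; simp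
  have h1 : Function.update (Function.update (Function.update N x (Y • ee R x + ee R u)) v
      (ee R x)) u (N u) = Function.update (Function.update N x (Y • ee R x + ee R u)) v
      (ee R x) := by
    conv_rhs => rw [← Function.update_eq_self u (Function.update (Function.update N x
      (Y • ee R x + ee R u)) v (ee R x))]
    rw [Function.update_of_ne huv, Function.update_of_ne hux]
  rw [h0, h1, Function.update_comm hvx.symm, pr_update_add, pr_update_smul]
  have h3 : pr (Function.update (Function.update N v (ee R x)) x (ee R x)) = 0 := by
    apply pr_dup _ v x x hvx <;> simp [hvx]
  rw [h3, pr_swap _ _ _ hvx, Function.update_comm hvx, e1]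
  ring

/-- The sequence of path polynomials, `Fs Y (k+2) = f_k`. -/
def Fs (Y : R) : ℕ → R
  | 0 => 1
  | 1 => 0
  | (n + 2) => Y * Fs Y (n + 1) + Fs Y n

/-- Adding an ear from `u` to `v` through the vertices of `l`. -/
def ear (Y γ : R) : R → (V → V → R) → V → List V → V → (V → V → R)
  | α, N, u, [], v => Function.update (Function.update N u (N u + α • ee R v)) v (N v + γ • ee R u)
  | α, N, u, x :: l, v => ear Y γ 1 (addV Y α N u x) x l v

theorem addV_iso (Y α : R) {N : V → V → R} {u x z : V} (hz : Iso1 N z) (hzu : z ≠ u) (hzx : z ≠ x) :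
    Iso1 (addV Y α N u x) z := by
  unfold addV
  apply Iso1.update _ hzu.symm
  · simp [hz.2 u hzu.symm, hzx]
  · apply Iso1.update hz hzx.symm
    simp [hzu, hzx]

theorem pr_ear (Y γ : R) (l : List V) : ∀ (α : R) (N : V → V → R) (u v : V),
    u ≠ v → u ∉ l → v ∉ l → l.Nodup → (∀ x ∈ l, Iso1 N x) →
    pr (ear Y γ α N u l v) = Fs Y (l.length + 2) * pr N
      + Fs Y (l.length + 1) * (α * pr (Function.update N u (ee R u)) +
          γ * pr (Function.update N v (ee R v)))
      + Fs Y l.length * (α * γ * pr (Function.update (Function.update N u (ee R u)) v (ee R v)))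
      + α * pr (Function.update N u (ee R v)) + γ * pr (Function.update N v (ee R u)) := by
  induction l with
  | nil =>
    intro α N u v huv _ _ _ _
    simp only [ear, List.length_nil, Fs]
    rw [pr_update_add, pr_update_smul]
    have h1 : Function.update (Function.update N u (N u + α • ee R v)) v (N v) =
        Function.update N u (N u + α • ee R v) := by
      conv_rhs => rw [← Function.update_eq_self v (Function.update N u (N u + α • ee R v))]
      rw [Function.update_of_ne huv.symm]
    have h2 : Function.update (Function.update N v (ee R u)) u (N u) = Function.update N v (ee R u) := by
      conv_rhs => rw [← Function.update_eq_self u (Function.update N v (ee R u))]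
      rw [Function.update_of_ne huv]
    rw [h1, pr_update_add, pr_update_smul, Function.update_eq_self, Function.update_comm huv,
      pr_update_add, pr_update_smul, h2, pr_swap _ _ _ huv.symm, Function.update_comm huv.symm]
    ring
  | cons x l ih =>
    intro α N u v huv hu hv hl hN
    simp only [List.mem_cons, not_or] at hu hv
    rw [List.nodup_cons] at hl
    have hNx := hN x (by simp)
    simp only [ear]
    rw [ih 1 (addV Y α N u x) x v (Ne.symm hv.1) hl.1 hv.2 hl.2]
    · have hNv : Iso1 (Function.update N v (ee R v)) x :=
        hNx.update hv.1 (by simp [Ne.symm hv.1])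
      rw [pr_addV _ _ _ hu.1 hNx, pr_addV_x _ _ _ hu.1 hNx, pr_addV_xv _ _ _ hu.1 hv.1 hNx,
        pr_addV_vx _ _ _ hu.1 hv.1 huv hNx, Function.update_comm (Ne.symm hv.1),
        addV_update _ _ _ huv.symm hv.1, pr_addV _ _ _ hu.1 hNv, pr_addV_x _ _ _ hu.1 hNv,
        Function.update_comm huv.symm]
      simp only [List.length_cons, Fs]
      ring
    · intro z hz
      apply addV_iso _ _ (hN z (by simp [hz]))
      · rintro rfl; exact hu.2 hz
      · rintro rfl; exact hl.1 hz

/-- Row updates outside the ear commute with adding the ear. -/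
theorem ear_update (Y γ : R) (l : List V) : ∀ (α : R) (N : V → V → R) (u v z : V) (r : V → R),
    z ≠ u → z ≠ v → z ∉ l →
    Function.update (ear Y γ α N u l v) z r = ear Y γ α (Function.update N z r) u l v := by
  induction l with
  | nil =>
    intro α N u v z r hu hv _
    simp only [ear]
    rw [Function.update_comm hv.symm, Function.update_comm hu.symm,
      Function.update_of_ne hu.symm, Function.update_of_ne hv.symm]
  | cons x l ih =>
    intro α N u v z r hu hv hz
    simp only [List.mem_cons, not_or] at hz
    simp only [ear]
    rw [ih _ _ _ _ _ _ hz.1 hv hz.2, addV_update _ _ _ hu hz.1]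

theorem ear_update_v (Y γ : R) (l : List V) : ∀ (α : R) (N : V → V → R) (u v : V) (r : V → R),
    v ≠ u → v ∉ l →
    Function.update (ear Y γ α N u l v) v r = ear Y 0 α (Function.update N v r) u l v := by
  induction l with
  | nil =>
    intro α N u v r hu _
    simp only [ear]
    rw [Function.update_idem, zero_smul, add_zero, Function.update_self,
      Function.update_of_ne hu.symm, Function.update_comm hu, Function.update_idem]
  | cons x l ih =>
    intro α N u v r hu hv
    simp only [List.mem_cons, not_or] at hv
    simp only [ear]
    rw [ih _ _ _ _ _ hv.1 hv.2, addV_update _ _ _ hu hv.1]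

theorem ear_update_u (Y γ : R) (l : List V) (α : R) (N : V → V → R) (u v : V) (r : V → R)
    (huv : u ≠ v) (hu : u ∉ l) :
    Function.update (ear Y γ α N u l v) u r = ear Y γ 0 (Function.update N u r) u l v := by
  cases l with
  | nil =>
    simp only [ear]
    rw [zero_smul, add_zero, Function.update_self, Function.update_comm huv.symm,
      Function.update_idem, Function.update_idem, Function.update_of_ne huv.symm]
  | cons x l =>
    simp only [List.mem_cons, not_or] at hu
    simp only [ear]
    rw [ear_update _ _ _ _ _ _ _ _ _ hu.1 huv hu.2]
    congr 1
    unfold addV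
    simp only [Function.update_idem, zero_smul, add_zero, Function.update_self]
    rw [Function.update_comm hu.1, Function.update_idem]

/-- Hypotheses under which an ear can be added. -/
structure EarOK (N : V → V → R) (u : V) (l : List V) (v : V) : Prop where
  huv : u ≠ v
  hu : u ∉ l
  hv : v ∉ l
  hl : l.Nodup
  hN : ∀ x ∈ l, Iso1 N x

section
variable {N : V → V → R} {u v : V} {l : List V} (Y : R)

theorem EarOK.update (h : EarOK N u l v) {z : V} (hz : z ∉ l) {r : V → R} (hr : ∀ x ∈ l, r x = 0) :
    EarOK (Function.update N z r) u l v :=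
  ⟨h.huv, h.hu, h.hv, h.hl, fun x hx => (h.hN x hx).update (by rintro rfl; exact hz hx) (hr x hx)⟩

theorem ee_zero {l : List V} {v : V} (hv : v ∉ l) : ∀ x ∈ l, ee R v x = 0 := by
  intro x hx
  apply Pi.single_eq_of_ne
  rintro rfl; exact hv hx

theorem EarOK.pr0 (h : EarOK N u l v) : pr (ear Y 1 1 N u l v) = Fs Y (l.length + 2) * pr N
      + Fs Y (l.length + 1) * (pr (Function.update N u (ee R u)) +
          pr (Function.update N v (ee R v)))
      + Fs Y l.length * (pr (Function.update (Function.update N u (ee R u)) v (ee R v)))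
      + pr (Function.update N u (ee R v)) + pr (Function.update N v (ee R u)) := by
  rw [pr_ear Y 1 l 1 N u v h.huv h.hu h.hv h.hl h.hN]; ring

theorem EarOK.pru (h : EarOK N u l v) :
    pr (Function.update (ear Y 1 1 N u l v) u (ee R u)) =
      Fs Y (l.length + 2) * pr (Function.update N u (ee R u))
      + Fs Y (l.length + 1) * pr (Function.update (Function.update N u (ee R u)) v (ee R v)) := by
  have h' := h.update h.hu (ee_zero (R := R) h.hu)
  rw [ear_update_u _ _ _ _ _ _ _ _ h.huv h.hu,
    pr_ear Y 1 l 0 _ u v h'.huv h'.hu h'.hv h'.hl h'.hN]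
  have : pr (Function.update (Function.update N u (ee R u)) v (ee R u)) = 0 := by
    apply pr_dup _ u v u h.huv <;> simp [h.huv]
  rw [this]; ring

theorem EarOK.prv (h : EarOK N u l v) :
    pr (Function.update (ear Y 1 1 N u l v) v (ee R v)) =
      Fs Y (l.length + 2) * pr (Function.update N v (ee R v))
      + Fs Y (l.length + 1) * pr (Function.update (Function.update N u (ee R u)) v (ee R v)) := by
  have h' := h.update h.hv (ee_zero (R := R) h.hv)
  rw [ear_update_v _ _ _ _ _ _ _ _ h.huv.symm h.hv,
    pr_ear Y 0 l 1 _ u v h'.huv h'.hu h'.hv h'.hl h'.hN]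
  have : pr (Function.update (Function.update N v (ee R v)) u (ee R v)) = 0 := by
    apply pr_dup _ u v v h.huv <;> simp [h.huv.symm]
  rw [this, Function.update_comm h.huv.symm]; ring

theorem EarOK.pruv (h : EarOK N u l v) :
    pr (Function.update (Function.update (ear Y 1 1 N u l v) u (ee R u)) v (ee R v)) =
      Fs Y (l.length + 2) * pr (Function.update (Function.update N u (ee R u)) v (ee R v)) := by
  have h' := (h.update h.hu (ee_zero (R := R) h.hu)).update h.hv (ee_zero (R := R) h.hv)
  rw [ear_update_u _ _ _ _ _ _ _ _ h.huv h.hu, ear_update_v _ _ _ _ _ _ _ _ h.huv.symm h.hv,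
    pr_ear Y 0 l 0 _ u v h'.huv h'.hu h'.hv h'.hl h'.hN]
  ring

theorem EarOK.prx (h : EarOK N u l v) :
    pr (Function.update (ear Y 1 1 N u l v) u (ee R v)) =
      Fs Y (l.length + 2) * pr (Function.update N u (ee R v))
      + pr (Function.update (Function.update N u (ee R u)) v (ee R v)) := by
  have h' := h.update h.hu (ee_zero (R := R) h.hv)
  rw [ear_update_u _ _ _ _ _ _ _ _ h.huv h.hu,
    pr_ear Y 1 l 0 _ u v h'.huv h'.hu h'.hv h'.hl h'.hN]
  have : pr (Function.update (Function.update N u (ee R v)) v (ee R v)) = 0 := by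
    apply pr_dup _ u v v h.huv <;> simp [h.huv]
  rw [this, pr_swap N u v h.huv (ee R v) (ee R u)]; ring

theorem EarOK.prx2 (h : EarOK N u l v) :
    pr (Function.update (ear Y 1 1 N u l v) v (ee R u)) =
      Fs Y (l.length + 2) * pr (Function.update N v (ee R u))
      + pr (Function.update (Function.update N u (ee R u)) v (ee R v)) := by
  have h' := h.update h.hv (ee_zero (R := R) h.hu)
  rw [ear_update_v _ _ _ _ _ _ _ _ h.huv.symm h.hv,
    pr_ear Y 0 l 1 _ u v h'.huv h'.hu h'.hv h'.hl h'.hN]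
  have : pr (Function.update (Function.update N v (ee R u)) u (ee R u)) = 0 := by
    apply pr_dup _ u v u h.huv <;> simp [h.huv, h.huv.symm]
  rw [this, pr_swap N v u h.huv.symm (ee R u) (ee R v), Function.update_comm h.huv.symm (ee R v) (ee R u) N]; ring

end

end PermRows


/-! ## Graphs, paths and degrees -/

section PathGraphs

variable {V : Type*}

/-- The path graph from `u` to `v` through the vertices of `l`. -/
def pathG : V → List V → V → SimpleGraph V
  | u, [], v => SimpleGraph.edge u v
  | u, x :: l, v => SimpleGraph.edge u x ⊔ pathG x l v

theorem pathG_adj_mem (l : List V) : ∀ (u v a b : V), (pathG u l v).Adj a b →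
    (a = u ∨ a = v ∨ a ∈ l) ∧ (b = u ∨ b = v ∨ b ∈ l) := by
  induction l with
  | nil =>
    intro u v a b h
    simp only [pathG, SimpleGraph.edge_adj] at h
    rcases h.1 with ⟨rfl, rfl⟩ | ⟨rfl, rfl⟩ <;> simp
  | cons x l ih =>
    intro u v a b h
    simp only [pathG, SimpleGraph.sup_adj, SimpleGraph.edge_adj] at h
    rcases h with h | h
    · rcases h.1 with ⟨rfl, rfl⟩ | ⟨rfl, rfl⟩ <;> simp
    · have := ih x v a b h
      simp only [List.mem_cons]
      tauto

/-- Degree, as a natural number. -/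
def dg (H : SimpleGraph V) (z : V) : ℕ := (H.neighborSet z).ncard

theorem dg_eq_zero [Finite V] {H : SimpleGraph V} {z : V} : dg H z = 0 ↔ ∀ y, ¬ H.Adj z y := by
  rw [dg, Set.ncard_eq_zero (Set.toFinite _), Set.eq_empty_iff_forall_notMem]
  rfl

theorem dg_sup [Finite V] {A B : SimpleGraph V} (h : ∀ x y, A.Adj x y → ¬ B.Adj x y) (z : V) :
    dg (A ⊔ B) z = dg A z + dg B z := by
  unfold dg
  rw [← Set.ncard_union_eq _ (Set.toFinite _) (Set.toFinite _)]
  · rfl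
  · rw [Set.disjoint_left]; intro y hy hy'; exact h z y hy hy'

theorem dg_edge {u v : V} (h : u ≠ v) (z : V) :
    dg (SimpleGraph.edge u v) z = (if z = u then 1 else 0) + (if z = v then 1 else 0) := by
  have : (SimpleGraph.edge u v).neighborSet z =
      if z = u then {v} else if z = v then {u} else ∅ := by
    ext y
    simp only [SimpleGraph.mem_neighborSet, SimpleGraph.edge_adj]
    split_ifs with h1 h2
    · subst h1
      simp only [Set.mem_singleton_iff]
      grind
    · simp only [Set.mem_singleton_iff]
      grind
    · simp; grind
  unfold dg
  rw [this]
  split_ifs with h1 h2 <;> simp_all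

theorem dg_pathG [Finite V] (l : List V) : ∀ (u v : V), u ≠ v → u ∉ l → v ∉ l → l.Nodup → ∀ z,
    dg (pathG u l v) z = (if z = u then 1 else 0) + (if z = v then 1 else 0) +
      (if z ∈ l then 2 else 0) := by
  induction l with
  | nil =>
    intro u v huv _ _ _ z
    simp [pathG, dg_edge huv]
  | cons x l ih =>
    intro u v huv hu hv hl z
    simp only [List.mem_cons, not_or, List.nodup_cons] at hu hv hl
    rw [pathG, dg_sup, dg_edge hu.1, ih x v (Ne.symm hv.1) hl.1 hv.2 hl.2]
    · simp only [List.mem_cons]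
      by_cases h1 : z = x
      · subst h1
        simp [hl.1]; omega
      · simp [h1]; omega
    · intro a b h1 h2
      have := pathG_adj_mem _ _ _ _ _ h2
      simp only [SimpleGraph.edge_adj] at h1
      grind

theorem dg_sdiff [Finite V] {H K : SimpleGraph V} (h : K ≤ H) (z : V) :
    dg (H \ K) z + dg K z = dg H z := by
  rw [← dg_sup, sdiff_sup_cancel h]
  intro x y h1 h2
  exact h1.2 h2

theorem exists_pathG_of_walk {H : SimpleGraph V} {u v : V} (p : H.Walk u v) : p.IsPath → u ≠ v →
    ∃ l : List V, u ∉ l ∧ v ∉ l ∧ l.Nodup ∧ pathG u l v ≤ H ∧ ∀ x ∈ l, x ∈ p.support := by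
  induction p with
  | nil => intro _ h; exact absurd rfl h
  | @cons u x v hux p ih =>
    intro hp huv
    rw [SimpleGraph.Walk.cons_isPath_iff] at hp
    have he : SimpleGraph.edge u x ≤ H := by
      intro a b hab
      simp only [SimpleGraph.edge_adj] at hab
      rcases hab.1 with ⟨rfl, rfl⟩ | ⟨rfl, rfl⟩
      · exact hux
      · exact hux.symm
    by_cases hxv : x = v
    · subst hxv
      exact ⟨[], by simp, by simp, by simp, he, by simp⟩
    · obtain ⟨l, h1, h2, h3, h4, h5⟩ := ih hp.1 hxv
      refine ⟨x :: l, ?_, ?_, ?_, ?_, ?_⟩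
      · simp only [List.mem_cons, not_or]
        exact ⟨hux.ne, fun h => hp.2 (h5 _ h)⟩
      · simp only [List.mem_cons, not_or]
        exact ⟨Ne.symm hxv, h2⟩
      · exact List.nodup_cons.2 ⟨h1, h3⟩
      · exact sup_le he h4
      · intro y hy
        rw [SimpleGraph.Walk.support_cons, List.mem_cons]
        rcases List.mem_cons.1 hy with rfl | hy
        · exact Or.inr p.start_mem_support
        · exact Or.inr (h5 y hy)

theorem exists_pathG {H : SimpleGraph V} {u v : V} (h : H.Reachable u v) (huv : u ≠ v) :
    ∃ l : List V, u ∉ l ∧ v ∉ l ∧ l.Nodup ∧ pathG u l v ≤ H ∧ ∀ x ∈ l, H.Reachable u x := by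
  obtain ⟨p, hp⟩ := h.exists_isPath
  obtain ⟨l, h1, h2, h3, h4, h5⟩ := exists_pathG_of_walk p hp huv
  refine ⟨l, h1, h2, h3, h4, fun x hx => ⟨p.takeUntil x (h5 x hx)⟩⟩

theorem dg_eq_degree (H : SimpleGraph V) (z : V) [Fintype (H.neighborSet z)] : dg H z = H.degree z := by
  rw [dg, ← SimpleGraph.card_neighborSet_eq_degree, Set.ncard_eq_toFinset_card', Set.toFinset_card]

theorem reachable_of_parity [Finite V] {H : SimpleGraph V} {x y : V} (hx : Odd (dg H x))
    (h : ∀ z, z ≠ x → z ≠ y → Even (dg H z)) : H.Reachable x y := by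
  by_contra hxy
  have := Fintype.ofFinite V
  let K : SimpleGraph V :=
    { Adj := fun a b => H.Adj a b ∧ H.Reachable x a
      symm := ⟨fun a b hab => ⟨hab.1.symm, hab.2.trans hab.1.reachable⟩⟩
      loopless := ⟨fun a h => H.loopless.irrefl a h.1⟩ }
  have hK : ∀ z, dg K z = if H.Reachable x z then dg H z else 0 := by
    intro z
    split_ifs with hz
    · unfold dg; congr 1; ext b
      simp [K, hz]
    · rw [dg_eq_zero]
      intro b hb; exact hz hb.2
  have h1 := K.even_card_odd_degree_vertices
  have h2 : (Finset.univ.filter fun v => Odd (K.degree v)) = {x} := by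
    ext z
    simp only [Finset.mem_filter, Finset.mem_univ, true_and, Finset.mem_singleton]
    rw [← dg_eq_degree, hK]
    constructor
    · intro hz
      by_contra hzx
      split_ifs at hz with h3
      · have : z ≠ y := by rintro rfl; exact hxy h3
        exact (Nat.not_even_iff_odd.2 hz) (h z hzx this)
      · simp at hz
    · rintro rfl; simpa using hx
  rw [h2] at h1
  simp at h1

end PathGraphs


/-! ## Weighted adjacency matrices and ears -/

section Mats

set_option linter.unusedSectionVars false

variable {V : Type*} [Fintype V] {R : Type*} [CommRing R]

/-- Adjacency matrix with diagonal weights. -/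
def mat (H : SimpleGraph V) (d : V → R) : V → V → R := fun i j =>
  if i = j then d i else if H.Adj i j then 1 else 0

/-- Overwrite the weights on a list. -/
def ov (d : V → R) (l : List V) (Y : R) : V → R := fun z => if z ∈ l then Y else d z

theorem mat_iso1 {H : SimpleGraph V} {d : V → R} {x : V} (h : ∀ y, ¬ H.Adj x y) (hd : d x = 1) :
    Iso1 (mat H d) x := by
  refine ⟨?_, ?_⟩
  · funext j
    by_cases hj : x = j
    · subst hj; simp [mat, hd]
    · simp [mat, hj, h, Ne.symm hj]
  · intro z hz
    have : ¬ H.Adj z x := fun h' => h z h'.symm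
    simp [mat, hz, this]

theorem mat_update_iso {H : SimpleGraph V} {d : V → R} {x : V} (h : ∀ y, ¬ H.Adj x y) (w : R) :
    mat H (Function.update d x w) = Function.update (mat H d) x (w • ee R x) := by
  funext i j
  by_cases hi : i = x
  · subst hi
    by_cases hj : i = j
    · subst hj; simp [mat]
    · simp [mat, hj, h, Ne.symm hj]
  · simp [mat, hi]

theorem addV_mat (Y : R) {H : SimpleGraph V} {d : V → R} {u x : V} (hux : u ≠ x)
    (h : ∀ y, ¬ H.Adj x y) :
    addV Y 1 (mat H d) u x = mat (H ⊔ SimpleGraph.edge u x) (Function.update d x Y) := by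
  funext i j
  have h' : ∀ y, ¬ H.Adj y x := fun y hy => h y hy.symm
  by_cases hi : i = u
  · subst hi
    by_cases hj : i = j
    · subst hj; simp [addV, mat, hux, SimpleGraph.edge_adj]
    · by_cases hjx : j = x
      · subst hjx; simp [addV, mat, hux, SimpleGraph.edge_adj, h']
      · simp [addV, mat, hj, hjx, hux, SimpleGraph.edge_adj]
  · by_cases hix : i = x
    · subst hix
      by_cases hj : i = j
      · subst hj; simp [addV, mat, hi]
      · by_cases hju : j = u
        · subst hju; simp [addV, mat, hj, SimpleGraph.edge_adj, hux]
        · simp [addV, mat, hi, hj, hju, SimpleGraph.edge_adj, hux.symm, h, Ne.symm hj]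
    · simp [addV, mat, hi, hix, SimpleGraph.edge_adj]

theorem ear_mat (Y : R) (l : List V) : ∀ (H : SimpleGraph V) (d : V → R) (u v : V),
    u ≠ v → u ∉ l → v ∉ l → l.Nodup → (∀ x ∈ l, ∀ y, ¬ H.Adj x y) → (l = [] → ¬ H.Adj u v) →
    ear Y 1 1 (mat H d) u l v = mat (H ⊔ pathG u l v) (ov d l Y) := by
  induction l with
  | nil =>
    intro H d u v huv _ _ _ _ hadj
    have h1 := hadj rfl
    have h2 : ¬ H.Adj v u := fun h => h1 h.symm
    have h0 : ov d [] Y = d := by funext z; simp [ov]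
    rw [h0]
    funext i j
    simp only [ear, pathG]
    by_cases hi : i = u
    · subst hi
      by_cases hj : i = j
      · subst hj; simp [mat, huv]
      · by_cases hjv : j = v
        · subst hjv; simp [mat, huv, SimpleGraph.edge_adj, h1]
        · simp [mat, hj, hjv, huv, SimpleGraph.edge_adj]
    · by_cases hix : i = v
      · subst hix
        by_cases hj : i = j
        · subst hj; simp [mat, hi]
        · by_cases hju : j = u
          · subst hju; simp [mat, hj, SimpleGraph.edge_adj, h2]
          · simp [mat, hi, hj, hju, SimpleGraph.edge_adj]
      · simp [mat, hi, hix, SimpleGraph.edge_adj]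
  | cons x l ih =>
    intro H d u v huv hu hv hl hH _
    simp only [List.mem_cons, not_or, List.nodup_cons] at hu hv hl
    rw [ear, addV_mat Y hu.1 (hH x (by simp)), ih _ _ x v (Ne.symm hv.1) hl.1 hv.2 hl.2]
    · have : ov (Function.update d x Y) l Y = ov d (x :: l) Y := by
        funext z
        by_cases hz : z = x
        · subst hz; simp [ov]
        · simp [ov, hz]
      rw [this, pathG, sup_assoc]
    · intro z hz y
      simp only [SimpleGraph.sup_adj, SimpleGraph.edge_adj, not_or]
      refine ⟨hH z (by simp [hz]) y, ?_⟩
      have : z ≠ u := by rintro rfl; exact hu.2 hz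
      have : z ≠ x := by rintro rfl; exact hl.1 hz
      tauto
    · intro _
      simp only [SimpleGraph.sup_adj, SimpleGraph.edge_adj, not_or]
      refine ⟨hH x (by simp) v, ?_⟩
      rintro ⟨⟨h1, h2⟩ | ⟨h1, h2⟩, h3⟩
      · exact hu.1 h1.symm
      · exact huv h2.symm

/-- The state of a matrix with respect to two vertices. -/
structure St (N : V → V → R) (u v : V) (s0 s1 s3 s4 : R) : Prop where
  p0 : pr N = s0
  p1 : pr (Function.update N u (ee R u)) = s1
  p2 : pr (Function.update N v (ee R v)) = s1
  p3 : pr (Function.update (Function.update N u (ee R u)) v (ee R v)) = s3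
  p4 : pr (Function.update N u (ee R v)) + pr (Function.update N v (ee R u)) = s4

theorem St.ear {N : V → V → R} {u v : V} {s0 s1 s3 s4 : R} (h : St N u v s0 s1 s3 s4) (Y : R)
    {l : List V} (hE : EarOK N u l v) :
    St (ear Y 1 1 N u l v) u v
      (Fs Y (l.length + 2) * s0 + 2 * Fs Y (l.length + 1) * s1 + Fs Y l.length * s3 + s4)
      (Fs Y (l.length + 2) * s1 + Fs Y (l.length + 1) * s3)
      (Fs Y (l.length + 2) * s3)
      (Fs Y (l.length + 2) * s4 + 2 * s3) := by
  refine ⟨?_, ?_, ?_, ?_, ?_⟩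
  · rw [hE.pr0, h.p0, h.p1, h.p2, h.p3, ← h.p4]; ring
  · rw [hE.pru, h.p1, h.p3]
  · rw [hE.prv, h.p2, h.p3]
  · rw [hE.pruv, h.p3]
  · rw [hE.prx, hE.prx2, h.p3, ← h.p4]; ring

theorem St.base {M : V → V → R} {u v : V} (huv : u ≠ v) (hu : Iso1 M u) (hv : Iso1 M v) (w : R) :
    St (Function.update (Function.update M u (w • ee R u)) v (w • ee R v)) u v
      (w * w * pr M) (w * pr M) (pr M) 0 := by
  have eu : Function.update M u (ee R u) = M := by rw [← hu.1, Function.update_eq_self]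
  have ev : Function.update M v (ee R v) = M := by rw [← hv.1, Function.update_eq_self]
  refine ⟨?_, ?_, ?_, ?_, ?_⟩
  · rw [pr_update_smul, Function.update_comm huv, pr_update_smul, ev, eu]; ring
  · rw [Function.update_comm huv.symm, Function.update_idem, pr_update_smul, eu, ev]
  · rw [Function.update_idem, Function.update_comm huv, pr_update_smul, ev, eu]
  · rw [Function.update_comm huv.symm, Function.update_idem, Function.update_idem, eu, ev]
  · rw [Function.update_comm huv.symm, Function.update_idem, Function.update_idem, pr_update_smul,
      Function.update_comm huv (w • ee R u) (ee R u) M, pr_update_smul]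
    rw [pr_dup _ u v v huv (by simp [huv]) (by simp), pr_dup _ u v u huv (by simp) (by simp [huv.symm])]
    ring

/-- Attaching a cycle at `u` through `x` and `l`. -/
def loopN (Y : R) (N : V → V → R) (x : V) (l : List V) (u : V) : V → V → R :=
  ear Y 1 1 (ear Y 1 1 (Function.update N x (Y • ee R x)) x l u) x [] u

theorem loopN_pr (Y : R) {N : V → V → R} {x u : V} {l : List V} (h : EarOK N x l u)
    (hx : Iso1 N x) :
    pr (loopN Y N x l u) = Fs Y (l.length + 3) * pr N
        + (2 * Fs Y (l.length + 2) + 2) * pr (Function.update N u (ee R u)) ∧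
    pr (Function.update (loopN Y N x l u) u (ee R u)) =
      Fs Y (l.length + 3) * pr (Function.update N u (ee R u)) := by
  have hxu := h.huv
  have h1 : EarOK (Function.update N x (Y • ee R x)) x l u := by
    apply h.update h.hu
    intro z hz
    simp [ee_zero (R := R) h.hu z hz]
  have h2 : EarOK (ear Y 1 1 (Function.update N x (Y • ee R x)) x l u) x [] u :=
    ⟨hxu, by simp, by simp, by simp, by simp⟩
  have ex : Function.update N x (ee R x) = N := by rw [← hx.1, Function.update_eq_self]
  have q0 : pr (Function.update N x (Y • ee R x)) = Y * pr N := by rw [pr_update_smul, ex]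
  have q1 : pr (Function.update (Function.update N x (Y • ee R x)) x (ee R x)) = pr N := by
    rw [Function.update_idem, ex]
  have q2 : pr (Function.update (Function.update N x (Y • ee R x)) u (ee R u)) =
      Y * pr (Function.update N u (ee R u)) := by
    rw [Function.update_comm hxu, pr_update_smul, Function.update_comm hxu.symm, ex]
  have q3 : pr (Function.update (Function.update (Function.update N x (Y • ee R x)) x (ee R x)) u
      (ee R u)) = pr (Function.update N u (ee R u)) := by
    rw [Function.update_idem, ex]
  have q4 : pr (Function.update (Function.update N x (Y • ee R x)) x (ee R u)) = 0 := by
    rw [Function.update_idem]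
    apply pr_zero_col _ x
    intro z
    by_cases hz : z = x
    · subst hz; simp [hxu]
    · rw [Function.update_of_ne hz]; exact hx.2 z hz
  have q5 : pr (Function.update (Function.update N x (Y • ee R x)) u (ee R x)) = 0 := by
    rw [Function.update_comm hxu, pr_update_smul,
      pr_dup _ x u x hxu (by simp) (by simp [hxu.symm])]
    simp
  unfold loopN
  constructor
  · rw [h2.pr0, h1.pr0, h1.pru, h1.prv, h1.pruv, h1.prx, h1.prx2, q0, q1, q2, q3, q4, q5]
    simp only [List.length_nil, Fs]
    ring
  · rw [h2.prv, h1.prv, h1.pruv, q2, q3]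
    simp only [List.length_nil, Fs]
    ring

theorem loopN_update (Y : R) (N : V → V → R) {x u z : V} {l : List V} (hzx : z ≠ x) (hzu : z ≠ u)
    (hzl : z ∉ l) (r : V → R) :
    Function.update (loopN Y N x l u) z r = loopN Y (Function.update N z r) x l u := by
  unfold loopN
  rw [ear_update _ _ _ _ _ _ _ _ _ hzx hzu (by simp), ear_update _ _ _ _ _ _ _ _ _ hzx hzu hzl,
    Function.update_comm hzx]

theorem loopN_mat (Y : R) {H : SimpleGraph V} {d : V → R} {x u : V} {l : List V}
    (hxu : x ≠ u) (hx : x ∉ l) (hu : u ∉ l) (hl : l.Nodup) (hne : l ≠ [])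
    (hHx : ∀ y, ¬ H.Adj x y) (hH : ∀ z ∈ l, ∀ y, ¬ H.Adj z y) :
    loopN Y (mat H d) x l u = mat (H ⊔ pathG x l u ⊔ SimpleGraph.edge x u) (ov d (x :: l) Y) := by
  unfold loopN
  rw [← mat_update_iso hHx, ear_mat Y l H _ x u hxu hx hu hl hH (fun h => absurd h hne), ear_mat]
  · have : ov (ov (Function.update d x Y) l Y) [] Y = ov d (x :: l) Y := by
      funext z
      by_cases hz : z = x
      · subst hz; simp [ov]
      · simp [ov, hz]
    rw [this, pathG]
  · exact hxu
  · simp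
  · simp
  · simp
  · simp
  · intro _
    rw [SimpleGraph.sup_adj, not_or]
    refine ⟨hHx u, ?_⟩
    cases l with
    | nil => exact absurd rfl hne
    | cons y l =>
      simp only [List.mem_cons, not_or, List.nodup_cons] at hx hu
      simp only [pathG, SimpleGraph.sup_adj, SimpleGraph.edge_adj]
      rintro (h | h)
      · rcases h.1 with ⟨_, h⟩ | ⟨_, h⟩
        · exact hu.1 h
        · exact hxu h.symm
      · have := (pathG_adj_mem _ _ _ _ _ h).1
        tauto

/-- State polynomial of a theta graph. -/
def thF (Y w : R) (k1 k2 k3 : ℕ) : R :=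
  let a0 := Fs Y (k1 + 2) * (w * w) + 2 * Fs Y (k1 + 1) * w + Fs Y k1
  let a1 := Fs Y (k1 + 2) * w + Fs Y (k1 + 1)
  let a3 := Fs Y (k1 + 2)
  let a4 : R := 2
  let b0 := Fs Y (k2 + 2) * a0 + 2 * Fs Y (k2 + 1) * a1 + Fs Y k2 * a3 + a4
  let b1 := Fs Y (k2 + 2) * a1 + Fs Y (k2 + 1) * a3
  let b3 := Fs Y (k2 + 2) * a3
  let b4 := Fs Y (k2 + 2) * a4 + 2 * a3
  Fs Y (k3 + 2) * b0 + 2 * Fs Y (k3 + 1) * b1 + Fs Y k3 * b3 + b4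

/-- Polynomial of a dumbbell graph: connecting path with `k` internal vertices, cycles of length
`b`, `c`. -/
def dbF (Y w : R) (k b c : ℕ) : R :=
  let p := Fs Y (k + 2) * (w * w) + 2 * Fs Y (k + 1) * w + Fs Y k
  let q := Fs Y (k + 2) * w + Fs Y (k + 1)
  let s := Fs Y (k + 2)
  Fs Y (c + 1) * (Fs Y (b + 1) * p + (2 * Fs Y b + 2) * q)
    + (2 * Fs Y c + 2) * (Fs Y (b + 1) * q + (2 * Fs Y b + 2) * s)

theorem theta_pr (Y w : R) {H : SimpleGraph V} {d : V → R} {u v : V} {l1 l2 l3 : List V}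
    (hnd : (u :: v :: (l1 ++ l2 ++ l3)).Nodup)
    (hiso : ∀ z ∈ u :: v :: (l1 ++ l2 ++ l3), ∀ y, ¬ H.Adj z y)
    (hd : ∀ z ∈ u :: v :: (l1 ++ l2 ++ l3), d z = 1)
    (h12 : l1 ≠ [] ∨ l2 ≠ []) (h13 : l1 ≠ [] ∨ l3 ≠ []) (h23 : l2 ≠ [] ∨ l3 ≠ []) :
    pr (mat (H ⊔ pathG u l1 v ⊔ pathG u l2 v ⊔ pathG u l3 v)
      (ov (ov (ov (Function.update (Function.update d u w) v w) l1 Y) l2 Y) l3 Y)) =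
      thF Y w l1.length l2.length l3.length * pr (mat H d) := by
  simp only [List.nodup_cons, List.mem_cons, List.mem_append, not_or, List.nodup_append'] at hnd hiso hd
  obtain ⟨⟨huv, ⟨hu1, hu2⟩, hu3⟩, ⟨⟨hv1, hv2⟩, hv3⟩, ⟨⟨n1, n2, n12⟩, n3, n123⟩⟩ := hnd
  have d12 : ∀ z ∈ l1, z ∉ l2 := fun z h h' => n12 h h'
  have d13 : ∀ z ∈ l1, z ∉ l3 := fun z h h' => n123 (by simp [h]) h'
  have d23 : ∀ z ∈ l2, z ∉ l3 := fun z h h' => n123 (by simp [h]) h'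
  have iu := hiso u (by simp)
  have iv := hiso v (by simp)
  have i1 : ∀ z ∈ l1, ∀ y, ¬ H.Adj z y := fun z hz => hiso z (by simp [hz])
  have i2 : ∀ z ∈ l2, ∀ y, ¬ (H ⊔ pathG u l1 v).Adj z y := by
    intro z hz y
    rw [SimpleGraph.sup_adj, not_or]
    refine ⟨hiso z (by simp [hz]) y, fun h => ?_⟩
    have := (pathG_adj_mem _ _ _ _ _ h).1
    rcases this with rfl | rfl | h'
    · exact hu2 hz
    · exact hv2 hz
    · exact d12 _ h' hz
  have i3 : ∀ z ∈ l3, ∀ y, ¬ (H ⊔ pathG u l1 v ⊔ pathG u l2 v).Adj z y := by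
    intro z hz y
    rw [SimpleGraph.sup_adj, SimpleGraph.sup_adj, not_or, not_or]
    refine ⟨⟨hiso z (by simp [hz]) y, fun h => ?_⟩, fun h => ?_⟩
    · have := (pathG_adj_mem _ _ _ _ _ h).1
      rcases this with rfl | rfl | h'
      · exact hu3 hz
      · exact hv3 hz
      · exact d13 _ h' hz
    · have := (pathG_adj_mem _ _ _ _ _ h).1
      rcases this with rfl | rfl | h'
      · exact hu3 hz
      · exact hv3 hz
      · exact d23 _ h' hz
  have key : ∀ l : List V, u ∉ l → v ∉ l → l ≠ [] → ¬ (pathG u l v).Adj u v := by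
    intro l hul hvl hne
    cases l with
    | nil => exact absurd rfl hne
    | cons y l =>
      simp only [List.mem_cons, not_or] at hul hvl
      simp only [pathG, SimpleGraph.sup_adj, SimpleGraph.edge_adj]
      rintro (h | h)
      · rcases h.1 with ⟨_, h⟩ | ⟨h, _⟩
        · exact hvl.1 h
        · exact hul.1 h
      · have := (pathG_adj_mem _ _ _ _ _ h).1
        tauto
  have ne_u : ∀ {l : List V} {z}, u ∉ l → z ∈ l → z ≠ u := by rintro l z h h' rfl; exact h h'
  have ne_v : ∀ {l : List V} {z}, v ∉ l → z ∈ l → z ≠ v := by rintro l z h h' rfl; exact h h'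
  have hb := St.base huv (mat_iso1 iu (hd u (by simp))) (mat_iso1 iv (hd v (by simp))) w
  rw [← mat_update_iso iu, ← mat_update_iso iv] at hb
  have hs1 := hb.ear Y (l := l1) ⟨huv, hu1, hv1, n1, fun z hz => mat_iso1 (i1 z hz) (by
    rw [Function.update_of_ne (ne_v hv1 hz), Function.update_of_ne (ne_u hu1 hz)]
    exact hd z (by simp [hz]))⟩
  rw [ear_mat Y l1 H _ u v huv hu1 hv1 n1 i1 (fun _ => iu v)] at hs1
  have hs2 := hs1.ear Y (l := l2) ⟨huv, hu2, hv2, n2, fun z hz => mat_iso1 (i2 z hz) (by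
    rw [ov, if_neg (fun h => d12 z h hz), Function.update_of_ne (ne_v hv2 hz),
      Function.update_of_ne (ne_u hu2 hz)]
    exact hd z (by simp [hz]))⟩
  rw [ear_mat Y l2 _ _ u v huv hu2 hv2 n2 i2] at hs2
  · have hs3 := hs2.ear Y (l := l3) ⟨huv, hu3, hv3, n3, fun z hz => mat_iso1 (i3 z hz) (by
      rw [ov, if_neg (fun h => d23 z h hz), ov, if_neg (fun h => d13 z h hz),
        Function.update_of_ne (ne_v hv3 hz), Function.update_of_ne (ne_u hu3 hz)]
      exact hd z (by simp [hz]))⟩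
    rw [ear_mat Y l3 _ _ u v huv hu3 hv3 n3 i3] at hs3
    · rw [hs3.p0]
      simp only [thF]
      ring
    · intro h
      have e1 := h13.resolve_right (fun h' => h' h)
      have e2 := h23.resolve_right (fun h' => h' h)
      rw [SimpleGraph.sup_adj, SimpleGraph.sup_adj, not_or, not_or]
      exact ⟨⟨iu v, key l1 hu1 hv1 e1⟩, key l2 hu2 hv2 e2⟩
  · intro h
    have e1 := h12.resolve_right (fun h' => h' h)
    rw [SimpleGraph.sup_adj, not_or]
    exact ⟨iu v, key l1 hu1 hv1 e1⟩

end Mats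


/-! ## Structure of graphs with two vertices of degree three and all others of degree two -/

section Struct

set_option linter.unusedSectionVars false

variable {V : Type*} [Fintype V] {R : Type*} [CommRing R]

theorem pr_unit : pr (fun i : V => ee R i) = 1 := by
  unfold pr
  rw [Finset.sum_eq_single 1]
  · simp
  · intro σ _ hσ
    obtain ⟨i, hi⟩ : ∃ i, σ i ≠ i := by
      by_contra h
      push Not at h
      exact hσ (Equiv.ext h)
    exact Finset.prod_eq_zero (Finset.mem_univ i) (Pi.single_eq_of_ne hi _)
  · simp

theorem edge_le {H : SimpleGraph V} {x u : V} (h : H.Adj x u) : SimpleGraph.edge x u ≤ H := by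
  intro a b hab
  simp only [SimpleGraph.edge_adj] at hab
  rcases hab.1 with ⟨rfl, rfl⟩ | ⟨rfl, rfl⟩
  · exact h
  · exact h.symm

theorem not_iso_dg {H : SimpleGraph V} {z : V} (h : dg H z = 0) : ∀ y, ¬ H.Adj z y := dg_eq_zero.1 h

theorem cycle_extract {H : SimpleGraph V} (hH : ∀ z, dg H z = 0 ∨ dg H z = 2) {u : V}
    (hu : dg H u = 2) : ∃ (x : V) (l : List V) (H' : SimpleGraph V), x ≠ u ∧ x ∉ l ∧ u ∉ l ∧
      l.Nodup ∧ l ≠ [] ∧ H = H' ⊔ pathG x l u ⊔ SimpleGraph.edge x u ∧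
      (∀ z, dg H' z = if z = u ∨ z = x ∨ z ∈ l then 0 else dg H z) ∧
      (∀ z, z = x ∨ z ∈ l → H.Reachable u z ∧ dg H z = 2) := by
  have hx : ∃ x, H.Adj x u := by
    by_contra h
    push Not at h
    have : dg H u = 0 := dg_eq_zero.2 (fun y hy => h y hy.symm)
    omega
  obtain ⟨x, hx⟩ := hx
  have hxu : x ≠ u := hx.ne
  have hE := edge_le hx
  have d1 := fun z => dg_sdiff hE z
  have dE := fun z => dg_edge hxu z
  have hdx : dg H x = 2 := by
    have := d1 x
    rw [dE] at this
    have := hH x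
    simp at *
    omega
  have hr : (H \ SimpleGraph.edge x u).Reachable x u := by
    apply reachable_of_parity
    · have := d1 x
      rw [dE] at this
      simp [hxu] at this
      have : dg (H \ SimpleGraph.edge x u) x = 1 := by omega
      rw [this]; exact odd_one
    · intro z h1 h2
      have := d1 z
      rw [dE] at this
      simp [h1, h2] at this
      rw [this]
      rcases hH z with h | h <;> rw [h] <;> decide
  obtain ⟨l, h1, h2, h3, h4, h5⟩ := exists_pathG hr hxu
  have hne : l ≠ [] := by
    rintro rfl
    have : (pathG x [] u).Adj x u := by simp [pathG, SimpleGraph.edge_adj, hxu]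
    have := h4 this
    rw [SimpleGraph.sdiff_adj] at this
    exact this.2 (by simp [SimpleGraph.edge_adj, hxu])
  have d2 := fun z => dg_sdiff h4 z
  have dP := fun z => dg_pathG l x u hxu h1 h2 h3 z
  have hl2 : ∀ z ∈ l, dg H z = 2 := by
    intro z hz
    have e1 := d1 z
    have e2 := d2 z
    rw [dP, if_pos hz] at e2
    have := hH z
    omega
  refine ⟨x, l, (H \ SimpleGraph.edge x u) \ pathG x l u, hxu, h1, h2, h3, hne, ?_, ?_, ?_⟩
  · rw [sdiff_sup_cancel h4, sdiff_sup_cancel hE]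
  · intro z
    have e1 := d1 z
    have e2 := d2 z
    rw [dE] at e1
    rw [dP] at e2
    by_cases hz : z ∈ l
    · have := hl2 z hz
      simp [hz] at *
      omega
    · by_cases hzx : z = x
      · subst hzx; simp [hz, hxu] at *; omega
      · by_cases hzu : z = u
        · subst hzu; simp [hz, hzx] at *; omega
        · simp [hz, hzx, hzu] at *; omega
  · rintro z (rfl | hz)
    · exact ⟨hx.symm.reachable, hdx⟩
    · exact ⟨hx.symm.reachable.trans ((h5 z hz).mono sdiff_le), hl2 z hz⟩

/-- Weights of the part of the graph made of disjoint cycles. -/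
def wt (H : SimpleGraph V) (Y : R) : V → R := fun z => if dg H z = 2 then Y else 1

/-- Polynomial of a cycle. -/
def cyc (Y : R) (k : ℕ) : R := Fs Y (k + 2) + Fs Y k + 2

theorem rest_pr (Y : R) : ∀ (n : ℕ) (H : SimpleGraph V), (∀ z, dg H z = 0 ∨ dg H z = 2) →
    (Finset.univ.filter fun z => dg H z = 2).card = n →
    ∃ K : List ℕ, (∀ k ∈ K, 3 ≤ k) ∧ pr (mat H (wt H Y)) = (K.map (cyc Y)).prod := by
  intro n
  induction n using Nat.strong_induction_on with
  | _ n ih =>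
  intro H hH hn
  by_cases hex : ∃ u, dg H u = 2
  · obtain ⟨u, hu⟩ := hex
    obtain ⟨x, l, H', hxu, hxl, hul, hl, hne, hEq, hdg, hmem⟩ := cycle_extract hH hu
    have hH' : ∀ z, dg H' z = 0 ∨ dg H' z = 2 := by
      intro z
      rw [hdg]
      split_ifs
      · simp
      · exact hH z
    have hlt : (Finset.univ.filter fun z => dg H' z = 2).card < n := by
      rw [← hn]
      apply Finset.card_lt_card
      rw [Finset.ssubset_iff_of_subset]
      · refine ⟨u, by simp [hu], by simp [hdg]⟩
      · intro z
        simp only [Finset.mem_filter, Finset.mem_univ, true_and, hdg]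
        split_ifs <;> simp
    obtain ⟨K, hK, hpr⟩ := ih _ hlt H' hH' rfl
    refine ⟨(l.length + 2) :: K, ?_, ?_⟩
    · have : l.length ≠ 0 := by simpa using hne
      intro k hk
      rcases List.mem_cons.1 hk with rfl | hk
      · omega
      · exact hK k hk
    · have i0 : ∀ z, z = u ∨ z = x ∨ z ∈ l → dg H' z = 0 := fun z hz => by rw [hdg, if_pos hz]
      have w1 : ∀ z, z = u ∨ z = x ∨ z ∈ l → wt H' Y z = 1 := fun z hz => by
        rw [wt, i0 z hz]; simp
      have iu : ∀ y, ¬ H'.Adj u y := not_iso_dg (i0 u (by simp))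
      have ix : ∀ y, ¬ H'.Adj x y := not_iso_dg (i0 x (by simp))
      have il : ∀ z ∈ l, ∀ y, ¬ H'.Adj z y := fun z hz => not_iso_dg (i0 z (by simp [hz]))
      have hE : EarOK (mat H' (Function.update (wt H' Y) u Y)) x l u :=
        ⟨hxu, hxl, hul, hl, fun z hz => mat_iso1 (il z hz) (by
          rw [Function.update_of_ne (by rintro rfl; exact hul hz), w1 z (by simp [hz])])⟩
      have hI : Iso1 (mat H' (Function.update (wt H' Y) u Y)) x :=
        mat_iso1 ix (by rw [Function.update_of_ne hxu, w1 x (by simp)])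
      have h1 := (loopN_pr Y hE hI).1
      rw [loopN_mat Y hxu hxl hul hl hne ix il, ← hEq] at h1
      have hw : ov (Function.update (wt H' Y) u Y) (x :: l) Y = wt H Y := by
        funext z
        unfold ov
        by_cases hz : z ∈ x :: l
        · rw [if_pos hz, wt, (hmem z (List.mem_cons.1 hz)).2]; simp
        · rw [if_neg hz]
          by_cases hzu : z = u
          · subst hzu; simp [wt, hu]
          · simp only [List.mem_cons, not_or] at hz
            have e := hdg z
            rw [if_neg (by simp [hzu, hz.1, hz.2])] at e
            rw [Function.update_of_ne hzu, wt, wt, e]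
      rw [hw] at h1
      rw [h1, mat_update_iso iu, pr_update_smul, Function.update_idem]
      have : Function.update (mat H' (wt H' Y)) u (ee R u) = mat H' (wt H' Y) := by
        rw [← (mat_iso1 iu (w1 u (by simp))).1, Function.update_eq_self]
      rw [this, hpr, List.map_cons, List.prod_cons, cyc]
      simp only [Fs]
      ring
  · push Not at hex
    refine ⟨[], by simp, ?_⟩
    have : mat H (wt H Y) = fun i : V => ee R i := by
      funext z
      have h0 : dg H z = 0 := (hH z).resolve_right (hex z)
      exact (mat_iso1 (not_iso_dg h0) (by simp [wt, h0])).1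
    rw [this, pr_unit]
    simp

theorem dumbbell_pr (Y w : R) {H : SimpleGraph V} {d : V → R} {u v x y : V} {l m m' : List V}
    (huv : u ≠ v) (hul : u ∉ l) (hvl : v ∉ l) (hl : l.Nodup)
    (hxv : x ≠ v) (hxm : x ∉ m) (hvm : v ∉ m) (hm : m.Nodup) (hmne : m ≠ [])
    (hyu : y ≠ u) (hym : y ∉ m') (hum : u ∉ m') (hm' : m'.Nodup) (hmne' : m' ≠ [])
    (hux : u ∉ x :: m)
    (hlx : ∀ z ∈ l, z ∉ x :: m) (hly : ∀ z ∈ l, z ∉ y :: m')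
    (hxy : ∀ z ∈ x :: m, z ∉ y :: m') (hvy : v ∉ y :: m')
    (hiso : ∀ z, z = u ∨ z = v ∨ z ∈ l ∨ z ∈ x :: m ∨ z ∈ y :: m' → ∀ t, ¬ H.Adj z t)
    (hd : ∀ z, z = u ∨ z = v ∨ z ∈ l ∨ z ∈ x :: m ∨ z ∈ y :: m' → d z = 1) :
    pr (mat (H ⊔ pathG u l v ⊔ pathG x m v ⊔ SimpleGraph.edge x v ⊔ pathG y m' u ⊔
        SimpleGraph.edge y u)
      (ov (ov (ov (Function.update (Function.update d u w) v w) l Y) (x :: m) Y) (y :: m') Y)) =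
      dbF Y w l.length (m.length + 2) (m'.length + 2) * pr (mat H d) := by
  have iu := hiso u (by simp)
  have iv := hiso v (by simp)
  have il : ∀ z ∈ l, ∀ y, ¬ H.Adj z y := fun z hz => hiso z (by simp [hz])
  have hb := St.base huv (mat_iso1 iu (hd u (by simp))) (mat_iso1 iv (hd v (by simp))) w
  rw [← mat_update_iso iu, ← mat_update_iso iv] at hb
  have nev : ∀ z ∈ l, z ≠ v := by rintro z hz rfl; exact hvl hz
  have neu : ∀ z ∈ l, z ≠ u := by rintro z hz rfl; exact hul hz
  have hs1 := hb.ear Y (l := l) ⟨huv, hul, hvl, hl, fun z hz => mat_iso1 (il z hz) (by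
    rw [Function.update_of_ne (nev z hz), Function.update_of_ne (neu z hz)]
    exact hd z (by simp [hz]))⟩
  rw [ear_mat Y l H _ u v huv hul hvl hl il (fun _ => iu v)] at hs1
  -- isolation in the second graph
  have i2 : ∀ z, z ∈ x :: m ∨ z ∈ y :: m' → ∀ t, ¬ (H ⊔ pathG u l v).Adj z t := by
    intro z hz t
    rw [SimpleGraph.sup_adj, not_or]
    refine ⟨hiso z (by tauto) t, fun h => ?_⟩
    rcases (pathG_adj_mem _ _ _ _ _ h).1 with rfl | rfl | h'
    · rcases hz with hz | hz
      · exact hux hz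
      · simp only [List.mem_cons] at hz
        rcases hz with hz | hz
        · exact hyu hz.symm
        · exact hum hz
    · rcases hz with hz | hz
      · simp only [List.mem_cons] at hz
        rcases hz with hz | hz
        · exact hxv hz.symm
        · exact hvm hz
      · exact hvy hz
    · rcases hz with hz | hz
      · exact hlx z h' hz
      · exact hly z h' hz
  have w2 : ∀ z, z ∈ x :: m ∨ z ∈ y :: m' →
      ov (Function.update (Function.update d u w) v w) l Y z = 1 := by
    intro z hz
    have h1 : z ∉ l := by
      intro h; rcases hz with hz | hz
      · exact hlx z h hz
      · exact hly z h hz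
    have h2 : z ≠ v := by
      rintro rfl
      rcases hz with hz | hz
      · simp only [List.mem_cons] at hz
        rcases hz with hz | hz
        · exact hxv hz.symm
        · exact hvm hz
      · exact hvy hz
    have h3 : z ≠ u := by
      rintro rfl
      rcases hz with hz | hz
      · exact hux hz
      · simp only [List.mem_cons] at hz
        rcases hz with hz | hz
        · exact hyu hz.symm
        · exact hum hz
    rw [ov, if_neg h1, Function.update_of_ne h2, Function.update_of_ne h3]
    exact hd z (by tauto)
  set H1 := H ⊔ pathG u l v with hH1
  set d1 := ov (Function.update (Function.update d u w) v w) l Y with hd1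
  have hE1 : EarOK (mat H1 d1) x m v := ⟨hxv, hxm, hvm, hm, fun z hz =>
    mat_iso1 (i2 z (by simp [hz])) (w2 z (by simp [hz]))⟩
  have hI1 : Iso1 (mat H1 d1) x := mat_iso1 (i2 x (by simp)) (w2 x (by simp))
  have hxu' : x ≠ u := by rintro rfl; simp at hux
  have hum2 : u ∉ m := fun h => hux (by simp [h])
  have hE2 : EarOK (Function.update (mat H1 d1) u (ee R u)) x m v :=
    hE1.update hum2 (ee_zero hum2)
  have hI2 : Iso1 (Function.update (mat H1 d1) u (ee R u)) x :=
    hI1.update hxu'.symm (by simp [hxu'])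
  have L1 := (loopN_pr Y hE1 hI1).1
  have L2 := (loopN_pr Y hE2 hI2).1
  rw [← loopN_update Y _ hxu'.symm huv hum2] at L2
  rw [hs1.p0, hs1.p2] at L1
  rw [hs1.p1, hs1.p3] at L2
  have hmat : loopN Y (mat H1 d1) x m v =
      mat (H1 ⊔ pathG x m v ⊔ SimpleGraph.edge x v) (ov d1 (x :: m) Y) :=
    loopN_mat Y hxv hxm hvm hm hmne (i2 x (by simp)) (fun z hz => i2 z (by simp [hz]))
  rw [hmat] at L1 L2
  have i3 : ∀ z, z ∈ y :: m' → ∀ t,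
      ¬ (H1 ⊔ pathG x m v ⊔ SimpleGraph.edge x v).Adj z t := by
    intro z hz t
    rw [SimpleGraph.sup_adj, SimpleGraph.sup_adj, not_or, not_or]
    have hzx : z ∉ x :: m := fun h => hxy z h hz
    have hzv : z ≠ v := by rintro rfl; exact hvy hz
    simp only [List.mem_cons, not_or] at hzx
    refine ⟨⟨i2 z (Or.inr hz) t, fun h => ?_⟩, fun h => ?_⟩
    · rcases (pathG_adj_mem _ _ _ _ _ h).1 with h | h | h
      · exact hzx.1 h
      · exact hzv h
      · exact hzx.2 h
    · simp only [SimpleGraph.edge_adj] at h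
      tauto
  have w3 : ∀ z, z ∈ y :: m' → ov d1 (x :: m) Y z = 1 := by
    intro z hz
    rw [ov, if_neg (fun h => hxy z h hz)]
    exact w2 z (Or.inr hz)
  set H2 := H1 ⊔ pathG x m v ⊔ SimpleGraph.edge x v with hH2
  set d2 := ov d1 (x :: m) Y with hd2
  have hE3 : EarOK (mat H2 d2) y m' u := ⟨hyu, hym, hum, hm', fun z hz =>
    mat_iso1 (i3 z (by simp [hz])) (w3 z (by simp [hz]))⟩
  have hI3 : Iso1 (mat H2 d2) y := mat_iso1 (i3 y (by simp)) (w3 y (by simp))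
  have L3 := (loopN_pr Y hE3 hI3).1
  rw [loopN_mat Y hyu hym hum hm' hmne' (i3 y (by simp)) (fun z hz => i3 z (by simp [hz])),
    L1, L2] at L3
  rw [L3]
  simp only [dbF]
  ring

theorem struct_thm (Y w : R) (G : SimpleGraph V) {u v : V} (huv : u ≠ v) (hdu : dg G u = 3)
    (hdv : dg G v = 3) (hd : ∀ z, z ≠ u → z ≠ v → dg G z = 2) :
    (∃ (l1 l2 l3 : List V) (H : SimpleGraph V) (K : List ℕ),
      (u :: v :: (l1 ++ l2 ++ l3)).Nodup ∧
      (∀ z ∈ u :: v :: (l1 ++ l2 ++ l3), ∀ y, ¬ H.Adj z y) ∧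
      (l1 ≠ [] ∨ l2 ≠ []) ∧ (l1 ≠ [] ∨ l3 ≠ []) ∧ (l2 ≠ [] ∨ l3 ≠ []) ∧
      G = H ⊔ pathG u l1 v ⊔ pathG u l2 v ⊔ pathG u l3 v ∧ (∀ k ∈ K, 3 ≤ k) ∧
      pr (mat G (fun z => if z = u ∨ z = v then w else Y)) =
        thF Y w l1.length l2.length l3.length * (K.map (cyc Y)).prod) ∨
    (∃ (k b c : ℕ) (K : List ℕ), 3 ≤ b ∧ 3 ≤ c ∧ (∀ k ∈ K, 3 ≤ k) ∧
      pr (mat G (fun z => if z = u ∨ z = v then w else Y)) =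
        dbF Y w k b c * (K.map (cyc Y)).prod) := by
  have hr : G.Reachable u v := by
    apply reachable_of_parity
    · rw [hdu]; decide
    · intro z h1 h2; rw [hd z h1 h2]; decide
  obtain ⟨l1, hu1, hv1, n1, le1, -⟩ := exists_pathG hr huv
  have dH1 : ∀ z, dg (G \ pathG u l1 v) z = if z ∈ l1 then 0 else 2 := by
    intro z
    have e1 := dg_sdiff le1 z
    rw [dg_pathG l1 u v huv hu1 hv1 n1] at e1
    by_cases hzu : z = u
    · subst hzu; simp [huv, hu1, hdu] at *; omega
    · by_cases hzv : z = v
      · subst hzv; simp [hzu, hv1, hdv] at *; omega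
      · have := hd z hzu hzv
        by_cases hz : z ∈ l1
        · simp [hzu, hzv, hz, this] at *; omega
        · simp [hzu, hzv, hz, this] at *; omega
  set H1 := G \ pathG u l1 v with hH1
  have hG1 : G = H1 ⊔ pathG u l1 v := by rw [hH1, sdiff_sup_cancel le1]
  have hev : ∀ z, dg H1 z = 0 ∨ dg H1 z = 2 := by
    intro z; rw [dH1]; split_ifs <;> simp
  have adj_nil : (pathG u [] v).Adj u v := by simp [pathG, SimpleGraph.edge_adj, huv]
  by_cases hr1 : H1.Reachable u v
  · left
    obtain ⟨l2, hu2, hv2, n2, le2, -⟩ := exists_pathG hr1 huv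
    have d12 : ∀ z ∈ l2, z ∉ l1 := by
      intro z hz hz1
      have e1 := dg_sdiff le2 z
      rw [dg_pathG l2 u v huv hu2 hv2 n2, if_pos hz, dH1, if_pos hz1] at e1
      omega
    have dH2 : ∀ z, dg (H1 \ pathG u l2 v) z =
        if z = u ∨ z = v then 1 else if z ∈ l1 ∨ z ∈ l2 then 0 else 2 := by
      intro z
      have e1 := dg_sdiff le2 z
      rw [dg_pathG l2 u v huv hu2 hv2 n2, dH1] at e1
      by_cases hzu : z = u
      · subst hzu; simp [huv, hu1, hu2] at *; omega
      · by_cases hzv : z = v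
        · subst hzv; simp [hzu, hv1, hv2] at *; omega
        · by_cases hz : z ∈ l2
          · have := d12 z hz
            simp [hzu, hzv, hz, this] at *; omega
          · simp [hzu, hzv, hz] at *; omega
    set H2 := H1 \ pathG u l2 v with hH2
    have hG2 : H1 = H2 ⊔ pathG u l2 v := by rw [hH2, sdiff_sup_cancel le2]
    have hr2 : H2.Reachable u v := by
      apply reachable_of_parity
      · rw [dH2]; simp
      · intro z h1 h2; rw [dH2, if_neg (by simp [h1, h2])]; split_ifs <;> decide
    obtain ⟨l3, hu3, hv3, n3, le3, -⟩ := exists_pathG hr2 huv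
    have d3 : ∀ z ∈ l3, z ∉ l1 ∧ z ∉ l2 := by
      intro z hz
      rw [← not_or]
      intro hz1
      have e1 := dg_sdiff le3 z
      have hzu : z ≠ u := by rintro rfl; exact hu3 hz
      have hzv : z ≠ v := by rintro rfl; exact hv3 hz
      have e2 := dH2 z
      rw [if_neg (by simp [hzu, hzv]), if_pos hz1] at e2
      rw [dg_pathG l3 u v huv hu3 hv3 n3, if_pos hz, e2] at e1
      omega
    have dH3 : ∀ z, dg (H2 \ pathG u l3 v) z =
        if z = u ∨ z = v ∨ z ∈ l1 ∨ z ∈ l2 ∨ z ∈ l3 then 0 else 2 := by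
      intro z
      have e1 := dg_sdiff le3 z
      rw [dg_pathG l3 u v huv hu3 hv3 n3, dH2] at e1
      by_cases hzu : z = u
      · subst hzu; simp [huv, hu3] at *; omega
      · by_cases hzv : z = v
        · subst hzv; simp [hzu, hv3] at *; omega
        · by_cases hz : z ∈ l3
          · have := d3 z hz
            simp [hzu, hzv, hz, this] at *; omega
          · simp [hzu, hzv, hz] at *; omega
    set H3 := H2 \ pathG u l3 v with hH3
    have hG3 : H2 = H3 ⊔ pathG u l3 v := by rw [hH3, sdiff_sup_cancel le3]
    have hev3 : ∀ z, dg H3 z = 0 ∨ dg H3 z = 2 := by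
      intro z; rw [dH3]; split_ifs <;> simp
    obtain ⟨K, hK, hpr⟩ := rest_pr Y _ H3 hev3 rfl
    have hmem : ∀ z, z ∈ u :: v :: (l3 ++ l2 ++ l1) ↔
        z = u ∨ z = v ∨ z ∈ l1 ∨ z ∈ l2 ∨ z ∈ l3 := by
      intro z; simp only [List.mem_cons, List.mem_append]; tauto
    have hnd : (u :: v :: (l3 ++ l2 ++ l1)).Nodup := by
      simp only [List.nodup_cons, List.mem_cons, List.mem_append, not_or, List.nodup_append']
      refine ⟨⟨huv, ⟨hu3, hu2⟩, hu1⟩, ⟨⟨hv3, hv2⟩, hv1⟩, ⟨n3, n2, ?_⟩, n1, ?_⟩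
      · intro z h h'; exact (d3 z h).2 h'
      · intro z h h'
        rcases List.mem_append.1 h with h | h
        · exact (d3 z h).1 h'
        · exact d12 z h h'
    have hiso : ∀ z ∈ u :: v :: (l3 ++ l2 ++ l1), ∀ y, ¬ H3.Adj z y := by
      intro z hz
      apply not_iso_dg
      rw [dH3, if_pos ((hmem z).1 hz)]
    have hw1 : ∀ z ∈ u :: v :: (l3 ++ l2 ++ l1), wt H3 Y z = 1 := by
      intro z hz
      rw [wt, dH3, if_pos ((hmem z).1 hz)]
      simp
    have c32 : l3 ≠ [] ∨ l2 ≠ [] := by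
      by_contra h
      push Not at h
      have h1 := le3 (by rw [h.1]; exact adj_nil)
      rw [hH2, SimpleGraph.sdiff_adj] at h1
      exact h1.2 (by rw [h.2]; exact adj_nil)
    have c31 : l3 ≠ [] ∨ l1 ≠ [] := by
      by_contra h
      push Not at h
      have h1 := le3 (by rw [h.1]; exact adj_nil)
      rw [hH2, SimpleGraph.sdiff_adj, hH1, SimpleGraph.sdiff_adj] at h1
      exact h1.1.2 (by rw [h.2]; exact adj_nil)
    have c21 : l2 ≠ [] ∨ l1 ≠ [] := by
      by_contra h
      push Not at h
      have h1 := le2 (by rw [h.1]; exact adj_nil)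
      rw [hH1, SimpleGraph.sdiff_adj] at h1
      exact h1.2 (by rw [h.2]; exact adj_nil)
    have hGeq : G = H3 ⊔ pathG u l3 v ⊔ pathG u l2 v ⊔ pathG u l1 v := by
      rw [← hG3, ← hG2, ← hG1]
    refine ⟨l3, l2, l1, H3, K, hnd, hiso, c32, c31, c21, hGeq, hK, ?_⟩
    have := theta_pr Y w hnd hiso hw1 c32 c31 c21
    rw [hpr, ← hGeq] at this
    rw [← this]
    congr 2
    funext z
    unfold ov
    by_cases h1 : z = u ∨ z = v
    · have a1 : z ∉ l1 := by rintro h; rcases h1 with rfl | rfl <;> tauto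
      have a2 : z ∉ l2 := by rintro h; rcases h1 with rfl | rfl <;> tauto
      have a3 : z ∉ l3 := by rintro h; rcases h1 with rfl | rfl <;> tauto
      rw [if_pos h1, if_neg a1, if_neg a2, if_neg a3]
      by_cases hzv : z = v
      · subst hzv; simp
      · have : z = u := h1.resolve_right hzv
        subst this; simp [hzv]
    · rw [if_neg h1]
      rw [not_or] at h1
      split_ifs with b1 b2 b3
      · rfl
      · rfl
      · rfl
      · have e := dH3 z
        rw [if_neg (by simp [h1.1, h1.2, b1, b2, b3])] at e
        rw [Function.update_of_ne h1.2, Function.update_of_ne h1.1, wt, e]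
        simp
  · right
    have du1 : dg H1 u = 2 := by rw [dH1, if_neg hu1]
    have dv1 : dg H1 v = 2 := by rw [dH1, if_neg hv1]
    obtain ⟨x, m, H2, hxv, hxm, hvm, hm, hmne, hE2, dH2, mem2⟩ := cycle_extract hev dv1
    have hux : ¬ (u = x ∨ u ∈ m) := fun h => hr1 (mem2 u h).1.symm
    have hev2 : ∀ z, dg H2 z = 0 ∨ dg H2 z = 2 := by
      intro z
      rw [dH2]
      split_ifs
      · simp
      · exact hev z
    have du2 : dg H2 u = 2 := by rw [dH2, if_neg (by tauto), du1]
    obtain ⟨y, m', H3, hyu, hym, hum, hm', hmne', hE3, dH3, mem3⟩ := cycle_extract hev2 du2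
    have hev3 : ∀ z, dg H3 z = 0 ∨ dg H3 z = 2 := by
      intro z
      rw [dH3]
      split_ifs
      · simp
      · exact hev2 z
    obtain ⟨K, hK, hpr⟩ := rest_pr Y _ H3 hev3 rfl
    have z3 : ∀ z, z = u ∨ z = v ∨ z ∈ l1 ∨ z ∈ x :: m ∨ z ∈ y :: m' → dg H3 z = 0 := by
      intro z hz
      simp only [List.mem_cons] at hz
      have a3 := dH3 z
      have a2 := dH2 z
      have a1 := dH1 z
      clear hpr hE2 hE3 hG1 mem2 mem3 dH1 dH2 dH3
      split_ifs at a1 a2 a3 <;> first | omega | (exfalso; tauto)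
    have nz3 : ∀ z, ¬ (z = u ∨ z = v ∨ z ∈ l1 ∨ z ∈ x :: m ∨ z ∈ y :: m') → dg H3 z = 2 := by
      intro z hz
      simp only [List.mem_cons, not_or] at hz
      obtain ⟨hzu, hzv, hzl, ⟨hzx, hzm⟩, hzy, hzm'⟩ := hz
      rw [dH3, if_neg (by simp [hzu, hzy, hzm']), dH2, if_neg (by simp [hzv, hzx, hzm]), dH1,
        if_neg hzl]
    have hlx : ∀ z ∈ l1, z ∉ x :: m := by
      intro z hz hz'
      have := (mem2 z (List.mem_cons.1 hz')).2
      rw [dH1, if_pos hz] at this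
      omega
    have hly : ∀ z ∈ l1, z ∉ y :: m' := by
      intro z hz hz'
      have := (mem3 z (List.mem_cons.1 hz')).2
      rw [dH2, dH1, if_pos hz] at this
      simp at this
    have hxy : ∀ z ∈ x :: m, z ∉ y :: m' := by
      intro z hz hz'
      have := (mem3 z (List.mem_cons.1 hz')).2
      rw [List.mem_cons] at hz
      rw [dH2, if_pos (by tauto)] at this
      omega
    have hvy : v ∉ y :: m' := by
      intro hz'
      have := (mem3 v (List.mem_cons.1 hz')).2
      rw [dH2, if_pos (by tauto)] at this
      omega
    have hux' : u ∉ x :: m := by rw [List.mem_cons]; exact hux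
    have := dumbbell_pr Y w (H := H3) (d := wt H3 Y) huv hu1 hv1 n1 hxv hxm hvm hm hmne hyu hym hum
      hm' hmne' hux' hlx hly hxy hvy (fun z hz => not_iso_dg (z3 z hz))
      (fun z hz => by rw [wt, z3 z hz]; simp)
    have lm : m.length ≠ 0 := by simpa using hmne
    have lm' : m'.length ≠ 0 := by simpa using hmne'
    refine ⟨l1.length, m.length + 2, m'.length + 2, K, by omega, by omega, hK, ?_⟩
    rw [← hpr, ← this]
    have hGeq : G = H3 ⊔ pathG u l1 v ⊔ pathG x m v ⊔ SimpleGraph.edge x v ⊔ pathG y m' u ⊔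
        SimpleGraph.edge y u := by
      rw [hG1, hE2, hE3]
      simp only [sup_assoc, sup_comm, sup_left_comm]
    rw [← hGeq]
    congr 2
    funext z
    unfold ov
    by_cases h1 : z = u ∨ z = v
    · have a1 : z ∉ l1 := by rintro h; rcases h1 with rfl | rfl <;> tauto
      have a2 : z ∉ x :: m := by
        rcases h1 with rfl | rfl
        · exact hux'
        · simp only [List.mem_cons, not_or]; exact ⟨hxv.symm, hvm⟩
      have a3 : z ∉ y :: m' := by
        rcases h1 with rfl | rfl
        · simp only [List.mem_cons, not_or]; exact ⟨hyu.symm, hum⟩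
        · exact hvy
      rw [if_pos h1, if_neg a1, if_neg a2, if_neg a3]
      by_cases hzv : z = v
      · subst hzv; simp
      · have : z = u := h1.resolve_right hzv
        subst this; simp [hzv]
    · rw [if_neg h1]
      rw [not_or] at h1
      split_ifs with b1 b2 b3
      · rfl
      · rfl
      · rfl
      · rw [Function.update_of_ne h1.2, Function.update_of_ne h1.1, wt, nz3 z (by simp only [h1.1, h1.2, b1, b2, b3, or_self, not_false_eq_true])]
        simp

end Struct


/-! ## The theta graph as a union of three paths -/

section ThetaIso

set_option linter.unusedSectionVars false

theorem pathG_map {A B : Type*} (φ : A → B) (S : Set A) (hφ : Set.InjOn φ S) (l : List A) :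
    ∀ (u v a b : A), u ∈ S → v ∈ S → (∀ x ∈ l, x ∈ S) → a ∈ S → b ∈ S →
    ((pathG (φ u) (l.map φ) (φ v)).Adj (φ a) (φ b) ↔ (pathG u l v).Adj a b) := by
  have he : ∀ u v a b : A, u ∈ S → v ∈ S → a ∈ S → b ∈ S →
      ((SimpleGraph.edge (φ u) (φ v)).Adj (φ a) (φ b) ↔ (SimpleGraph.edge u v).Adj a b) := by
    intro u v a b hu hv ha hb
    simp only [SimpleGraph.edge_adj, ne_eq]
    rw [hφ.eq_iff ha hu, hφ.eq_iff hb hv, hφ.eq_iff ha hv, hφ.eq_iff hb hu, hφ.eq_iff ha hb]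
  induction l with
  | nil =>
    intro u v a b hu hv _ ha hb
    exact he u v a b hu hv ha hb
  | cons x l ih =>
    intro u v a b hu hv hl ha hb
    have hx := hl x (by simp)
    simp only [List.map_cons, pathG, SimpleGraph.sup_adj]
    rw [he u x a b hu hx ha hb, ih x v a b hx hv (fun y hy => hl y (by simp [hy])) ha hb]

theorem pathG_range_aux (b : ℕ) (k : ℕ) : ∀ (s i j : ℕ),
    (pathG s (List.range' (s + 1) k) b).Adj i j ↔ i ≠ j ∧
      (((s ≤ i ∧ i + 1 = j ∧ j ≤ s + k) ∨ (i = s + k ∧ j = b)) ∨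
       ((s ≤ j ∧ j + 1 = i ∧ i ≤ s + k) ∨ (j = s + k ∧ i = b))) := by
  induction k with
  | zero =>
    intro s i j
    simp only [List.range'_zero, pathG, SimpleGraph.edge_adj]
    omega
  | succ k ih =>
    intro s i j
    simp only [List.range'_succ, pathG, SimpleGraph.edge_adj, SimpleGraph.sup_adj, ih]
    omega

/-- Oriented adjacency relation of one of the three paths. -/
def Qr (s k i j : ℕ) : Prop :=
  (k = 0 ∧ i = 0 ∧ j = 1) ∨ (0 < k ∧ i = 0 ∧ j = s) ∨ (s ≤ i ∧ i + 1 = j ∧ j < s + k) ∨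
        (0 < k ∧ i + 1 = s + k ∧ j = 1)

theorem pathG_range (s k i j : ℕ) :
    (pathG 0 (List.range' s k) 1).Adj i j ↔ i ≠ j ∧ (Qr s k i j ∨ Qr s k j i) := by
  unfold Qr
  cases k with
  | zero =>
    simp only [List.range'_zero, pathG, SimpleGraph.edge_adj]
    constructor
    · rintro ⟨h | h, h'⟩
      · obtain ⟨h1, h2⟩ := h
        refine ⟨h', Or.inl (Or.inl ⟨trivial, by omega, by omega⟩)⟩
      · obtain ⟨h1, h2⟩ := h
        refine ⟨h', Or.inr (Or.inl ⟨trivial, by omega, by omega⟩)⟩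
    · rintro ⟨h, (h' | h' | h' | h') | (h' | h' | h' | h')⟩ <;> omega
  | succ k =>
    simp only [List.range'_succ, pathG, SimpleGraph.edge_adj, SimpleGraph.sup_adj, pathG_range_aux]
    constructor
    · rintro (⟨h | h, h'⟩ | ⟨h', (h | h) | (h | h)⟩) <;> omega
    · rintro ⟨h, (h' | h' | h' | h') | (h' | h' | h' | h')⟩ <;> omega

/-- Theta graph on natural numbers. -/
def thetaN (p q r : ℕ) : SimpleGraph ℕ :=
  pathG 0 (List.range' 2 p) 1 ⊔ pathG 0 (List.range' (p + 2) q) 1 ⊔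
    pathG 0 (List.range' (p + q + 2) r) 1

theorem Qr_assoc (a1 a2 a3 a4 b1 b2 b3 b4 c1 c2 c3 c4 : Prop) :
    (a1 ∨ a2 ∨ a3 ∨ a4 ∨ b1 ∨ b2 ∨ b3 ∨ b4 ∨ c1 ∨ c2 ∨ c3 ∨ c4) ↔
    (a1 ∨ a2 ∨ a3 ∨ a4) ∨ (b1 ∨ b2 ∨ b3 ∨ b4) ∨ (c1 ∨ c2 ∨ c3 ∨ c4) := by
  simp only [or_assoc]

theorem theta_rel_iff (p q r a b : ℕ) (hb : b < p + q + r + 2) :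
    ((p = 0 ∧ a = 0 ∧ b = 1) ∨
    (0 < p ∧ a = 0 ∧ b = 2) ∨
    (2 ≤ a ∧ a + 1 = b ∧ b < p + 2) ∨
    (0 < p ∧ a = p + 1 ∧ b = 1) ∨
    (q = 0 ∧ a = 0 ∧ b = 1) ∨
    (0 < q ∧ a = 0 ∧ b = p + 2) ∨
    (p + 2 ≤ a ∧ a + 1 = b ∧ b < p + q + 2) ∨
    (0 < q ∧ a = p + q + 1 ∧ b = 1) ∨
    (r = 0 ∧ a = 0 ∧ b = 1) ∨
    (0 < r ∧ a = 0 ∧ b = p + q + 2) ∨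
    (p + q + 2 ≤ a ∧ a + 1 = b) ∨
    (0 < r ∧ a = p + q + r + 1 ∧ b = 1)) ↔
    (Qr 2 p a b ∨ Qr (p + 2) q a b ∨ Qr (p + q + 2) r a b) := by
  rw [Qr_assoc]
  unfold Qr
  refine or_congr ?_ (or_congr ?_ ?_)
  · refine or_congr Iff.rfl (or_congr Iff.rfl (or_congr ?_ ?_)) <;> omega
  · refine or_congr Iff.rfl (or_congr Iff.rfl (or_congr ?_ ?_)) <;> omega
  · refine or_congr Iff.rfl (or_congr Iff.rfl (or_congr ?_ ?_)) <;> omega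

theorem theta_adj_iff (p q r : ℕ) (i j : Fin (p + q + r + 2)) :
    (thetaGraph p q r).Adj i j ↔ (thetaN p q r).Adj i.val j.val := by
  have hi := i.isLt
  have hj := j.isLt
  simp only [thetaGraph, SimpleGraph.fromRel_adj, thetaN, SimpleGraph.sup_adj, pathG_range,
    ne_eq, Fin.ext_iff]
  rw [theta_rel_iff p q r i.val j.val hj, theta_rel_iff p q r j.val i.val hi]
  tauto

/-- Transport of `thetaN` along a map injective on an initial segment. -/
theorem thetaN_map {B : Type*} (p q r : ℕ) (φ : ℕ → B)
    (hφ : Set.InjOn φ {i | i < p + q + r + 2}) (i j : ℕ) (hi : i < p + q + r + 2)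
    (hj : j < p + q + r + 2) :
    (pathG (φ 0) ((List.range' 2 p).map φ) (φ 1) ⊔ pathG (φ 0) ((List.range' (p + 2) q).map φ) (φ 1)
      ⊔ pathG (φ 0) ((List.range' (p + q + 2) r).map φ) (φ 1)).Adj (φ i) (φ j) ↔
      (thetaN p q r).Adj i j := by
  simp only [SimpleGraph.sup_adj, thetaN]
  rw [pathG_map φ _ hφ, pathG_map φ _ hφ, pathG_map φ _ hφ]
  all_goals first
    | (intro x hx; simp only [List.mem_range'_1] at hx; simp only [Set.mem_ofPred_eq]; omega)
    | (simp only [Set.mem_ofPred_eq]; omega)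

theorem theta_eq_paths (p q r : ℕ) (φ : ℕ → Fin (p + q + r + 2))
    (hφ : ∀ i, i < p + q + r + 2 → (φ i).val = i) :
    thetaGraph p q r = pathG (φ 0) ((List.range' 2 p).map φ) (φ 1) ⊔
      pathG (φ 0) ((List.range' (p + 2) q).map φ) (φ 1)
      ⊔ pathG (φ 0) ((List.range' (p + q + 2) r).map φ) (φ 1) := by
  ext i j
  have hinj : Set.InjOn φ {i | i < p + q + r + 2} := by
    intro a ha b hb hab
    rw [← hφ a ha, ← hφ b hb, hab]
  have h1 : φ i.val = i := Fin.ext (hφ _ i.isLt)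
  have h2 : φ j.val = j := Fin.ext (hφ _ j.isLt)
  have := thetaN_map p q r φ hinj i.val j.val i.isLt j.isLt
  rw [h1, h2] at this
  rw [theta_adj_iff, this]

theorem iso_of_lists {V : Type*} [Fintype V] {G H : SimpleGraph V} {u v : V} {l1 l2 l3 : List V}
    (hnd : (u :: v :: (l1 ++ l2 ++ l3)).Nodup)
    (hiso : ∀ z ∈ u :: v :: (l1 ++ l2 ++ l3), ∀ y, ¬ H.Adj z y)
    (hG : G = H ⊔ pathG u l1 v ⊔ pathG u l2 v ⊔ pathG u l3 v)
    (hcard : Fintype.card V = l1.length + l2.length + l3.length + 2) {p q r : ℕ}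
    (h1 : l1.length = p) (h2 : l2.length = q) (h3 : l3.length = r) :
    Nonempty (G ≃g thetaGraph p q r) := by
  subst h1 h2 h3
  set p := l1.length
  set q := l2.length
  set r := l3.length
  set L := u :: v :: (l1 ++ l2 ++ l3) with hL
  have hlen : L.length = p + q + r + 2 := by simp [hL, p, q, r]; omega
  have hmem : ∀ z, z ∈ L := by
    intro z
    have : L.toFinset = Finset.univ := by
      apply Finset.eq_univ_of_card
      rw [List.toFinset_card_of_nodup hnd, hlen, hcard]
    rw [← List.mem_toFinset, this]; simp
  have hbot : H = ⊥ := by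
    ext a b
    simp only [SimpleGraph.bot_adj, iff_false]
    exact hiso a (hmem a) b
  let φ : ℕ → V := fun i => L.getD i u
  have hφ : ∀ i (hi : i < L.length), φ i = L[i] := fun i hi => List.getD_eq_getElem _ _ hi
  have hinj : Set.InjOn φ {i | i < p + q + r + 2} := by
    intro a ha b hb hab
    simp only [Set.mem_ofPred_eq, ← hlen] at ha hb
    rw [hφ a ha, hφ b hb] at hab
    exact (List.Nodup.getElem_inj_iff hnd).1 hab
  have e0 : φ 0 = u := by simp [φ, hL]
  have e1 : φ 1 = v := by simp [φ, hL]
  have f1 : (List.range' 2 p).map φ = l1 := by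
    apply List.ext_getElem
    · simp [p]
    · intro i hi hi'
      have : 2 + i < L.length := by rw [hlen]; omega
      simp only [List.getElem_map, List.getElem_range', one_mul]
      rw [hφ _ this]
      simp only [hL, show 2 + i = i + 1 + 1 by omega, List.getElem_cons_succ]
      rw [List.getElem_append_left (by simp; omega), List.getElem_append_left hi']
  have f2 : (List.range' (p + 2) q).map φ = l2 := by
    apply List.ext_getElem
    · simp [q]
    · intro i hi hi'
      have : p + 2 + i < L.length := by rw [hlen]; omega
      simp only [List.getElem_map, List.getElem_range', one_mul]
      rw [hφ _ this]
      simp only [hL, show p + 2 + i = (p + i) + 1 + 1 by omega, List.getElem_cons_succ]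
      rw [List.getElem_append_left (by simp; omega), List.getElem_append_right (by omega)]
      congr 1
      omega
  have f3 : (List.range' (p + q + 2) r).map φ = l3 := by
    apply List.ext_getElem
    · simp [r]
    · intro i hi hi'
      have : p + q + 2 + i < L.length := by rw [hlen]; omega
      simp only [List.getElem_map, List.getElem_range', one_mul]
      rw [hφ _ this]
      simp only [hL, show p + q + 2 + i = (p + q + i) + 1 + 1 by omega, List.getElem_cons_succ]
      rw [List.getElem_append_right (by simp; omega)]
      congr 1
      simp; omega
  have hadj : ∀ i j : Fin (p + q + r + 2), G.Adj (φ i.val) (φ j.val) ↔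
      (thetaGraph p q r).Adj i j := by
    intro i j
    have := thetaN_map p q r φ hinj i.val j.val i.isLt j.isLt
    rw [f1, f2, f3, e0, e1] at this
    rw [theta_adj_iff, ← this, hG, hbot, bot_sup_eq]
  have hbij : Function.Bijective (fun i : Fin (p + q + r + 2) => φ i.val) := by
    constructor
    · intro a b hab
      exact Fin.ext (hinj a.isLt b.isLt hab)
    · intro z
      obtain ⟨i, hi, hz⟩ := List.getElem_of_mem (hmem z)
      exact ⟨⟨i, by omega⟩, by simp only; rw [hφ i hi, hz]⟩
  exact ⟨SimpleGraph.Iso.symm ⟨Equiv.ofBijective _ hbij, by intro a b; exact hadj a b⟩⟩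

theorem iso_of_lists_perm {V : Type*} [Fintype V] {G H : SimpleGraph V} {u v : V}
    {l1 l2 l3 : List V}
    (hnd : (u :: v :: (l1 ++ l2 ++ l3)).Nodup)
    (hiso : ∀ z ∈ u :: v :: (l1 ++ l2 ++ l3), ∀ y, ¬ H.Adj z y)
    (hG : G = H ⊔ pathG u l1 v ⊔ pathG u l2 v ⊔ pathG u l3 v)
    (hcard : Fintype.card V = l1.length + l2.length + l3.length + 2) {p q r : ℕ}
    (hcases : (l1.length = p ∧ l2.length = q ∧ l3.length = r) ∨
      (l1.length = p ∧ l3.length = q ∧ l2.length = r) ∨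
      (l2.length = p ∧ l1.length = q ∧ l3.length = r) ∨
      (l2.length = p ∧ l3.length = q ∧ l1.length = r) ∨
      (l3.length = p ∧ l1.length = q ∧ l2.length = r) ∨
      (l3.length = p ∧ l2.length = q ∧ l1.length = r)) :
    Nonempty (G ≃g thetaGraph p q r) := by
  have key : ∀ m1 m2 m3 : List V, (m1 ++ m2 ++ m3).Perm (l1 ++ l2 ++ l3) →
      H ⊔ pathG u m1 v ⊔ pathG u m2 v ⊔ pathG u m3 v =
        H ⊔ pathG u l1 v ⊔ pathG u l2 v ⊔ pathG u l3 v →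
      m1.length = p → m2.length = q → m3.length = r → Nonempty (G ≃g thetaGraph p q r) := by
    intro m1 m2 m3 hp hE h1 h2 h3
    have hp' : (u :: v :: (m1 ++ m2 ++ m3)).Perm (u :: v :: (l1 ++ l2 ++ l3)) :=
      (hp.cons v).cons u
    refine iso_of_lists (hp'.nodup_iff.2 hnd) (fun z hz => hiso z (hp'.mem_iff.1 hz))
      (hG.trans hE.symm) ?_ h1 h2 h3
    have := hp.length_eq
    simp only [List.length_append] at this
    omega
  have perm_of : ∀ m1 m2 m3 : List V, (∀ x, (m1 ++ m2 ++ m3).count x = (l1 ++ l2 ++ l3).count x) →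
      (m1 ++ m2 ++ m3).Perm (l1 ++ l2 ++ l3) := fun m1 m2 m3 h => List.perm_iff_count.2 h
  rcases hcases with h | h | h | h | h | h
  · exact key l1 l2 l3 (List.Perm.refl _) rfl h.1 h.2.1 h.2.2
  · exact key l1 l3 l2 (perm_of _ _ _ (by intro x; simp only [List.count_append]; omega))
      (by simp only [sup_assoc, sup_comm, sup_left_comm]) h.1 h.2.1 h.2.2
  · exact key l2 l1 l3 (perm_of _ _ _ (by intro x; simp only [List.count_append]; omega))
      (by simp only [sup_assoc, sup_comm, sup_left_comm]) h.1 h.2.1 h.2.2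
  · exact key l2 l3 l1 (perm_of _ _ _ (by intro x; simp only [List.count_append]; omega))
      (by simp only [sup_assoc, sup_comm, sup_left_comm]) h.1 h.2.1 h.2.2
  · exact key l3 l1 l2 (perm_of _ _ _ (by intro x; simp only [List.count_append]; omega))
      (by simp only [sup_assoc, sup_comm, sup_left_comm]) h.1 h.2.1 h.2.2
  · exact key l3 l2 l1 (perm_of _ _ _ (by intro x; simp only [List.count_append]; omega))
      (by simp only [sup_assoc, sup_comm, sup_left_comm]) h.1 h.2.1 h.2.2

theorem theta_dis {V : Type*} (u v : V) (huv : u ≠ v) (l l' : List V) (hul : u ∉ l) (hvl : v ∉ l)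
    (hul' : u ∉ l') (hvl' : v ∉ l')
    (hd : ∀ z ∈ l, z ∉ l') (hne : l ≠ [] ∨ l' ≠ []) (a b : V)
    (h1 : (pathG u l v).Adj a b) : ¬ (pathG u l' v).Adj a b := by
  intro h2
  have m1 := pathG_adj_mem _ _ _ _ _ h1
  have m2 := pathG_adj_mem _ _ _ _ _ h2
  have hab : (a = u ∧ b = v) ∨ (a = v ∧ b = u) := by
    have hne' := h1.ne
    have aux : ∀ c, (c = u ∨ c = v ∨ c ∈ l) → (c = u ∨ c = v ∨ c ∈ l') → c = u ∨ c = v := by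
      intro c h h'
      rcases h with h | h | h
      · exact Or.inl h
      · exact Or.inr h
      · rcases h' with h' | h' | h'
        · exact Or.inl h'
        · exact Or.inr h'
        · exact absurd h' (hd c h)
    rcases aux a m1.1 m2.1 with ha | ha <;> rcases aux b m1.2 m2.2 with hb | hb
    · exact absurd (ha.trans hb.symm) hne'
    · exact Or.inl ⟨ha, hb⟩
    · exact Or.inr ⟨ha, hb⟩
    · exact absurd (ha.trans hb.symm) hne'
  have key : ∀ l : List (V), u ∉ l → v ∉ l → l ≠ [] →
      ¬ (pathG u l v).Adj u v := by
    intro l hul hvl hne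
    cases l with
    | nil => exact absurd rfl hne
    | cons y l =>
      simp only [List.mem_cons, not_or] at hul hvl
      simp only [pathG, SimpleGraph.sup_adj, SimpleGraph.edge_adj]
      rintro (h | h)
      · rcases h.1 with ⟨_, h⟩ | ⟨h, _⟩
        · exact hvl.1 h
        · exact hul.1 h
      · have := (pathG_adj_mem _ _ _ _ _ h).1
        rcases this with h | h | h
        · exact hul.1 h
        · exact huv h
        · exact hul.2 h
  have g1 : (pathG u l v).Adj u v := by
    rcases hab with ⟨rfl, rfl⟩ | ⟨rfl, rfl⟩
    · exact h1
    · exact h1.symm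
  have g2 : (pathG u l' v).Adj u v := by
    rcases hab with ⟨rfl, rfl⟩ | ⟨rfl, rfl⟩
    · exact h2
    · exact h2.symm
  rcases hne with h | h
  · exact key l hul hvl h g1
  · exact key l' hul' hvl' h g2

theorem theta_data_gen {V : Type*} [Fintype V] {R : Type*} [CommRing R] (Y w : R) (G : SimpleGraph V)
    {u v : V} {l1 l2 l3 : List V} (hnd : (u :: v :: (l1 ++ l2 ++ l3)).Nodup)
    (hmem : ∀ z, z ∈ u :: v :: (l1 ++ l2 ++ l3)) (c12 : l1 ≠ [] ∨ l2 ≠ []) (c13 : l1 ≠ [] ∨ l3 ≠ [])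
    (c23 : l2 ≠ [] ∨ l3 ≠ []) (hE : G = pathG u l1 v ⊔ pathG u l2 v ⊔ pathG u l3 v) :
    u ≠ v ∧ dg G u = 3 ∧ dg G v = 3 ∧ (∀ z, z ≠ u → z ≠ v → dg G z = 2) ∧
      pr (mat G (fun z => if z = u ∨ z = v then w else Y)) = thF Y w l1.length l2.length l3.length := by
  have hpr := theta_pr Y w (H := ⊥) (d := fun _ => (1 : R)) hnd (by simp) (by simp) c12 c13 c23
  have hone : pr (mat (⊥ : SimpleGraph (V)) (fun _ => (1 : R))) = 1 := by
    refine Eq.trans ?_ (pr_unit (V := V) (R := R))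
    congr 1
    funext z
    exact (mat_iso1 (H := (⊥ : SimpleGraph (V))) (d := fun _ => (1 : R))
      (x := z) (by simp) rfl).1
  rw [hone, mul_one, bot_sup_eq, ← hE] at hpr
  have hnd' := hnd
  simp only [List.nodup_cons, List.mem_cons, List.mem_append, not_or, List.nodup_append'] at hnd'
  have huv : u ≠ v := hnd'.1.1
  obtain ⟨⟨_, ⟨hu1, hu2⟩, hu3⟩, ⟨⟨hv1, hv2⟩, hv3⟩, ⟨⟨n1, n2, n12⟩, n3, n123⟩⟩ := hnd'
  have d12 : ∀ z ∈ l1, z ∉ l2 := fun z h h' => n12 h h'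
  have d13 : ∀ z ∈ l1, z ∉ l3 := fun z h h' => n123 (by simp [h]) h'
  have d23 : ∀ z ∈ l2, z ∉ l3 := fun z h h' => n123 (by simp [h]) h'
  have hdg : ∀ z, dg (G) z = dg (pathG u l1 v) z + dg (pathG u l2 v) z +
      dg (pathG u l3 v) z := by
    intro z
    rw [hE, dg_sup, dg_sup]
    · exact theta_dis u v huv l1 l2 hu1 hv1 hu2 hv2 d12 c12
    · intro a b h
      rw [SimpleGraph.sup_adj] at h
      rcases h with h | h
      · exact theta_dis u v huv l1 l3 hu1 hv1 hu3 hv3 d13 c13 a b h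
      · exact theta_dis u v huv l2 l3 hu2 hv2 hu3 hv3 d23 c23 a b h
  simp only [dg_pathG l1 u v huv hu1 hv1 n1, dg_pathG l2 u v huv hu2 hv2 n2,
    dg_pathG l3 u v huv hu3 hv3 n3] at hdg
  refine ⟨huv, ?_, ?_, ?_, ?_⟩
  · rw [hdg]; simp [huv, hu1, hu2, hu3]
  · rw [hdg]; simp [huv.symm, hv1, hv2, hv3]
  · intro z hzu hzv
    have := hmem z
    simp only [List.mem_cons, hzu, hzv, false_or, List.mem_append] at this
    rw [hdg]
    rcases this with (h | h) | h
    · simp [hzu, hzv, h, d12 z h, d13 z h]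
    · simp [hzu, hzv, h, d23 z h, show z ∉ l1 from fun h' => d12 z h' h]
    · simp [hzu, hzv, h, show z ∉ l1 from fun h' => d13 z h' h, show z ∉ l2 from fun h' => d23 z h' h]
  · rw [← hpr]
    congr 2
    funext z
    have hz := hmem z
    unfold ov
    by_cases h1 : z = u ∨ z = v
    · have a1 : z ∉ l1 := by rintro h; rcases h1 with rfl | rfl <;> tauto
      have a2 : z ∉ l2 := by rintro h; rcases h1 with rfl | rfl <;> tauto
      have a3 : z ∉ l3 := by rintro h; rcases h1 with rfl | rfl <;> tauto
      rw [if_pos h1, if_neg a1, if_neg a2, if_neg a3]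
      by_cases hzv : z = v
      · rw [hzv]; simp
      · have : z = u := h1.resolve_right hzv
        rw [this]; simp [huv]
    · rw [if_neg h1]
      rw [not_or] at h1
      simp only [List.mem_cons, h1.1, h1.2, false_or, List.mem_append] at hz
      split_ifs with b1 b2 b3
      · rfl
      · rfl
      · rfl
      · tauto

theorem theta_data {R : Type*} [CommRing R] (p q r : ℕ)
    (h0 : (0 < p ∧ 0 < q) ∨ (0 < p ∧ 0 < r) ∨ (0 < q ∧ 0 < r)) (Y w : R) :
    ∃ u v : Fin (p + q + r + 2), u ≠ v ∧ dg (thetaGraph p q r) u = 3 ∧ dg (thetaGraph p q r) v = 3 ∧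
      (∀ z, z ≠ u → z ≠ v → dg (thetaGraph p q r) z = 2) ∧
      pr (mat (thetaGraph p q r) (fun z => if z = u ∨ z = v then w else Y)) = thF Y w p q r := by
  let φ : ℕ → Fin (p + q + r + 2) := fun i => Fin.ofNat _ i
  have hφ : ∀ i, i < p + q + r + 2 → (φ i).val = i := by
    intro i hi; simp [φ, Nat.mod_eq_of_lt hi]
  have hE := theta_eq_paths p q r φ hφ
  have hinj : Set.InjOn φ {i | i < p + q + r + 2} := by
    intro a ha b hb hab
    rw [← hφ a ha, ← hφ b hb, hab]
  set u := φ 0 with hu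
  set v := φ 1 with hv
  set l1 := (List.range' 2 p).map φ with hl1
  set l2 := (List.range' (p + 2) q).map φ with hl2
  set l3 := (List.range' (p + q + 2) r).map φ with hl3
  have hL : u :: v :: (l1 ++ l2 ++ l3) = (List.range' 0 (p + q + r + 2)).map φ := by
    rw [hl1, hl2, hl3, ← List.map_append, ← List.map_append, hu, hv, ← List.map_cons,
      ← List.map_cons]
    congr 1
    rw [show p + q + r + 2 = (p + q + r) + 1 + 1 by omega, List.range'_succ, List.range'_succ]
    congr 2
    rw [show p + 2 = 2 + 1 * p by omega, List.range'_append,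
      show p + q + 2 = 2 + 1 * (p + q) by omega, List.range'_append]
  have hnd : (u :: v :: (l1 ++ l2 ++ l3)).Nodup := by
    rw [hL]
    apply List.Nodup.map_on
    · intro x hx y hy hxy
      apply hinj _ _ hxy
      · simp only [List.mem_range'_1] at hx; simp only [Set.mem_ofPred_eq]; omega
      · simp only [List.mem_range'_1] at hy; simp only [Set.mem_ofPred_eq]; omega
    · exact List.nodup_range'
  have hmem : ∀ z, z ∈ u :: v :: (l1 ++ l2 ++ l3) := by
    intro z
    rw [hL, List.mem_map]
    exact ⟨z.val, by simp only [List.mem_range'_1]; omega, Fin.ext (hφ _ z.isLt)⟩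
  have len1 : l1.length = p := by simp [hl1]
  have len2 : l2.length = q := by simp [hl2]
  have len3 : l3.length = r := by simp [hl3]
  have ne_of : ∀ {l : List (Fin (p + q + r + 2))} {k}, l.length = k → 0 < k → l ≠ [] := by
    rintro l k h1 h2 rfl; simp at h1; omega
  have c12 : l1 ≠ [] ∨ l2 ≠ [] := by
    rcases h0 with h | h | h
    · exact Or.inl (ne_of len1 h.1)
    · exact Or.inl (ne_of len1 h.1)
    · exact Or.inr (ne_of len2 h.1)
  have c13 : l1 ≠ [] ∨ l3 ≠ [] := by
    rcases h0 with h | h | h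
    · exact Or.inl (ne_of len1 h.1)
    · exact Or.inl (ne_of len1 h.1)
    · exact Or.inr (ne_of len3 h.2)
  have c23 : l2 ≠ [] ∨ l3 ≠ [] := by
    rcases h0 with h | h | h
    · exact Or.inl (ne_of len2 h.2)
    · exact Or.inr (ne_of len3 h.2)
    · exact Or.inl (ne_of len2 h.1)
  have H := theta_data_gen Y w (thetaGraph p q r) hnd hmem c12 c13 c23 hE
  rw [len1, len2, len3] at H
  refine ⟨u, v, H.1, H.2.1, H.2.2.1, H.2.2.2.1, ?_⟩
  rw [← H.2.2.2.2]
  congr 2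
  funext z
  by_cases hz : z = u ∨ z = v
  · rw [if_pos hz, if_pos hz]
  · rw [if_neg hz, if_neg hz]

end ThetaIso


/-! ## Closed forms after the substitution `Y = 1/z - z` -/

section Closed

variable {R : Type*} [CommRing R]

/-- `(-z²)^a`. -/
def ut (z : R) (a : ℕ) : R := (-z ^ 2) ^ a

/-- `1 - z + 2 z²`. -/
def Bz (z : R) : R := 1 - z + 2 * z ^ 2

/-- Closed form of the theta polynomial. -/
def Sth (z : R) (a b c : ℕ) : R :=
  Bz z ^ 2 - z ^ 2 * (1 - z) ^ 2 * (ut z a + ut z b + ut z c)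
    + (1 + z) ^ 2 * (ut z a * ut z b + ut z a * ut z c + ut z b * ut z c)
    - (2 + z + z ^ 2) ^ 2 * (ut z a * ut z b * ut z c)
    + 2 * (1 + z ^ 2) ^ 2 * (z ^ (a + b) * (1 - ut z c) + z ^ (a + c) * (1 - ut z b)
      + z ^ (b + c) * (1 - ut z a))

/-- First loop factor. -/
def Xl (z : R) (b : ℕ) : R := Bz z + (1 + z) * ut z b + 2 * (1 + z ^ 2) * z ^ b

/-- Second loop factor. -/
def Yl (z : R) (b : ℕ) : R := z * (z - 1) + (2 + z + z ^ 2) * ut z b + 2 * (1 + z ^ 2) * z ^ b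

/-- Closed form of the dumbbell polynomial. -/
def Sdb (z : R) (a b c : ℕ) : R := Xl z b * Xl z c - ut z a * (Yl z b * Yl z c)

/-- Closed form of the cycle polynomial. -/
def Cz (z : R) (k : ℕ) : R := 1 + 2 * z ^ k + ut z k

theorem map_Sth {S : Type*} [CommRing S] (f : R →+* S) (z : R) (a b c : ℕ) :
    f (Sth z a b c) = Sth (f z) a b c := by
  simp [Sth, ut, Bz, map_ofNat f 2]

theorem map_Sdb {S : Type*} [CommRing S] (f : R →+* S) (z : R) (a b c : ℕ) :
    f (Sdb z a b c) = Sdb (f z) a b c := by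
  simp [Sdb, Xl, Yl, ut, Bz, map_ofNat f 2]

theorem map_Cz {S : Type*} [CommRing S] (f : R →+* S) (z : R) (k : ℕ) :
    f (Cz z k) = Cz (f z) k := by
  simp [Cz, ut, map_ofNat f 2]

theorem map_prodCz {S : Type*} [CommRing S] (f : R →+* S) (z : R) (K : List ℕ) :
    f ((K.map (Cz z)).prod) = (K.map (Cz (f z))).prod := by
  induction K with
  | nil => simp
  | cons k K ih => simp [map_Cz, ih]

theorem Fs_closed {z Y : R} (h : z * Y = 1 - z ^ 2) (m : ℕ) :
    (1 + z ^ 2) * (z ^ m * Fs Y m) = z ^ 2 + (-z ^ 2) ^ m ∧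
    (1 + z ^ 2) * (z ^ (m + 1) * Fs Y (m + 1)) = z ^ 2 + (-z ^ 2) ^ (m + 1) := by
  induction m with
  | zero => constructor <;> simp [Fs]; ring
  | succ m ih =>
    refine ⟨ih.2, ?_⟩
    have e : Fs Y (m + 1 + 1) = Y * Fs Y (m + 1) + Fs Y m := rfl
    rw [e]
    have h1 := ih.1
    have h2 := ih.2
    linear_combination (1 + z ^ 2) * z ^ (m + 1) * Fs Y (m + 1) * h + (1 - z ^ 2) * h2 + z ^ 2 * h1

section Fld
variable {F : Type*} [Field F] {z Y : F}

theorem Fs_div (h : z * Y = 1 - z ^ 2) (hz : z ≠ 0) (hk : 1 + z ^ 2 ≠ 0) (m : ℕ) :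
    Fs Y m = (z ^ 2 + (-z ^ 2) ^ m) / ((1 + z ^ 2) * z ^ m) ∧
    Fs Y (m + 1) = (z ^ 2 - z ^ 2 * (-z ^ 2) ^ m) / ((1 + z ^ 2) * (z ^ m * z)) ∧
    Fs Y (m + 2) = (z ^ 2 + z ^ 4 * (-z ^ 2) ^ m) / ((1 + z ^ 2) * (z ^ m * z ^ 2)) := by
  refine ⟨?_, ?_, ?_⟩
  · rw [eq_div_iff (mul_ne_zero hk (by simp [hz])), ← (Fs_closed h m).1]; ring
  · rw [eq_div_iff (mul_ne_zero hk (by simp [hz]))]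
    have := (Fs_closed h m).2
    linear_combination this
  · rw [eq_div_iff (mul_ne_zero hk (by simp [hz]))]
    have := (Fs_closed h (m + 1)).2
    linear_combination this

theorem thF_closed (h : z * Y = 1 - z ^ 2) (hz : z ≠ 0) (hk : 1 + z ^ 2 ≠ 0) (p q r : ℕ) :
    (1 + z ^ 2) ^ 3 * (z ^ (p + q + r + 2) * thF Y (Y - 1) p q r) =
      Sth z (p + 1) (q + 1) (r + 1) := by
  obtain ⟨p0, p1, p2⟩ := Fs_div h hz hk p
  obtain ⟨q0, q1, q2⟩ := Fs_div h hz hk q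
  obtain ⟨r0, r1, r2⟩ := Fs_div h hz hk r
  have hY : Y = (1 - z ^ 2) / z := by rw [eq_div_iff hz, ← h]; ring
  simp only [thF, p0, p1, p2, q0, q1, q2, r0, r1, r2, Sth, ut, Bz, pow_add, pow_one]
  have h1 : z ^ p ≠ 0 := pow_ne_zero _ hz
  have h2 : z ^ q ≠ 0 := pow_ne_zero _ hz
  have h3 : z ^ r ≠ 0 := pow_ne_zero _ hz
  rw [hY]
  clear p0 p1 p2 q0 q1 q2 r0 r1 r2
  generalize z ^ p = zp at *
  generalize z ^ q = zq at *
  generalize z ^ r = zr at *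
  generalize (-z ^ 2) ^ p = tp at *
  generalize (-z ^ 2) ^ q = tq at *
  generalize (-z ^ 2) ^ r = tr at *
  field_simp
  ring

theorem dbF_closed (h : z * Y = 1 - z ^ 2) (hz : z ≠ 0) (hk : 1 + z ^ 2 ≠ 0) (k b c : ℕ) :
    (1 + z ^ 2) ^ 3 * (z ^ (k + b + c) * dbF Y (Y - 1) k b c) =
      Sdb z (k + 1) b c := by
  obtain ⟨p0, p1, p2⟩ := Fs_div h hz hk k
  obtain ⟨q0, q1, q2⟩ := Fs_div h hz hk b
  obtain ⟨r0, r1, r2⟩ := Fs_div h hz hk c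
  have hY : Y = (1 - z ^ 2) / z := by rw [eq_div_iff hz, ← h]; ring
  simp only [dbF, p0, p1, p2, q0, q1, q2, r0, r1, r2, Sdb, Xl, Yl, ut, Bz, pow_add, pow_one]
  have h1 : z ^ k ≠ 0 := pow_ne_zero _ hz
  have h2 : z ^ b ≠ 0 := pow_ne_zero _ hz
  have h3 : z ^ c ≠ 0 := pow_ne_zero _ hz
  rw [hY]
  clear p0 p1 p2 q0 q1 q2 r0 r1 r2
  generalize z ^ k = zp at *
  generalize z ^ b = zq at *
  generalize z ^ c = zr at *
  generalize (-z ^ 2) ^ k = tp at *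
  generalize (-z ^ 2) ^ b = tq at *
  generalize (-z ^ 2) ^ c = tr at *
  field_simp
  ring

theorem cyc_closed (h : z * Y = 1 - z ^ 2) (hz : z ≠ 0) (hk : 1 + z ^ 2 ≠ 0) (k : ℕ) :
    z ^ k * cyc Y k = Cz z k := by
  obtain ⟨p0, p1, p2⟩ := Fs_div h hz hk k
  simp only [cyc, p0, p2, Cz, ut]
  have h1 : z ^ k ≠ 0 := pow_ne_zero _ hz
  clear p0 p1 p2
  generalize z ^ k = zp at *
  generalize (-z ^ 2) ^ k = tp at *
  field_simp
  ring

theorem cycs_closed (h : z * Y = 1 - z ^ 2) (hz : z ≠ 0) (hk : 1 + z ^ 2 ≠ 0) (K : List ℕ) :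
    z ^ K.sum * (K.map (cyc Y)).prod = (K.map (Cz z)).prod := by
  induction K with
  | nil => simp
  | cons k K ih =>
    simp only [List.sum_cons, List.map_cons, List.prod_cons, ← ih, ← cyc_closed h hz hk k, pow_add]
    ring

end Fld

/-- The field of rational functions in which the substitution takes place. -/
abbrev FF := RatFunc ℚ

/-- The substituted variable. -/
def YF : FF := (RatFunc.X : FF)⁻¹ - RatFunc.X

/-- Embedding of integer polynomials. -/
def phi : ℤ[X] →+* FF := (algebraMap ℚ[X] FF).comp (Polynomial.mapRingHom (Int.castRingHom ℚ))

theorem phi_inj : Function.Injective phi := by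
  unfold phi
  rw [RingHom.coe_comp]
  exact (RatFunc.algebraMap_injective ℚ).comp
    (Polynomial.map_injective _ (RingHom.injective_int (Int.castRingHom ℚ)))

theorem phi_X : phi X = RatFunc.X := by
  simp [phi]

theorem YF_eq : (RatFunc.X : FF) * YF = 1 - RatFunc.X ^ 2 := by
  have := RatFunc.X_ne_zero (K := ℚ)
  unfold YF
  field_simp

theorem kap_ne : (1 + RatFunc.X ^ 2 : FF) ≠ 0 := by
  rw [← phi_X, ← map_pow, ← map_one phi, ← map_add, ← map_zero phi]
  intro h
  have := congrArg (Polynomial.eval 0) (phi_inj h)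
  simp at this

theorem pow_cancel {A B : ℤ[X]} {n m : ℕ} (h : X ^ m * A = X ^ n * B) (hA : A.coeff 0 = 1)
    (hB : B.coeff 0 = 1) : n = m ∧ A = B := by
  have key : n = m := by
    rcases lt_trichotomy n m with h1 | h1 | h1
    · have := congrArg (fun p => p.coeff n) h
      simp only [Polynomial.coeff_X_pow_mul', le_refl, if_true, Nat.sub_self, hB] at this
      rw [if_neg (by omega)] at this
      omega
    · exact h1
    · have := congrArg (fun p => p.coeff m) h
      simp only [Polynomial.coeff_X_pow_mul', le_refl, if_true, Nat.sub_self, hA] at this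
      rw [if_neg (by omega)] at this
      omega
  refine ⟨key, ?_⟩
  subst key
  exact mul_left_cancel₀ (pow_ne_zero _ X_ne_zero) h

theorem Sth_zero (a b c : ℕ) : (Sth (X : ℤ[X]) (a + 1) (b + 1) (c + 1)).coeff 0 = 1 := by
  rw [Polynomial.coeff_zero_eq_eval_zero, ← Polynomial.coe_evalRingHom, map_Sth]
  simp [Sth, ut, Bz]

theorem Sdb_zero (a b c : ℕ) (hb : 0 < b) (hc : 0 < c) : (Sdb (X : ℤ[X]) (a + 1) b c).coeff 0 = 1 := by
  rw [Polynomial.coeff_zero_eq_eval_zero, ← Polynomial.coe_evalRingHom, map_Sdb]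
  simp [Sdb, Xl, Yl, ut, Bz, hb.ne', hc.ne']

theorem prodC_zero (K : List ℕ) (hK : ∀ k ∈ K, 3 ≤ k) : ((K.map (Cz (X : ℤ[X]))).prod).coeff 0 = 1 := by
  rw [Polynomial.coeff_zero_eq_eval_zero, ← Polynomial.coe_evalRingHom, map_prodCz]
  induction K with
  | nil => simp
  | cons k K ih =>
    have : k ≠ 0 := by have := hK k (by simp); omega
    rw [List.map_cons, List.prod_cons, ih (fun k hk => hK k (by simp [hk]))]
    simp [Cz, ut, this]

theorem transfer_theta {p q r p' q' r' : ℕ} {K : List ℕ} (hK : ∀ k ∈ K, 3 ≤ k)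
    (h : thF YF (YF - 1) p q r = thF YF (YF - 1) p' q' r' * (K.map (cyc YF)).prod) :
    p + q + r + 2 = p' + q' + r' + 2 + K.sum ∧
    Sth (X : ℤ[X]) (p + 1) (q + 1) (r + 1) =
      Sth X (p' + 1) (q' + 1) (r' + 1) * (K.map (Cz X)).prod := by
  have e1 := thF_closed YF_eq RatFunc.X_ne_zero kap_ne p q r
  have e2 := thF_closed YF_eq RatFunc.X_ne_zero kap_ne p' q' r'
  have e3 := cycs_closed YF_eq RatFunc.X_ne_zero kap_ne K
  apply pow_cancel _ (Sth_zero p q r)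
    (by rw [Polynomial.mul_coeff_zero, Sth_zero, prodC_zero K hK, one_mul])
  apply phi_inj
  simp only [map_mul, map_pow, map_Sth, map_prodCz, phi_X]
  rw [← e1, ← e2, ← e3, h, pow_add _ _ K.sum]
  ring

theorem transfer_db {p q r k b c : ℕ} {K : List ℕ} (hb : 3 ≤ b) (hc : 3 ≤ c) (hK : ∀ k ∈ K, 3 ≤ k)
    (h : thF YF (YF - 1) p q r = dbF YF (YF - 1) k b c * (K.map (cyc YF)).prod) :
    p + q + r + 2 = k + b + c + K.sum ∧
    Sth (X : ℤ[X]) (p + 1) (q + 1) (r + 1) = Sdb X (k + 1) b c * (K.map (Cz X)).prod := by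
  have e1 := thF_closed YF_eq RatFunc.X_ne_zero kap_ne p q r
  have e2 := dbF_closed YF_eq RatFunc.X_ne_zero kap_ne k b c
  have e3 := cycs_closed YF_eq RatFunc.X_ne_zero kap_ne K
  apply pow_cancel _ (Sth_zero p q r)
    (by rw [Polynomial.mul_coeff_zero, Sdb_zero k b c (by omega) (by omega), prodC_zero K hK, one_mul])
  apply phi_inj
  simp only [map_mul, map_pow, map_Sth, map_Sdb, map_prodCz, phi_X]
  rw [← e1, ← e2, ← e3, h, pow_add _ _ K.sum]
  ring

end Closed


/-! ## Low order terms -/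

section Low

/-- Sum of the monomials `z^k`. -/
def sz {R : Type*} [CommRing R] (z : R) (K : List ℕ) : R := (K.map (fun k => z ^ k)).sum

theorem sz_nil {R : Type*} [CommRing R] (z : R) : sz z [] = 0 := by simp [sz]

theorem sz_cons {R : Type*} [CommRing R] (z : R) (k : ℕ) (K : List ℕ) :
    sz z (k :: K) = z ^ k + sz z K := by simp [sz]

theorem sz_coeff {R : Type*} [CommRing R] (K : List ℕ) (d : ℕ) :
    (sz (X : R[X]) K).coeff d = (K.count d : R) := by
  induction K with
  | nil => simp [sz_nil]
  | cons k K ih =>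
    rw [sz_cons, coeff_add, ih, coeff_X_pow, List.count_cons]
    by_cases h : d = k
    · subst h; simp [add_comm]
    · have h' : ¬ k = d := fun e => h e.symm
      simp [h, h']

theorem sz_dvd {R : Type*} [CommRing R] (z : R) {h : ℕ} (K : List ℕ) (hK : ∀ k ∈ K, h ≤ k) :
    z ^ h ∣ sz z K := by
  induction K with
  | nil => simp [sz_nil]
  | cons k K ih =>
    rw [sz_cons]
    exact dvd_add (pow_dvd_pow _ (hK k (by simp))) (ih fun k hk => hK k (by simp [hk]))

theorem prod_low {R : Type*} [CommRing R] (z α : R) (f : ℕ → R) {h : ℕ} (K : List ℕ)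
    (hK : ∀ k ∈ K, h ≤ k) (hf : ∀ k ∈ K, z ^ (2 * h) ∣ f k - (1 + α * z ^ k)) :
    z ^ (2 * h) ∣ (K.map f).prod - (1 + α * sz z K) := by
  induction K with
  | nil => simp [sz_nil]
  | cons k K ih =>
    rw [List.map_cons, List.prod_cons, sz_cons]
    have h1 := ih (fun k hk => hK k (by simp [hk])) (fun k hk => hf k (by simp [hk]))
    have h2 := hf k (by simp)
    have h3 : z ^ (2 * h) ∣ z ^ k * sz z K := by
      rw [two_mul, pow_add]
      exact mul_dvd_mul (pow_dvd_pow _ (hK k (by simp))) (sz_dvd z K fun k hk => hK k (by simp [hk]))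
    have e : f k * (K.map f).prod - (1 + α * (z ^ k + sz z K)) =
        (f k - (1 + α * z ^ k)) * (K.map f).prod
        + (1 + α * z ^ k) * ((K.map f).prod - (1 + α * sz z K)) + α ^ 2 * (z ^ k * sz z K) := by ring
    rw [e]
    exact dvd_add (dvd_add (h2.mul_right _) (h1.mul_left _)) (h3.mul_left _)

theorem ut_dvd {R : Type*} [CommRing R] (z : R) {m a : ℕ} (h : m ≤ 2 * a) : z ^ m ∣ ut z a := by
  unfold ut
  rw [neg_pow, ← pow_mul]
  exact (pow_dvd_pow _ h).mul_left _

theorem prodC_low {R : Type*} [CommRing R] (z : R) {h : ℕ} (K : List ℕ) (hK : ∀ k ∈ K, h ≤ k) :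
    z ^ (2 * h) ∣ (K.map (Cz z)).prod - (1 + 2 * sz z K) := by
  apply prod_low z 2 _ K hK
  intro k hk
  have := ut_dvd z (m := 2 * h) (a := k) (by have := hK k hk; omega)
  simpa [Cz] using this

/-- `B² - z²(1-z)² u_a`. -/
def Ea {R : Type*} [CommRing R] (z : R) (a : ℕ) : R := Bz z ^ 2 - z ^ 2 * (1 - z) ^ 2 * ut z a

theorem mul_low {R : Type*} [CommRing R] {d S S' P P' : R} (h1 : d ∣ S - S') (h2 : d ∣ P - P') :
    d ∣ S * P - S' * P' := by
  have e : S * P - S' * P' = (S - S') * P + S' * (P - P') := by ring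
  rw [e]
  exact dvd_add (h1.mul_right _) (h2.mul_left _)

theorem pow_mul_dvd {R : Type*} [CommRing R] {z x y : R} {i j m : ℕ} (hx : z ^ i ∣ x) (hy : z ^ j ∣ y)
    (h : m ≤ i + j) : z ^ m ∣ x * y :=
  (pow_dvd_pow z h).trans (by rw [pow_add]; exact mul_dvd_mul hx hy)

theorem theta_low {R : Type*} [CommRing R] (z : R) {a b c h m : ℕ} (K : List ℕ) (hab : a ≤ b) (hbc : b ≤ c)
    (hh : h ≤ a + b) (hK : ∀ k ∈ K, h ≤ k) (h1 : m ≤ 2 * h) (h2 : m ≤ h + 2 * a + 1)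
    (h3 : m ≤ 2 * b + 2) :
    z ^ m ∣ Sth z a b c * (K.map (Cz z)).prod -
      (Ea z a + 2 * ((1 + z ^ 2) ^ 2 * (z ^ (a + b) + z ^ (a + c) + z ^ (b + c)))
        + 2 * (Bz z ^ 2 * sz z K)) := by
  have hQ : z ^ h ∣ z ^ (a + b) + z ^ (a + c) + z ^ (b + c) :=
    dvd_add (dvd_add (pow_dvd_pow _ hh) (pow_dvd_pow _ (by omega))) (pow_dvd_pow _ (by omega))
  have hS := sz_dvd z K hK
  have hP := (pow_dvd_pow z h1).trans (prodC_low z K hK)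
  have ua := ut_dvd z (m := 2 * a) (a := a) le_rfl
  have ub := ut_dvd z (m := 2 * b) (a := b) le_rfl
  have uc := ut_dvd z (m := 2 * c) (a := c) le_rfl
  have uc' := ut_dvd z (m := 2 * b) (a := c) (by omega)
  have uab : z ^ m ∣ ut z a * ut z b := pow_mul_dvd ua ub (by omega)
  have uac : z ^ m ∣ ut z a * ut z c := pow_mul_dvd ua uc' (by omega)
  have ubc : z ^ m ∣ ut z b * ut z c := pow_mul_dvd ub uc (by omega)
  have zb : z ^ m ∣ z ^ 2 * ut z b := pow_mul_dvd dvd_rfl ub (by omega)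
  have zc : z ^ m ∣ z ^ 2 * ut z c := pow_mul_dvd dvd_rfl uc' (by omega)
  have q1 : z ^ m ∣ z ^ (a + b) * ut z c := pow_mul_dvd dvd_rfl uc' (by omega)
  have q2 : z ^ m ∣ z ^ (a + c) * ut z b := pow_mul_dvd dvd_rfl ub (by omega)
  have q3 : z ^ m ∣ z ^ (b + c) * ut z a := pow_mul_dvd dvd_rfl ua (by omega)
  have s1 : z ^ m ∣ Sth z a b c - (Ea z a + 2 * ((1 + z ^ 2) ^ 2 * (z ^ (a + b) + z ^ (a + c) + z ^ (b + c)))) := by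
    have e : Sth z a b c - (Ea z a + 2 * ((1 + z ^ 2) ^ 2 * (z ^ (a + b) + z ^ (a + c) + z ^ (b + c))))
      = - (1 - z) ^ 2 * (z ^ 2 * ut z b) + - (1 - z) ^ 2 * (z ^ 2 * ut z c)
        + ((1 + z) ^ 2 - (2 + z + z ^ 2) ^ 2 * ut z c) * (ut z a * ut z b)
        + (1 + z) ^ 2 * (ut z a * ut z c) + (1 + z) ^ 2 * (ut z b * ut z c)
        + (-(2 * (1 + z ^ 2) ^ 2)) * (z ^ (a + b) * ut z c)
        + (-(2 * (1 + z ^ 2) ^ 2)) * (z ^ (a + c) * ut z b)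
        + (-(2 * (1 + z ^ 2) ^ 2)) * (z ^ (b + c) * ut z a) := by
      unfold Sth Ea; ring
    rw [e]
    exact dvd_add (dvd_add (dvd_add (dvd_add (dvd_add (dvd_add (dvd_add (zb.mul_left _) (zc.mul_left _))
      (uab.mul_left _)) (uac.mul_left _)) (ubc.mul_left _)) (q1.mul_left _)) (q2.mul_left _)) (q3.mul_left _)
  have s2 := mul_low s1 hP
  have t1 : z ^ m ∣ (z ^ (a + b) + z ^ (a + c) + z ^ (b + c)) * sz z K := pow_mul_dvd hQ hS (by omega)
  have t2 : z ^ m ∣ (z ^ 2 * ut z a) * sz z K :=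
    pow_mul_dvd (i := 2 + 2 * a) (pow_mul_dvd dvd_rfl ua le_rfl) hS (by omega)
  have s3 : z ^ m ∣ (Ea z a + 2 * ((1 + z ^ 2) ^ 2 * (z ^ (a + b) + z ^ (a + c) + z ^ (b + c))))
        * (1 + 2 * sz z K) -
      (Ea z a + 2 * ((1 + z ^ 2) ^ 2 * (z ^ (a + b) + z ^ (a + c) + z ^ (b + c)))
        + 2 * (Bz z ^ 2 * sz z K)) := by
    have e : (Ea z a + 2 * ((1 + z ^ 2) ^ 2 * (z ^ (a + b) + z ^ (a + c) + z ^ (b + c))))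
        * (1 + 2 * sz z K) -
      (Ea z a + 2 * ((1 + z ^ 2) ^ 2 * (z ^ (a + b) + z ^ (a + c) + z ^ (b + c)))
        + 2 * (Bz z ^ 2 * sz z K)) =
        4 * (1 + z ^ 2) ^ 2 * ((z ^ (a + b) + z ^ (a + c) + z ^ (b + c)) * sz z K)
        + (-2 * (1 - z) ^ 2) * ((z ^ 2 * ut z a) * sz z K) := by
      unfold Ea; ring
    rw [e]
    exact dvd_add (t1.mul_left _) (t2.mul_left _)
  have := dvd_add s2 s3
  rwa [sub_add_sub_cancel] at this

theorem db_low {R : Type*} [CommRing R] (z : R) {a b c h m : ℕ} (K : List ℕ)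
    (hb : h ≤ b) (hc : h ≤ c) (hK : ∀ k ∈ K, h ≤ k) (h1 : m ≤ 2 * h) (h2 : m ≤ h + 2 * a + 1) :
    z ^ m ∣ Sdb z a b c * (K.map (Cz z)).prod -
      (Ea z a + 2 * ((1 + z ^ 2) * Bz z * (z ^ b + z ^ c)) + 2 * (Bz z ^ 2 * sz z K)) := by
  have hQ : z ^ h ∣ z ^ b + z ^ c := dvd_add (pow_dvd_pow _ hb) (pow_dvd_pow _ hc)
  have hS := sz_dvd z K hK
  have hP := (pow_dvd_pow z h1).trans (prodC_low z K hK)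
  have ua := ut_dvd z (m := 2 * a) (a := a) le_rfl
  have ub := ut_dvd z (m := m) (a := b) (by omega)
  have uc := ut_dvd z (m := m) (a := c) (by omega)
  have zbc : z ^ m ∣ z ^ b * z ^ c := pow_mul_dvd dvd_rfl dvd_rfl (by omega)
  have za : z ^ m ∣ (z * ut z a) * (z ^ b + z ^ c) :=
    pow_mul_dvd (i := 1 + 2 * a) (pow_mul_dvd (i := 1) (by simp) ua le_rfl) hQ (by omega)
  have s1 : z ^ m ∣ Sdb z a b c - (Ea z a + 2 * ((1 + z ^ 2) * Bz z * (z ^ b + z ^ c))) := by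
    have e : Sdb z a b c - (Ea z a + 2 * ((1 + z ^ 2) * Bz z * (z ^ b + z ^ c)))
      = ((1 + z) * Xl z c - ut z a * ((2 + z + z ^ 2) * Yl z c)) * ut z b
        + ((1 + z) * (Bz z + 2 * (1 + z ^ 2) * z ^ b)
          - ut z a * ((2 + z + z ^ 2) * (z * (z - 1) + 2 * (1 + z ^ 2) * z ^ b))) * ut z c
        + ((2 * (1 + z ^ 2)) ^ 2 * (1 - ut z a)) * (z ^ b * z ^ c)
        + (2 * (1 + z ^ 2) * (1 - z)) * ((z * ut z a) * (z ^ b + z ^ c)) := by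
      unfold Sdb Xl Yl Ea; ring
    rw [e]
    exact dvd_add (dvd_add (dvd_add (ub.mul_left _) (uc.mul_left _)) (zbc.mul_left _)) (za.mul_left _)
  have s2 := mul_low s1 hP
  have t1 : z ^ m ∣ (z ^ b + z ^ c) * sz z K := pow_mul_dvd hQ hS (by omega)
  have t2 : z ^ m ∣ (z ^ 2 * ut z a) * sz z K :=
    pow_mul_dvd (i := 2 + 2 * a) (pow_mul_dvd dvd_rfl ua le_rfl) hS (by omega)
  have s3 : z ^ m ∣ (Ea z a + 2 * ((1 + z ^ 2) * Bz z * (z ^ b + z ^ c)))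
        * (1 + 2 * sz z K) -
      (Ea z a + 2 * ((1 + z ^ 2) * Bz z * (z ^ b + z ^ c)) + 2 * (Bz z ^ 2 * sz z K)) := by
    have e : (Ea z a + 2 * ((1 + z ^ 2) * Bz z * (z ^ b + z ^ c)))
        * (1 + 2 * sz z K) -
      (Ea z a + 2 * ((1 + z ^ 2) * Bz z * (z ^ b + z ^ c)) + 2 * (Bz z ^ 2 * sz z K)) =
        4 * ((1 + z ^ 2) * Bz z) * ((z ^ b + z ^ c) * sz z K)
        + (-2 * (1 - z) ^ 2) * ((z ^ 2 * ut z a) * sz z K) := by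
      unfold Ea; ring
    rw [e]
    exact dvd_add (t1.mul_left _) (t2.mul_left _)
  have := dvd_add s2 s3
  rwa [sub_add_sub_cancel] at this

/-! ### Reduction modulo two -/

/-- Theta polynomial modulo two. -/
def T2 {R : Type*} [CommRing R] (v : R) (a b c : ℕ) : R :=
  1 + v ^ (a + 1) + v ^ (b + 1) + v ^ (c + 1) + v ^ (a + b) + v ^ (a + c) + v ^ (b + c)
    + v ^ (a + b + c + 1)

/-- Dumbbell polynomial modulo two. -/
def D2 {R : Type*} [CommRing R] (v : R) (a b c : ℕ) : R :=
  (1 + v ^ (a + 1)) * ((1 + v ^ b) * (1 + v ^ c))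

theorem ut_two {R : Type*} [CommRing R] (h2 : (2 : R) = 0) (z : R) (a : ℕ) : ut z a = (z ^ 2) ^ a := by
  have : -z ^ 2 = z ^ 2 := by linear_combination -z ^ 2 * h2
  rw [ut, this]

theorem Sth_two {R : Type*} [CommRing R] (h2 : (2 : R) = 0) (z : R) (a b c : ℕ) :
    Sth z a b c = (1 + z ^ 2) * T2 (z ^ 2) a b c := by
  unfold Sth T2 Bz
  simp only [ut_two h2]
  rw [pow_succ (z ^ 2) a, pow_succ (z ^ 2) b, pow_succ (z ^ 2) c, pow_succ (z ^ 2) (a + b + c),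
    pow_add (z ^ 2) (a + b) c, pow_add (z ^ 2) a b, pow_add (z ^ 2) a c, pow_add (z ^ 2) b c]
  generalize (z ^ 2) ^ a = A
  generalize (z ^ 2) ^ b = B
  generalize (z ^ 2) ^ c = C
  linear_combination ((-z + 2 * z ^ 2 - 2 * z ^ 3 + 2 * z ^ 4) - z ^ 2 * (1 - z + z ^ 2) * (A + B + C)
    + z * (A * B + A * C + B * C) - (2 + 2 * z + 3 * z ^ 2 + z ^ 3 + z ^ 4) * (A * B * C)
    + (1 + z ^ 2) ^ 2 * (z ^ (a + b) * (1 - C) + z ^ (a + c) * (1 - B)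
      + z ^ (b + c) * (1 - A))) * h2

theorem Sdb_two {R : Type*} [CommRing R] (h2 : (2 : R) = 0) (z : R) (a b c : ℕ) :
    Sdb z a b c = (1 + z ^ 2) * D2 (z ^ 2) a b c := by
  have hX : ∀ b, Xl z b = (1 + z) * (1 + (z ^ 2) ^ b) := by
    intro b
    unfold Xl Bz
    rw [ut_two h2]
    linear_combination (-z + z ^ 2 + (1 + z ^ 2) * z ^ b) * h2
  have hY : ∀ b, Yl z b = z * (1 + z) * (1 + (z ^ 2) ^ b) := by
    intro b
    unfold Yl
    rw [ut_two h2]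
    linear_combination (-z + (z ^ 2) ^ b + (1 + z ^ 2) * z ^ b) * h2
  unfold Sdb D2
  rw [hX, hX, hY, hY, ut_two h2, pow_succ (z ^ 2) a]
  generalize (z ^ 2) ^ a = A
  generalize (z ^ 2) ^ b = B
  generalize (z ^ 2) ^ c = C
  linear_combination ((1 + B) * (1 + C) * z * (1 - A * z ^ 2)
    - (1 + z ^ 2) * (1 + B) * (1 + C) * A * z ^ 2) * h2

theorem Cz_two {R : Type*} [CommRing R] (h2 : (2 : R) = 0) (z : R) (k : ℕ) :
    Cz z k = 1 + (z ^ 2) ^ k := by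
  unfold Cz
  rw [ut_two h2, h2]; ring

/-- Product of the cycle factors modulo two. -/
def P2 {R : Type*} [CommRing R] (v : R) (K : List ℕ) : R := (K.map (fun k => 1 + v ^ k)).prod

theorem prodCz_two {R : Type*} [CommRing R] (h2 : (2 : R) = 0) (z : R) (K : List ℕ) :
    (K.map (Cz z)).prod = P2 (z ^ 2) K := by
  unfold P2
  congr 1
  apply List.map_congr_left
  intro k _
  exact Cz_two h2 z k

theorem expand_P2 (K : List ℕ) :
    expand (ZMod 2) 2 (P2 X K) = P2 (X ^ 2) K := by
  unfold P2
  induction K with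
  | nil => simp
  | cons k K ih => simp only [List.map_cons, List.prod_cons, map_mul, ih]; simp

theorem two_poly : (2 : (ZMod 2)[X]) = 0 := by
  have : (2 : ZMod 2) = 0 := by decide
  have e : (2 : (ZMod 2)[X]) = C (2 : ZMod 2) := by rw [map_ofNat]
  rw [e, this, map_zero]

theorem kap2_ne : (1 + X ^ 2 : (ZMod 2)[X]) ≠ 0 := by
  intro h
  have := congrArg (Polynomial.eval 0) h
  simp at this

theorem mod2_theta {a b c a' b' c' : ℕ} {K : List ℕ}
    (h : Sth (X : ℤ[X]) a b c = Sth X a' b' c' * (K.map (Cz X)).prod) :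
    T2 (X : (ZMod 2)[X]) a b c = T2 X a' b' c' * P2 X K := by
  have h' := congrArg (Polynomial.mapRingHom (Int.castRingHom (ZMod 2))) h
  rw [map_mul, map_Sth, map_Sth, map_prodCz] at h'
  simp only [coe_mapRingHom, map_X] at h'
  rw [Sth_two two_poly, Sth_two two_poly, prodCz_two two_poly, mul_assoc] at h'
  have h'' := mul_left_cancel₀ kap2_ne h'
  apply expand_injective (R := ZMod 2) (n := 2) (by norm_num)
  rw [map_mul, expand_P2]
  simpa [T2] using h''

theorem mod2_db {a b c a' b' c' : ℕ} {K : List ℕ}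
    (h : Sth (X : ℤ[X]) a b c = Sdb X a' b' c' * (K.map (Cz X)).prod) :
    T2 (X : (ZMod 2)[X]) a b c = (1 + X ^ (a' + 1)) * P2 X (b' :: c' :: K) := by
  have h' := congrArg (Polynomial.mapRingHom (Int.castRingHom (ZMod 2))) h
  rw [map_mul, map_Sth, map_Sdb, map_prodCz] at h'
  simp only [coe_mapRingHom, map_X] at h'
  rw [Sth_two two_poly, Sdb_two two_poly, prodCz_two two_poly, mul_assoc] at h'
  have h'' := mul_left_cancel₀ kap2_ne h'
  apply expand_injective (R := ZMod 2) (n := 2) (by norm_num)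
  rw [map_mul, expand_P2]
  simp only [P2, List.map_cons, List.prod_cons] at h'' ⊢
  simp only [D2, mul_assoc] at h''
  simpa [T2] using h''

end Low


/-! ## Comparison of coefficients -/

section Arith

theorem coeff_eq_of_dvd {R : Type*} [CommRing R] {A B : R[X]} {m d : ℕ} (h : X ^ m ∣ A - B) (hd : d < m) :
    A.coeff d = B.coeff d := by
  have := X_pow_dvd_iff.1 h d hd
  rwa [coeff_sub, sub_eq_zero] at this

theorem coeff_mul_low {R : Type*} [CommRing R] {P Q : R[X]} {h d : ℕ} (hQ : X ^ h ∣ Q) (hd : d ≤ h) :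
    (P * Q).coeff d = P.coeff 0 * Q.coeff d := by
  obtain ⟨W, rfl⟩ := hQ
  rw [show P * (X ^ h * W) = X ^ h * (P * W) by ring, coeff_X_pow_mul', coeff_X_pow_mul']
  by_cases e : h ≤ d
  · have : d = h := le_antisymm hd e
    subst this
    simp [mul_coeff_zero]
  · simp [e]

theorem kap_zero : ((1 + X ^ 2 : ℤ[X]) ^ 2).coeff 0 = 1 := by
  rw [coeff_zero_eq_eval_zero]; simp

theorem kapB_zero : ((1 + X ^ 2 : ℤ[X]) * Bz X).coeff 0 = 1 := by
  rw [coeff_zero_eq_eval_zero]; simp [Bz]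

theorem BB_zero : (Bz (X : ℤ[X]) ^ 2).coeff 0 = 1 := by
  rw [coeff_zero_eq_eval_zero]; simp [Bz]

theorem theta_cnt {a b c h d : ℕ} (K : List ℕ) (hab : a ≤ b) (hbc : b ≤ c)
    (hh : ∀ l ∈ (a + b) :: (a + c) :: (b + c) :: K, h ≤ l) (h1 : 1 ≤ h) (hd : d ≤ h) :
    (Sth (X : ℤ[X]) a b c * (K.map (Cz X)).prod).coeff d =
      (Ea (X : ℤ[X]) a).coeff d + 2 * (((a + b) :: (a + c) :: (b + c) :: K).count d : ℤ) := by
  have hhab := hh (a + b) (by simp)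
  have hK : ∀ k ∈ K, h ≤ k := fun k hk => hh k (by simp [hk])
  rw [coeff_eq_of_dvd (theta_low (X : ℤ[X]) (m := h + 1) K hab hbc hhab hK (by omega) (by omega)
    (by omega)) (by omega)]
  have e : (X : ℤ[X]) ^ (a + b) + X ^ (a + c) + X ^ (b + c) = sz X [a + b, a + c, b + c] := by
    simp [sz, add_assoc]
  rw [e, coeff_add, coeff_add, coeff_ofNat_mul, coeff_ofNat_mul,
    coeff_mul_low (sz_dvd X (h := h) _ (fun l hl => hh l (by simp at hl ⊢; tauto))) hd,
    coeff_mul_low (sz_dvd X K hK) hd, kap_zero, BB_zero, sz_coeff, sz_coeff]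
  have : ((a + b) :: (a + c) :: (b + c) :: K) = [a + b, a + c, b + c] ++ K := rfl
  rw [this, List.count_append]
  push_cast
  ring

theorem db_cnt {a b c h d : ℕ} (K : List ℕ)
    (hh : ∀ l ∈ b :: c :: K, h ≤ l) (h1 : 1 ≤ h) (hd : d ≤ h) :
    (Sdb (X : ℤ[X]) a b c * (K.map (Cz X)).prod).coeff d =
      (Ea (X : ℤ[X]) a).coeff d + 2 * ((b :: c :: K).count d : ℤ) := by
  have hK : ∀ k ∈ K, h ≤ k := fun k hk => hh k (by simp [hk])
  rw [coeff_eq_of_dvd (db_low (X : ℤ[X]) (a := a) (b := b) (c := c) (m := h + 1) K (hh b (by simp)) (hh c (by simp))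
    hK (by omega) (by omega)) (by omega)]
  have e : (X : ℤ[X]) ^ b + X ^ c = sz X [b, c] := by
    simp [sz]
  rw [e, coeff_add, coeff_add, coeff_ofNat_mul, coeff_ofNat_mul,
    coeff_mul_low (sz_dvd X (h := h) _ (fun l hl => hh l (by simp at hl ⊢; tauto))) hd,
    coeff_mul_low (sz_dvd X K hK) hd, kapB_zero, BB_zero, sz_coeff, sz_coeff]
  have : (b :: c :: K) = [b, c] ++ K := rfl
  rw [this, List.count_append]
  push_cast
  ring

theorem Ea_coeff (a d : ℕ) (hd : d ≤ 2 * a + 2) : (Ea (X : ℤ[X]) a).coeff d =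
    (Bz (X : ℤ[X]) ^ 2).coeff d - if d = 2 * a + 2 then (-1) ^ a else 0 := by
  have e : (X : ℤ[X]) ^ 2 * (1 - X) ^ 2 * ut X a = X ^ (2 * a + 2) * (C ((-1) ^ a) * (1 - X) ^ 2) := by
    rw [ut, neg_pow, ← pow_mul, pow_add, map_pow, map_neg, map_one]; ring
  rw [Ea, e, coeff_sub, coeff_X_pow_mul']
  by_cases h : d = 2 * a + 2
  · subst h
    have : ((1 - X : ℤ[X]) ^ 2).coeff 0 = 1 := by rw [coeff_zero_eq_eval_zero]; simp
    rw [if_pos le_rfl, Nat.sub_self, coeff_C_mul, this, mul_one, if_pos rfl]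
  · rw [if_neg (by omega), if_neg h]

theorem neg_one_odd (a : ℕ) (x : ℤ) (h : (-1 : ℤ) ^ a = 2 * x) : False := by
  rcases neg_one_pow_eq_or ℤ a with e | e <;> rw [e] at h <;> omega

theorem L1 {S : ℤ[X]} {a a' g h : ℕ} {Cy Cy' : List ℕ}
    (hl : ∀ d ≤ g, S.coeff d = (Ea (X : ℤ[X]) a).coeff d + 2 * (Cy.count d : ℤ))
    (hl' : ∀ d ≤ h, S.coeff d = (Ea (X : ℤ[X]) a').coeff d + 2 * (Cy'.count d : ℤ))
    (hg : g ∈ Cy) (hgm : ∀ l ∈ Cy, g ≤ l) (hh : h ∈ Cy') (hhm : ∀ l ∈ Cy', h ≤ l) :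
    g = h ∧ Cy.count g = Cy'.count g ∧ (a = a' ∨ (g < 2 * a + 2 ∧ g < 2 * a' + 2)) := by
  have key1 : a < a' → 2 * a + 2 ≤ g → 2 * a + 2 ≤ h → False := by
    intro h1 h2 h3
    have e1 := hl _ h2
    rw [hl' _ h3, Ea_coeff _ _ le_rfl, Ea_coeff _ _ (by omega), if_pos rfl, if_neg (by omega)] at e1
    apply neg_one_odd a (Cy.count (2 * a + 2) - Cy'.count (2 * a + 2))
    linarith
  have key2 : a' < a → 2 * a' + 2 ≤ g → 2 * a' + 2 ≤ h → False := by
    intro h1 h2 h3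
    have e1 := hl _ h2
    rw [hl' _ h3, Ea_coeff _ _ (by omega), Ea_coeff _ _ (by omega), if_pos rfl, if_neg (by omega)] at e1
    apply neg_one_odd a' (Cy'.count (2 * a' + 2) - Cy.count (2 * a' + 2))
    linarith
  have hc : a = a' ∨ (min g h < 2 * a + 2 ∧ min g h < 2 * a' + 2) := by
    rcases lt_trichotomy a a' with h1 | h1 | h1
    · have : ¬ (2 * a + 2 ≤ g ∧ 2 * a + 2 ≤ h) := fun h2 => key1 h1 h2.1 h2.2
      omega
    · exact Or.inl h1
    · have : ¬ (2 * a' + 2 ≤ g ∧ 2 * a' + 2 ≤ h) := fun h2 => key2 h1 h2.1 h2.2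
      omega
  have hE : (Ea (X : ℤ[X]) a).coeff (min g h) = (Ea (X : ℤ[X]) a').coeff (min g h) := by
    rcases hc with h1 | h1
    · rw [h1]
    · rw [Ea_coeff _ _ (by omega), Ea_coeff _ _ (by omega), if_neg (by omega), if_neg (by omega)]
  have hcnt : Cy.count (min g h) = Cy'.count (min g h) := by
    have e1 := hl _ (min_le_left g h)
    rw [hl' _ (min_le_right g h), hE] at e1
    omega
  have hgh : g = h := by
    rcases le_total g h with h1 | h1
    · rw [min_eq_left h1] at hcnt
      have : 0 < Cy.count g := List.count_pos_iff.2 hg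
      have := hhm g (List.count_pos_iff.1 (by omega))
      omega
    · rw [min_eq_right h1] at hcnt
      have : 0 < Cy'.count h := List.count_pos_iff.2 hh
      have := hgm h (List.count_pos_iff.1 (by omega))
      omega
  subst hgh
  rw [min_self] at hcnt hc
  exact ⟨rfl, hcnt, hc⟩

theorem exists_min_list (l : List ℕ) (h : l ≠ []) : ∃ g ∈ l, ∀ x ∈ l, g ≤ x := by
  have hne : l.toFinset.Nonempty := by
    obtain ⟨x, hx⟩ := List.exists_mem_of_ne_nil l h
    exact ⟨x, by simpa using hx⟩
  obtain ⟨g, hg, hm⟩ := Finset.exists_min_image l.toFinset id hne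
  exact ⟨g, by simpa using hg, fun x hx => hm x (by simpa using hx)⟩

theorem mem_le_sum {K : List ℕ} {k : ℕ} (h : k ∈ K) : k ≤ K.sum := List.le_sum_of_mem h

theorem P2_low {h : ℕ} (K : List ℕ) (hK : ∀ k ∈ K, h ≤ k) :
    (X : (ZMod 2)[X]) ^ (2 * h) ∣ P2 X K - (1 + sz X K) := by
  have := prod_low (X : (ZMod 2)[X]) 1 (fun k => 1 + X ^ k) K hK (by simp)
  rwa [one_mul] at this

theorem P2_one {h : ℕ} (K : List ℕ) (hK : ∀ k ∈ K, h ≤ k) :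
    (X : (ZMod 2)[X]) ^ h ∣ P2 X K - 1 := by
  have h1 := (pow_dvd_pow X (show h ≤ 2 * h by omega)).trans (P2_low K hK)
  have h2 := sz_dvd (X : (ZMod 2)[X]) K hK
  have := dvd_add h1 h2
  convert this using 1
  ring

theorem mulP2_coeff {h d : ℕ} (A : (ZMod 2)[X]) (K : List ℕ) (hK : ∀ k ∈ K, h ≤ k) (hd : d < h) :
    (A * P2 X K).coeff d = A.coeff d := by
  have := mul_low (d := X ^ h) (S := A) (S' := A) (by simp) (P2_one K hK)
  rw [mul_one] at this
  exact coeff_eq_of_dvd this hd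

theorem T2_one (b c : ℕ) : T2 (X : (ZMod 2)[X]) 1 b c = (1 + X ^ 2) * (1 + X ^ (b + c)) := by
  unfold T2
  linear_combination (X ^ (b + 1) + X ^ (c + 1)) * two_poly

/-- `R(a,b)`. -/
def Rab {R : Type*} [CommRing R] (z : R) (a b : ℕ) : R :=
  Bz z ^ 2 - z ^ 2 * (1 - z) ^ 2 * (ut z a + ut z b) + (1 + z) ^ 2 * (ut z a * ut z b)
    + 2 * (1 + z ^ 2) ^ 2 * z ^ (a + b)

theorem theta_R {R : Type*} [CommRing R] (z : R) {a b c : ℕ} (ha : 1 ≤ a) (hab : a ≤ b) (hbc : b ≤ c) :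
    z ^ (a + c + 1) ∣ Sth z a b c - (Rab z a b + 2 * ((1 + z ^ 2) ^ 2 * (z ^ (a + c) + z ^ (b + c)))) := by
  have ua := ut_dvd z (m := 2 * a) (a := a) le_rfl
  have ub := ut_dvd z (m := 2 * b) (a := b) le_rfl
  have uc := ut_dvd z (m := 2 * c) (a := c) le_rfl
  have zc : z ^ (a + c + 1) ∣ z ^ 2 * ut z c := pow_mul_dvd dvd_rfl uc (by omega)
  have uac : z ^ (a + c + 1) ∣ ut z a * ut z c := pow_mul_dvd ua uc (by omega)
  have ubc : z ^ (a + c + 1) ∣ ut z b * ut z c := pow_mul_dvd ub uc (by omega)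
  have q1 : z ^ (a + c + 1) ∣ z ^ (a + b) * ut z c := pow_mul_dvd dvd_rfl uc (by omega)
  have q2 : z ^ (a + c + 1) ∣ z ^ (a + c) * ut z b := pow_mul_dvd dvd_rfl ub (by omega)
  have q3 : z ^ (a + c + 1) ∣ z ^ (b + c) * ut z a := pow_mul_dvd dvd_rfl ua (by omega)
  have e : Sth z a b c - (Rab z a b + 2 * ((1 + z ^ 2) ^ 2 * (z ^ (a + c) + z ^ (b + c))))
      = - (1 - z) ^ 2 * (z ^ 2 * ut z c)
        + ((1 + z) ^ 2 - (2 + z + z ^ 2) ^ 2 * ut z b) * (ut z a * ut z c)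
        + (1 + z) ^ 2 * (ut z b * ut z c)
        + (-(2 * (1 + z ^ 2) ^ 2)) * (z ^ (a + b) * ut z c)
        + (-(2 * (1 + z ^ 2) ^ 2)) * (z ^ (a + c) * ut z b)
        + (-(2 * (1 + z ^ 2) ^ 2)) * (z ^ (b + c) * ut z a) := by
      unfold Sth Rab; ring
  rw [e]
  exact dvd_add (dvd_add (dvd_add (dvd_add (dvd_add (zc.mul_left _)
      (uac.mul_left _)) (ubc.mul_left _)) (q1.mul_left _)) (q2.mul_left _)) (q3.mul_left _)

theorem caseA2 {a b c c' : ℕ} {K : List ℕ} (ha : 1 ≤ a) (hab : a ≤ b) (hbc : b ≤ c) (hbc' : b ≤ c')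
    (hK : ∀ k ∈ K, 3 ≤ k) (hcc : c' < c)
    (h : Sth (X : ℤ[X]) a b c = Sth X a b c' * (K.map (Cz X)).prod) : False := by
  obtain ⟨e, he, hm⟩ := exists_min_list ((a + c') :: (b + c') :: K) (by simp)
  have he1 := hm (a + c') (by simp)
  have hKe : ∀ k ∈ K, e ≤ k := fun k hk => hm k (by simp [hk])
  have he0 : 1 ≤ e := by
    simp only [List.mem_cons] at he
    rcases he with rfl | rfl | he
    · omega
    · omega
    · have := hK e he; omega
  have h1 := (pow_dvd_pow (X : ℤ[X]) (show e + 1 ≤ a + c' + 1 by omega)).trans (theta_R X ha hab hbc')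
  have h2 := (pow_dvd_pow (X : ℤ[X]) (show e + 1 ≤ 2 * e by omega)).trans (prodC_low X K hKe)
  have h3 := coeff_eq_of_dvd (mul_low h1 h2) (show e < e + 1 by omega)
  have h4 := coeff_eq_of_dvd (theta_R (X : ℤ[X]) ha hab hbc) (show e < a + c + 1 by omega)
  rw [← h, h4] at h3
  have e1 : (X : ℤ[X]) ^ (a + c) + X ^ (b + c) = sz X [a + c, b + c] := by simp [sz]
  have e2 : (X : ℤ[X]) ^ (a + c') + X ^ (b + c') = sz X [a + c', b + c'] := by simp [sz]
  have hR0 : (Rab (X : ℤ[X]) a b).coeff 0 = 1 := by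
    rw [coeff_zero_eq_eval_zero, Rab]
    simp [Bz, ut, show a ≠ 0 by omega]
  rw [e1, e2] at h3
  have hq : ∀ l ∈ [a + c', b + c'], e ≤ l := fun l hl => hm l (by simp at hl ⊢; tauto)
  have e3 : (Rab X a b + 2 * ((1 + X ^ 2) ^ 2 * sz (X : ℤ[X]) [a + c', b + c'])) * (1 + 2 * sz X K)
    = Rab X a b + 2 * ((1 + X ^ 2) ^ 2 * sz (X : ℤ[X]) [a + c', b + c'])
      + 2 * ((Rab X a b + 2 * ((1 + X ^ 2) ^ 2 * sz (X : ℤ[X]) [a + c', b + c'])) * sz X K) := by ring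
  rw [e3] at h3
  simp only [coeff_add, coeff_ofNat_mul] at h3
  rw [coeff_mul_low (sz_dvd X K hKe) le_rfl, coeff_mul_low (sz_dvd X _ hq) le_rfl,
    coeff_mul_low (sz_dvd X (h := e) _ (by intro l hl; simp at hl; omega)) le_rfl,
    coeff_add, coeff_ofNat_mul, mul_coeff_zero, hR0, kap_zero, sz_coeff, sz_coeff, sz_coeff, sz_coeff] at h3
  rw [List.count_eq_zero_of_not_mem (l := [a + c, b + c]) (by simp; omega),
    List.count_eq_zero_of_not_mem (a := 0) (l := [a + c', b + c']) (by simp; omega)] at h3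
  have hpos : 0 < (((a + c') :: (b + c') :: K)).count e := List.count_pos_iff.2 he
  have : ((a + c') :: (b + c') :: K) = [a + c', b + c'] ++ K := rfl
  rw [this, List.count_append] at hpos
  push_cast at h3
  omega

end Arith


/-! ## The arithmetic comparison theorems -/

section Compare

theorem coeff_four {p0 p1 p2 p3 : ℤ} {P W : ℤ[X]}
    (h : P = C p0 + C p1 * X + C p2 * X ^ 2 + C p3 * X ^ 3 + X ^ 4 * W) :
    P.coeff 0 = p0 ∧ P.coeff 1 = p1 ∧ P.coeff 2 = p2 ∧ P.coeff 3 = p3 := by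
  subst h
  refine ⟨?_, ?_, ?_, ?_⟩ <;>
    simp only [coeff_add, coeff_C_mul, coeff_X_pow_mul', coeff_X_pow, coeff_X, coeff_C] <;> norm_num

theorem sum_nonneg_four {P : ℤ[X]} (h0 : 0 ≤ P.coeff 0) (h1 : 0 ≤ P.coeff 1) (h2 : 0 ≤ P.coeff 2)
    (h3 : 0 ≤ P.coeff 3) {g : ℕ} (L : List ℕ) (hL : ∀ l ∈ L, g ≤ l) :
    0 ≤ (P * sz X L).coeff (g + 3) ∧ (g ∈ L → 0 < P.coeff 3 → 0 < (P * sz X L).coeff (g + 3)) := by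
  induction L with
  | nil => simp [sz_nil]
  | cons l L ih =>
    obtain ⟨i1, i2⟩ := ih (fun l hl => hL l (by simp [hl]))
    have hl := hL l (by simp)
    have e : (P * sz X (l :: L)).coeff (g + 3) =
        (if l ≤ g + 3 then P.coeff (g + 3 - l) else 0) + (P * sz X L).coeff (g + 3) := by
      rw [sz_cons, mul_add, coeff_add, coeff_mul_X_pow']
    have hn : 0 ≤ (if l ≤ g + 3 then P.coeff (g + 3 - l) else 0) := by
      split_ifs with hc
      · obtain ⟨j, hj, hj3⟩ : ∃ j, g + 3 - l = j ∧ j ≤ 3 := ⟨_, rfl, by omega⟩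
        rw [hj]
        interval_cases j <;> assumption
      · exact le_rfl
    rw [e]
    refine ⟨by omega, ?_⟩
    intro hg hp
    rw [List.mem_cons] at hg
    rcases hg with rfl | hg
    · have : (if g ≤ g + 3 then P.coeff (g + 3 - g) else 0) = P.coeff 3 := by
        rw [if_pos (by omega), show g + 3 - g = 3 by omega]
      omega
    · have := i2 hg hp
      omega

/-- Test polynomial. -/
def tst : ℤ[X] := 1 + 2 * X - X ^ 2 - 4 * X ^ 3

theorem caseB2 {a c : ℕ} (ha : 2 ≤ a) (hc : a + 4 ≤ c) {Q0 Q1 Q2 : List ℕ}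
    (h0 : ∀ l ∈ Q0, 2 * a ≤ l) (h1 : ∀ l ∈ Q1, 2 * a ≤ l) (h2 : ∀ l ∈ Q2, 2 * a ≤ l)
    (hg : 2 * a ∈ Q1 ∨ 2 * a ∈ Q2)
    (h : X ^ (2 * a + 4) ∣ Sth (X : ℤ[X]) a a c - (Bz X ^ 2 + 2 * ((1 + X ^ 2) ^ 2 * sz X Q0)
      + 2 * ((1 + X ^ 2) * Bz X * sz X Q1) + 2 * (Bz X ^ 2 * sz X Q2))) : False := by
  have hR := (pow_dvd_pow (X : ℤ[X]) (show 2 * a + 4 ≤ a + c + 1 by omega)).trans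
    (theta_R X (a := a) (b := a) (c := c) (by omega) le_rfl (by omega))
  have hu : ut (X : ℤ[X]) a = X ^ (2 * a) * C ((-1) ^ a) := by
    rw [ut, neg_pow, ← pow_mul, map_pow, map_neg, map_one]; ring
  have hx : (X : ℤ[X]) ^ (2 * a + 4) ∣ X ^ (a + c) := pow_dvd_pow _ (by omega)
  have hx2 : (X : ℤ[X]) ^ (2 * a + 4) ∣ ut X a * ut X a :=
    pow_mul_dvd (ut_dvd X le_rfl) (ut_dvd X le_rfl) (by omega)
  set D : ℤ[X] := X ^ (2 * a) * ((1 + X ^ 2) ^ 2 - C ((-1) ^ a) * (X ^ 2 * (1 - X) ^ 2))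
      - ((1 + X ^ 2) ^ 2 * sz X Q0 + (1 + X ^ 2) * Bz X * sz X Q1 + Bz X ^ 2 * sz X Q2) with hD
  have h2D : (X : ℤ[X]) ^ (2 * a + 4) ∣ 2 * D := by
    have e : 2 * D = (Sth (X : ℤ[X]) a a c - (Bz X ^ 2 + 2 * ((1 + X ^ 2) ^ 2 * sz X Q0)
      + 2 * ((1 + X ^ 2) * Bz X * sz X Q1) + 2 * (Bz X ^ 2 * sz X Q2)))
      - (Sth X a a c - (Rab X a a + 2 * ((1 + X ^ 2) ^ 2 * (X ^ (a + c) + X ^ (a + c)))))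
      + (-4 * (1 + X ^ 2) ^ 2) * X ^ (a + c) + (- (1 + X) ^ 2) * (ut X a * ut X a) := by
      rw [hD, Rab, hu]; ring
    rw [e]
    exact dvd_add (dvd_add (dvd_sub h hR) (hx.mul_left _)) (hx2.mul_left _)
  have hDd : (X : ℤ[X]) ^ (2 * a + 4) ∣ D := by
    rw [X_pow_dvd_iff] at h2D ⊢
    intro d hd
    have := h2D d hd
    rw [coeff_ofNat_mul] at this
    simpa using this
  have hc0 := X_pow_dvd_iff.1 (hDd.mul_right tst) (2 * a + 3) (by omega)
  have e : D * tst = X ^ (2 * a) * (((1 + X ^ 2) ^ 2 - C ((-1) ^ a) * (X ^ 2 * (1 - X) ^ 2)) * tst)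
    - (((1 + X ^ 2) ^ 2 * tst) * sz X Q0 + ((1 + X ^ 2) * Bz X * tst) * sz X Q1
      + (Bz X ^ 2 * tst) * sz X Q2) := by rw [hD]; ring
  rw [e, coeff_sub, coeff_add, coeff_add, coeff_X_pow_mul', if_pos (by omega),
    show 2 * a + 3 - 2 * a = 3 by omega] at hc0
  have cE := (coeff_four (p0 := 1) (p1 := 2) (p2 := 1 - (-1) ^ a) (p3 := 0)
    (P := ((1 + X ^ 2) ^ 2 - C ((-1) ^ a) * (X ^ 2 * (1 - X) ^ 2)) * tst)
    (W := (-1 - 6 * X - X ^ 2 - 4 * X ^ 3) - C ((-1) ^ a) * (-4 + 7 * X ^ 2 - 4 * X ^ 3))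
    (by simp only [tst, map_sub, map_one, map_zero, map_ofNat]; ring)).2.2.2
  obtain ⟨a00, a01, a02, a03⟩ := coeff_four (p0 := 1) (p1 := 2) (p2 := 1) (p3 := 0)
    (P := (1 + X ^ 2) ^ 2 * tst) (W := -1 - 6 * X - X ^ 2 - 4 * X ^ 3)
    (by simp only [tst, map_one, map_zero, map_ofNat]; ring)
  obtain ⟨a10, a11, a12, a13⟩ := coeff_four (p0 := 1) (p1 := 1) (p2 := 0) (p3 := 2)
    (P := (1 + X ^ 2) * Bz X * tst) (W := 1 - 7 * X + 2 * X ^ 2 - 8 * X ^ 3)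
    (by simp only [tst, Bz, map_one, map_zero, map_ofNat]; ring)
  obtain ⟨a20, a21, a22, a23⟩ := coeff_four (p0 := 1) (p1 := 0) (p2 := 0) (p3 := 4)
    (P := Bz X ^ 2 * tst) (W := -1 - 8 * X + 12 * X ^ 2 - 16 * X ^ 3)
    (by simp only [tst, Bz, map_one, map_zero, map_ofNat]; ring)
  have n0 := sum_nonneg_four (by omega) (by omega) (by omega) (by omega) Q0 h0
    (P := (1 + X ^ 2) ^ 2 * tst)
  have n1 := sum_nonneg_four (by omega) (by omega) (by omega) (by omega) Q1 h1
    (P := (1 + X ^ 2) * Bz X * tst)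
  have n2 := sum_nonneg_four (by omega) (by omega) (by omega) (by omega) Q2 h2
    (P := Bz X ^ 2 * tst)
  rw [cE] at hc0
  rcases hg with hg | hg
  · have := n1.2 hg (by omega)
    have := n0.1
    have := n2.1
    omega
  · have := n2.2 hg (by omega)
    have := n0.1
    have := n1.1
    omega

theorem Ea_low {m a : ℕ} (h : m ≤ 2 * a + 2) : (X : ℤ[X]) ^ m ∣ Ea X a - Bz X ^ 2 := by
  have e : Ea (X : ℤ[X]) a - Bz X ^ 2 = (-(1 - X) ^ 2) * (X ^ 2 * ut X a) := by unfold Ea; ring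
  rw [e]
  exact (pow_mul_dvd (i := 2) dvd_rfl (ut_dvd X le_rfl) (by omega)).mul_left _

theorem T2_coeff (a b c d : ℕ) : (T2 (X : (ZMod 2)[X]) a b c).coeff d =
    (if d = 0 then 1 else 0) + (if d = a + 1 then 1 else 0) + (if d = b + 1 then 1 else 0)
    + (if d = c + 1 then 1 else 0) + (if d = a + b then 1 else 0) + (if d = a + c then 1 else 0)
    + (if d = b + c then 1 else 0) + (if d = a + b + c + 1 then 1 else 0) := by
  simp only [T2, coeff_add, coeff_one, coeff_X_pow]

theorem one_ne2 : (1 : ZMod 2) ≠ 0 := by decide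

theorem arith_db {a b c a' b' c' : ℕ} {K : List ℕ} (ha : 1 ≤ a) (hab : a ≤ b) (hbc : b ≤ c)
    (hab3 : 3 ≤ a + b) (ha' : 1 ≤ a') (hb' : 3 ≤ b') (hc' : 3 ≤ c')
    (hK : ∀ k ∈ K, 3 ≤ k) (hs : a + b + c = a' + b' + c' + K.sum)
    (h : Sth (X : ℤ[X]) a b c = Sdb X a' b' c' * (K.map (Cz X)).prod) : False := by
  obtain ⟨g, hg, hgm⟩ := exists_min_list (b' :: c' :: K) (by simp)
  have hg3 : 3 ≤ g := by
    simp only [List.mem_cons] at hg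
    rcases hg with rfl | rfl | hg
    · omega
    · omega
    · exact hK g hg
  have hm1 : ∀ l ∈ [a + b, a + c, b + c], a + b ≤ l := by intro l hl; simp at hl; omega
  obtain ⟨e1, e2, e3⟩ := L1 (S := Sth (X : ℤ[X]) a b c) (a := a) (a' := a') (g := a + b) (h := g)
    (Cy := [a + b, a + c, b + c]) (Cy' := b' :: c' :: K)
    (fun d hd => by
      have := theta_cnt (a := a) (b := b) (c := c) (h := a + b) (d := d) [] hab hbc hm1 (by omega) hd
      simpa using this)
    (fun d hd => by rw [h]; exact db_cnt K hgm (by omega) hd)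
    (by simp) hm1 hg hgm
  subst e1
  have hb1 := hgm b' (by simp)
  have hc1 := hgm c' (by simp)
  have hcnt : (b' :: c' :: K).count (a + b) = 1 := by
    rw [← e2]
    rw [List.count_cons_self, List.count_eq_zero_of_not_mem]
    simp; omega
  have h2 := mod2_db h
  by_cases haa : a = a'
  · subst haa
    by_cases ha1 : a = 1
    · subst ha1
      rw [T2_one] at h2
      have h3 := mul_left_cancel₀ kap2_ne h2
      have h4 := congrArg (fun p => p.coeff (1 + b)) h3
      rw [coeff_eq_of_dvd (P2_low _ hgm) (by omega), coeff_add, coeff_add, sz_coeff, hcnt,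
        coeff_one, if_neg (by omega), coeff_X_pow, if_neg (by omega)] at h4
      simp at h4
    · have h4 := congrArg (fun p => p.coeff (b + 1)) h2
      rw [mulP2_coeff _ _ hgm (by omega), T2_coeff, coeff_add, coeff_one, coeff_X_pow,
        if_neg (by omega : ¬ b + 1 = c + 1), if_neg (by omega : ¬ b + 1 = a + b),
        if_neg (by omega : ¬ b + 1 = a + c), if_neg (by omega : ¬ b + 1 = b + c),
        if_neg (by omega : ¬ b + 1 = a + b + c + 1), if_pos (by rfl : b + 1 = b + 1)] at h4
      simp at h4
  · have e4 := e3.resolve_left haa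
    by_cases hba : b = a + 1
    · have h4 := congrArg (fun p => p.coeff (a + 1)) h2
      rw [mulP2_coeff _ _ hgm (by omega), T2_coeff, coeff_add, coeff_one, coeff_X_pow,
        if_neg (by omega : ¬ a + 1 = b + 1), if_neg (by omega : ¬ a + 1 = c + 1),
        if_neg (by omega : ¬ a + 1 = a + b), if_neg (by omega : ¬ a + 1 = a' + 1),
        if_neg (by omega : ¬ a + 1 = a + c), if_neg (by omega : ¬ a + 1 = b + c),
        if_neg (by omega : ¬ a + 1 = a + b + c + 1), if_pos (by rfl : a + 1 = a + 1)] at h4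
      simp at h4
    · have hba' : b = a := by omega
      subst hba'
      have hl := db_low (X : ℤ[X]) (a := a') (b := b') (c := c') (h := b + b) (m := 2 * b + 4) K hb1 hc1
        (fun k hk => hgm k (by simp [hk])) (by omega) (by omega)
      rw [← h] at hl
      have hl2 := dvd_add hl (Ea_low (m := 2 * b + 4) (a := a') (by omega))
      apply caseB2 (a := b) (c := c) (Q0 := []) (Q1 := [b', c']) (Q2 := K) (by omega) (by omega)
        (by simp) (by intro l hl; simp at hl; omega)
        (fun k hk => by have := hgm k (by simp [hk]); omega)
        (by
          rw [two_mul]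
          simp only [List.mem_cons, List.not_mem_nil, or_false] at hg ⊢
          tauto)
      convert hl2 using 1
      simp only [sz_cons, sz_nil]
      ring

theorem arith_theta {a b c a' b' c' : ℕ} {K : List ℕ} (ha : 1 ≤ a) (hab : a ≤ b) (hbc : b ≤ c)
    (hab3 : 3 ≤ a + b) (ha' : 1 ≤ a') (hab' : a' ≤ b') (hbc' : b' ≤ c') (hab3' : 3 ≤ a' + b')
    (hK : ∀ k ∈ K, 3 ≤ k) (hs : a + b + c = a' + b' + c' + K.sum)
    (h : Sth (X : ℤ[X]) a b c = Sth X a' b' c' * (K.map (Cz X)).prod) :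
    a = a' ∧ b = b' ∧ c = c' := by
  obtain ⟨g, hg, hgm⟩ := exists_min_list ((a' + b') :: (a' + c') :: (b' + c') :: K) (by simp)
  have hg3 : 3 ≤ g := by
    simp only [List.mem_cons] at hg
    rcases hg with rfl | rfl | rfl | hg
    · omega
    · omega
    · omega
    · exact hK g hg
  have hm1 : ∀ l ∈ [a + b, a + c, b + c], a + b ≤ l := by intro l hl; simp at hl; omega
  obtain ⟨e1, e2, e3⟩ := L1 (S := Sth (X : ℤ[X]) a b c) (a := a) (a' := a') (g := a + b) (h := g)
    (Cy := [a + b, a + c, b + c]) (Cy' := (a' + b') :: (a' + c') :: (b' + c') :: K)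
    (fun d hd => by
      have := theta_cnt (a := a) (b := b) (c := c) (h := a + b) (d := d) [] hab hbc hm1 (by omega) hd
      simpa using this)
    (fun d hd => by rw [h]; exact theta_cnt K hab' hbc' hgm (by omega) hd)
    (by simp) hm1 hg hgm
  subst e1
  have hb1 := hgm (a' + b') (by simp)
  by_cases hKn : K = []
  · subst hKn
    simp only [List.sum_nil] at hs
    have hgab : a + b = a' + b' := by
      simp only [List.mem_cons, List.not_mem_nil, or_false] at hg
      omega
    omega
  exfalso
  obtain ⟨k0, hk0⟩ := List.exists_mem_of_ne_nil K hKn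
  have hk1 := hgm k0 (by simp [hk0])
  have hk2 := mem_le_sum hk0
  have hKg : ∀ k ∈ K, a + b ≤ k := fun k hk => hgm k (by simp [hk])
  have hcnt : ((a' + b') :: (a' + c') :: (b' + c') :: K).count (a + b) = 1 := by
    rw [← e2]
    rw [List.count_cons_self, List.count_eq_zero_of_not_mem]
    simp; omega
  have h2 := mod2_theta h
  by_cases haa : a = a'
  · subst haa
    by_cases hbb : b = b'
    · subst hbb
      exact caseA2 ha hab hbc hbc' hK (by omega) h
    by_cases ha1 : a = 1
    · subst ha1
      rw [T2_one, T2_one, mul_assoc] at h2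
      have h3 := mul_left_cancel₀ kap2_ne h2
      have h3' : (1 + X ^ (b + c) : (ZMod 2)[X]) = P2 X ((b' + c') :: K) := by
        rw [h3]; simp [P2]
      have h4 := congrArg (fun p => p.coeff (1 + b)) h3'
      rw [List.count_cons_of_ne (by omega), List.count_cons_of_ne (by omega)] at hcnt
      rw [coeff_eq_of_dvd (P2_low (h := 1 + b) _ (fun l hl => hgm l (by simp at hl ⊢; tauto))) (by omega),
        coeff_add, coeff_add, sz_coeff, hcnt,
        coeff_one, if_neg (by omega), coeff_X_pow, if_neg (by omega)] at h4
      simp at h4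
    · have h4 := congrArg (fun p => p.coeff (b + 1)) h2
      rw [mulP2_coeff _ _ hKg (by omega), T2_coeff, T2_coeff,
        if_neg (by omega : ¬ b + 1 = c + 1), if_neg (by omega : ¬ b + 1 = a + b),
        if_neg (by omega : ¬ b + 1 = a + c), if_neg (by omega : ¬ b + 1 = b + c),
        if_neg (by omega : ¬ b + 1 = a + b + c + 1), if_pos (by rfl : b + 1 = b + 1),
        if_neg (by omega : ¬ b + 1 = b' + 1),
        if_neg (by omega : ¬ b + 1 = c' + 1), if_neg (by omega : ¬ b + 1 = a + b'),
        if_neg (by omega : ¬ b + 1 = a + c'), if_neg (by omega : ¬ b + 1 = b' + c'),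
        if_neg (by omega : ¬ b + 1 = a + b' + c' + 1)] at h4
      simp at h4
  · have e4 := e3.resolve_left haa
    by_cases hba : b = a + 1
    · have h4 := congrArg (fun p => p.coeff (a + 1)) h2
      rw [mulP2_coeff _ _ hKg (by omega), T2_coeff, T2_coeff,
        if_neg (by omega : ¬ a + 1 = b + 1), if_neg (by omega : ¬ a + 1 = c + 1),
        if_neg (by omega : ¬ a + 1 = a + b), if_neg (by omega : ¬ a + 1 = a' + 1),
        if_neg (by omega : ¬ a + 1 = a + c), if_neg (by omega : ¬ a + 1 = b + c),
        if_neg (by omega : ¬ a + 1 = a + b + c + 1), if_pos (by rfl : a + 1 = a + 1),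
        if_neg (by omega : ¬ a + 1 = b' + 1),
        if_neg (by omega : ¬ a + 1 = c' + 1), if_neg (by omega : ¬ a + 1 = a' + b'),
        if_neg (by omega : ¬ a + 1 = a' + c'), if_neg (by omega : ¬ a + 1 = b' + c'),
        if_neg (by omega : ¬ a + 1 = a' + b' + c' + 1)] at h4
      simp at h4
    · have hba' : b = a := by omega
      subst hba'
      have hl := theta_low (X : ℤ[X]) (a := a') (b := b') (c := c') (h := b + b) (m := 2 * b + 4) K
        hab' hbc' hb1 hKg (by omega) (by omega) (by omega)
      rw [← h] at hl
      have hl2 := dvd_add hl (Ea_low (m := 2 * b + 4) (a := a') (by omega))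
      apply caseB2 (a := b) (c := c) (Q0 := [a' + b', a' + c', b' + c']) (Q1 := []) (Q2 := K)
        (by omega) (by omega) (by intro l hl; simp at hl; omega) (by simp)
        (fun k hk => by have := hKg k hk; omega)
        (by
          rw [two_mul]
          simp only [List.mem_cons] at hg
          rcases hg with hg | hg | hg | hg
          · omega
          · omega
          · omega
          · exact Or.inr hg)
      convert hl2 using 1
      simp only [sz_cons, sz_nil]
      ring

end Compare


section Degrees

variable {V : Type*} [Fintype V]

theorem lap_eq_pr (G : SimpleGraph V) :
    lapPermPoly G = pr (mat G (fun z => (X : ℚ[X]) - C (dg G z : ℚ))) := by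
  rw [lapPermPoly, ← Matrix.permanent_transpose, Matrix.permanent, pr]
  refine Finset.sum_congr rfl fun σ _ => Finset.prod_congr rfl fun i _ => ?_
  rw [Matrix.transpose_apply]
  simp only [Matrix.sub_apply, Matrix.map_apply, SimpleGraph.lapMatrix, mat, SimpleGraph.degMatrix,
    SimpleGraph.adjMatrix_apply, Matrix.diagonal_apply]
  by_cases hi : i = σ i
  · rw [if_pos hi, if_pos hi, if_pos hi, ← hi]
    simp [dg_eq_degree]
  · rw [if_neg hi, if_neg hi, if_neg hi]
    by_cases ha : G.Adj i (σ i) <;> simp [ha]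

theorem pr_hom {R S : Type*} [CommRing R] [CommRing S] (f : R →+* S) (c : V → V → R) :
    f (pr c) = pr (fun i j => f (c i j)) := by
  simp [pr, map_sum, map_prod]

theorem pr_scale {R : Type*} [CommRing R] (z : R) (c : V → V → R) :
    z ^ (Fintype.card V) * pr c = pr (fun i j => z * c i j) := by
  simp only [pr, Finset.mul_sum]
  refine Finset.sum_congr rfl fun σ _ => ?_
  rw [Finset.prod_mul_distrib, Finset.prod_const, Finset.card_univ]

theorem lap_eval {F : Type*} [CommRing F] [Algebra ℚ F] (x : F) (G : SimpleGraph V) :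
    aeval x (lapPermPoly G) = pr (mat G (fun z => x - (dg G z : F))) := by
  rw [lap_eq_pr]
  have := pr_hom (aeval x : ℚ[X] →ₐ[ℚ] F).toRingHom (mat G (fun z => (X : ℚ[X]) - C (dg G z : ℚ)))
  refine Eq.trans this ?_
  congr 1
  funext i j
  simp only [mat]
  split_ifs <;> simp

/-- The reversed matrix. -/
def qm (G : SimpleGraph V) : V → V → ℚ[X] := fun i j =>
  if i = j then 1 - X * C (dg G i : ℚ) else if G.Adj i j then X else 0

theorem qm_eval (G : SimpleGraph V) :
    algebraMap ℚ[X] FF (pr (qm G)) =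
      (RatFunc.X : FF) ^ (Fintype.card V) * aeval ((RatFunc.X : FF)⁻¹) (lapPermPoly G) := by
  rw [lap_eval, pr_scale, pr_hom]
  congr 1
  funext i j
  simp only [qm, mat]
  split_ifs
  · rw [mul_sub, mul_inv_cancel₀ RatFunc.X_ne_zero]
    simp
  · simp
  · simp

/-- Terms. -/
def qt (G : SimpleGraph V) (σ : Equiv.Perm V) : ℚ[X] := ∏ i, qm G i (σ i)

theorem qt_dvd (G : SimpleGraph V) (σ : Equiv.Perm V) :
    (X : ℚ[X]) ^ σ.support.card ∣ qt G σ := by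
  have : (X : ℚ[X]) ^ σ.support.card = ∏ i, (if i ∈ σ.support then (X : ℚ[X]) else 1) := by
    rw [Finset.prod_ite_mem, Finset.univ_inter, Finset.prod_const]
  rw [this, qt]
  refine Finset.prod_dvd_prod_of_dvd _ _ fun i _ => ?_
  split_ifs with h
  · rw [Equiv.Perm.mem_support] at h
    rw [qm, if_neg (Ne.symm h)]
    split_ifs <;> simp
  · exact one_dvd _

theorem qt_coeff_zero (G : SimpleGraph V) (σ : Equiv.Perm V) {k : ℕ} (h : k < σ.support.card) :
    (qt G σ).coeff k = 0 := by
  exact (Polynomial.X_pow_dvd_iff.1 (qt_dvd G σ)) k h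

theorem qt_swap (G : SimpleGraph V) {a b : V} (h : a ≠ b) :
    (qt G (Equiv.swap a b)).coeff 2 = if G.Adj a b then 1 else 0 := by
  rw [qt, ← Finset.mul_prod_erase _ _ (Finset.mem_univ a),
    ← Finset.mul_prod_erase _ _ (Finset.mem_erase.2 ⟨h.symm, Finset.mem_univ b⟩)]
  rw [Equiv.swap_apply_left, Equiv.swap_apply_right, qm, if_neg h, qm, if_neg h.symm, G.adj_comm b a]
  have hc : (∏ x ∈ (Finset.univ.erase a).erase b, qm G x (Equiv.swap a b x)).coeff 0 = 1 := by
    rw [coeff_zero_eq_eval_zero, eval_prod]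
    refine Finset.prod_eq_one fun x hx => ?_
    simp only [Finset.mem_erase] at hx
    rw [Equiv.swap_apply_of_ne_of_ne hx.2.1 hx.1, qm, if_pos rfl]
    simp
  split_ifs
  · rw [← mul_assoc, ← pow_two, coeff_X_pow_mul']
    simpa using hc
  · simp

theorem prod_one_sub_low (d : V → ℚ) (s : Finset V) :
    (∏ i ∈ s, ((1 : ℚ[X]) - X * C (d i))).coeff 0 = 1 ∧
    (∏ i ∈ s, ((1 : ℚ[X]) - X * C (d i))).coeff 1 = - ∑ i ∈ s, d i ∧
    2 * (∏ i ∈ s, ((1 : ℚ[X]) - X * C (d i))).coeff 2 = (∑ i ∈ s, d i) ^ 2 - ∑ i ∈ s, d i ^ 2 := by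
  induction s using Finset.induction_on with
  | empty => simp [coeff_one]
  | insert a s ha ih =>
    obtain ⟨i0, i1, i2⟩ := ih
    rw [Finset.prod_insert ha, Finset.sum_insert ha, Finset.sum_insert ha]
    generalize (∏ i ∈ s, ((1 : ℚ[X]) - X * C (d i))) = P at *
    have e : (1 - X * C (d a)) * P = P - C (d a) * (X * P) := by ring
    rw [e]
    simp only [coeff_sub, coeff_C_mul, coeff_X_mul, coeff_X_mul_zero]
    refine ⟨?_, ?_, ?_⟩
    · rw [i0]; ring
    · rw [i0, i1]; ring
    · rw [i1]; linear_combination i2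

theorem qt_one (G : SimpleGraph V) : qt G 1 = ∏ i, ((1 : ℚ[X]) - X * C (dg G i : ℚ)) := by
  simp [qt, qm]

theorem swap_fiber {a b : V} (h : a ≠ b) :
    (Finset.univ.filter (fun p : V × V => p.1 ≠ p.2 ∧ Equiv.swap p.1 p.2 = Equiv.swap a b)).card = 2 := by
  have : (Finset.univ.filter (fun p : V × V => p.1 ≠ p.2 ∧ Equiv.swap p.1 p.2 = Equiv.swap a b)) =
      {(a, b), (b, a)} := by
    ext ⟨i, j⟩
    simp only [Finset.mem_filter, Finset.mem_univ, true_and, Finset.mem_insert, Finset.mem_singleton,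
      Prod.mk.injEq]
    constructor
    · rintro ⟨hij, he⟩
      have h1 := congrArg (fun σ : Equiv.Perm V => σ i) he
      simp only [Equiv.swap_apply_left] at h1
      rw [Equiv.swap_apply_def] at h1
      split_ifs at h1 with c1 c2
      · exact Or.inl ⟨c1, h1⟩
      · exact Or.inr ⟨c2, h1⟩
      · exact absurd h1.symm hij
    · rintro (⟨rfl, rfl⟩ | ⟨rfl, rfl⟩)
      · exact ⟨h, rfl⟩
      · exact ⟨h.symm, Equiv.swap_comm _ _⟩
  rw [this, Finset.card_pair]
  simp [h]

theorem sum_adj (G : SimpleGraph V) (i : V) :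
    ∑ j, (if G.Adj i j then (1 : ℚ) else 0) = dg G i := by
  rw [dg_eq_degree, Finset.sum_boole, SimpleGraph.degree]
  congr 2
  ext j
  simp

theorem sum_swaps (G : SimpleGraph V) :
    2 * ∑ σ ∈ Finset.univ.erase (1 : Equiv.Perm V), (qt G σ).coeff 2 = ∑ i, (dg G i : ℚ) := by
  have h1 : ∑ i, (dg G i : ℚ) = ∑ p : V × V, (if p.1 ≠ p.2 then (qt G (Equiv.swap p.1 p.2)).coeff 2 else 0) := by
    rw [Fintype.sum_prod_type]
    refine Finset.sum_congr rfl fun i _ => ?_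
    rw [← sum_adj]
    refine Finset.sum_congr rfl fun j _ => ?_
    by_cases hij : i = j
    · subst hij; simp
    · simp only [ne_eq, hij, not_false_eq_true, if_true]
      rw [qt_swap G hij]
  have h2 : ∀ p : V × V, (if p.1 ≠ p.2 then (qt G (Equiv.swap p.1 p.2)).coeff 2 else 0) =
      ∑ σ : Equiv.Perm V, if p.1 ≠ p.2 ∧ Equiv.swap p.1 p.2 = σ then (qt G σ).coeff 2 else 0 := by
    intro p
    by_cases hp : p.1 = p.2
    · simp [hp]
    · simp [hp]
  rw [h1, Finset.sum_congr rfl fun p _ => h2 p, Finset.sum_comm, Finset.mul_sum,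
    ← Finset.add_sum_erase _ _ (Finset.mem_univ (1 : Equiv.Perm V))]
  have h3 : ∑ p : V × V, (if p.1 ≠ p.2 ∧ Equiv.swap p.1 p.2 = 1 then (qt G 1).coeff 2 else 0) = 0 := by
    refine Finset.sum_eq_zero fun p _ => if_neg ?_
    rintro ⟨hp, he⟩
    exact hp (Equiv.swap_eq_one_iff.1 he)
  rw [h3, zero_add]
  refine Finset.sum_congr rfl fun σ hσ => ?_
  have hσ1 : σ ≠ 1 := (Finset.mem_erase.1 hσ).1
  rw [← Finset.sum_filter, Finset.sum_const, nsmul_eq_mul]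
  by_cases hs : σ.support.card = 2
  · obtain ⟨a, b, hab, rfl⟩ := Equiv.Perm.card_support_eq_two.1 hs
    rw [swap_fiber hab]
    norm_num
  · have := Equiv.Perm.two_le_card_support_of_ne_one hσ1
    rw [qt_coeff_zero G σ (by omega)]
    simp

theorem q_coeffs (G : SimpleGraph V) :
    (pr (qm G)).coeff 0 = 1 ∧ (pr (qm G)).coeff 1 = - ∑ i, (dg G i : ℚ) ∧
    2 * (pr (qm G)).coeff 2 = (∑ i, (dg G i : ℚ)) ^ 2 - ∑ i, (dg G i : ℚ) ^ 2 + ∑ i, (dg G i : ℚ) := by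
  have e : pr (qm G) = qt G 1 + ∑ σ ∈ Finset.univ.erase (1 : Equiv.Perm V), qt G σ := by
    rw [Finset.add_sum_erase _ _ (Finset.mem_univ (1 : Equiv.Perm V))]
    rfl
  have hz : ∀ k < 2, (∑ σ ∈ Finset.univ.erase (1 : Equiv.Perm V), qt G σ).coeff k = 0 := by
    intro k hk
    rw [finsetSum_coeff]
    refine Finset.sum_eq_zero fun σ hσ => qt_coeff_zero G σ ?_
    have := Equiv.Perm.two_le_card_support_of_ne_one (Finset.mem_erase.1 hσ).1
    omega
  obtain ⟨p0, p1, p2⟩ := prod_one_sub_low (fun i => (dg G i : ℚ)) Finset.univ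
  rw [e, coeff_add, coeff_add, coeff_add, hz 0 (by omega), hz 1 (by omega), qt_one, finsetSum_coeff,
    mul_add, sum_swaps, p0, p1, p2]
  simp

theorem lap_invariants {W : Type*} [Fintype W] (G : SimpleGraph V) (H : SimpleGraph W)
    (h : lapPermPoly G = lapPermPoly H) :
    Fintype.card V = Fintype.card W ∧ ∑ i, (dg G i : ℚ) = ∑ i, (dg H i : ℚ) ∧
      ∑ i, (dg G i : ℚ) ^ 2 = ∑ i, (dg H i : ℚ) ^ 2 := by
  obtain ⟨g0, g1, g2⟩ := q_coeffs G
  obtain ⟨h0, h1, h2⟩ := q_coeffs H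
  have key : (X : ℚ[X]) ^ Fintype.card W * pr (qm G) = X ^ Fintype.card V * pr (qm H) := by
    apply RatFunc.algebraMap_injective ℚ
    rw [map_mul, map_mul, map_pow, map_pow, qm_eval, qm_eval, h, RatFunc.algebraMap_X]
    ring
  have hn : Fintype.card V = Fintype.card W := by
    generalize Fintype.card V = n at *
    generalize Fintype.card W = m at *
    rcases lt_trichotomy n m with hl | hl | hl
    · have := congrArg (fun p => p.coeff n) key
      rw [coeff_X_pow_mul', coeff_X_pow_mul', if_neg (by omega), if_pos le_rfl, Nat.sub_self, h0] at this
      norm_num at this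
    · exact hl
    · have := congrArg (fun p => p.coeff m) key
      rw [coeff_X_pow_mul', coeff_X_pow_mul', if_neg (by omega : ¬ n ≤ m), if_pos le_rfl, Nat.sub_self, g0] at this
      norm_num at this
  rw [hn] at key
  have hq := mul_left_cancel₀ (pow_ne_zero _ X_ne_zero) key
  rw [hq] at g1 g2
  have s1 : ∑ i, (dg G i : ℚ) = ∑ i, (dg H i : ℚ) := by linarith
  rw [s1] at g2
  exact ⟨hn, s1, by linarith⟩

theorem degrees_of_theta {p q r : ℕ} (h0 : (0 < p ∧ 0 < q) ∨ (0 < p ∧ 0 < r) ∨ (0 < q ∧ 0 < r))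
    (G : SimpleGraph V) (h : lapPermPoly G = lapPermPoly (thetaGraph p q r)) :
    ∃ u v, u ≠ v ∧ dg G u = 3 ∧ dg G v = 3 ∧ ∀ z, z ≠ u → z ≠ v → dg G z = 2 := by
  obtain ⟨u, v, huv, hu, hv, hz, -⟩ := theta_data p q r h0 (0 : ℚ) 0
  obtain ⟨hn, s1, s2⟩ := lap_invariants G _ h
  have t1 : ∀ z, (dg (thetaGraph p q r) z : ℚ) = 2 + ((if z = u then 1 else 0) + (if z = v then 1 else 0)) := by
    intro z
    by_cases c1 : z = u
    · subst c1; rw [hu]; simp [huv]; norm_num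
    by_cases c2 : z = v
    · subst c2; rw [hv]; simp [huv.symm]; norm_num
    rw [hz z c1 c2]; simp [c1, c2]
  have t2 : ∀ z, (dg (thetaGraph p q r) z : ℚ) ^ 2 = 4 + 5 * ((if z = u then 1 else 0) + (if z = v then 1 else 0)) := by
    intro z
    by_cases c1 : z = u
    · subst c1; rw [hu]; simp [huv]; norm_num
    by_cases c2 : z = v
    · subst c2; rw [hv]; simp [huv.symm]; norm_num
    rw [hz z c1 c2]; simp [c1, c2]; norm_num
  rw [Finset.sum_congr rfl fun z _ => t1 z, Finset.sum_add_distrib, Finset.sum_add_distrib] at s1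
  rw [Finset.sum_congr rfl fun z _ => t2 z, Finset.sum_add_distrib, ← Finset.mul_sum, Finset.sum_add_distrib] at s2
  simp only [Finset.sum_const, Finset.card_univ, Finset.sum_ite_eq', Finset.mem_univ, if_true, nsmul_eq_mul,
    ← hn] at s1 s2
  have hsum : ∑ i, ((dg G i : ℤ) - 2) * ((dg G i : ℤ) - 3) = 0 := by
    have : ∑ i, ((dg G i : ℚ) - 2) * ((dg G i : ℚ) - 3) = 0 := by
      have e : ∀ i, ((dg G i : ℚ) - 2) * ((dg G i : ℚ) - 3) = (dg G i : ℚ) ^ 2 - 5 * (dg G i : ℚ) + 6 := by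
        intro i; ring
      rw [Finset.sum_congr rfl fun i _ => e i, Finset.sum_add_distrib, Finset.sum_sub_distrib, ← Finset.mul_sum,
        s1, s2]
      simp only [Finset.sum_const, Finset.card_univ, nsmul_eq_mul]
      ring
    exact_mod_cast this
  have hd : ∀ i, dg G i = 2 ∨ dg G i = 3 := by
    have hnn : ∀ i ∈ Finset.univ, 0 ≤ ((dg G i : ℤ) - 2) * ((dg G i : ℤ) - 3) := by
      intro i _
      rcases le_or_gt (dg G i : ℤ) 2 with c | c
      · exact mul_nonneg_of_nonpos_of_nonpos (by omega) (by omega)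
      · exact mul_nonneg (by omega) (by omega)
    intro i
    have := (Finset.sum_eq_zero_iff_of_nonneg hnn).1 hsum i (Finset.mem_univ i)
    rcases mul_eq_zero.1 this with c | c
    · left; omega
    · right; omega
  have hcard : (Finset.univ.filter (fun i => dg G i = 3)).card = 2 := by
    have e : ∀ i, (dg G i : ℚ) = 2 + (if dg G i = 3 then 1 else 0) := by
      intro i
      rcases hd i with c | c <;> rw [c] <;> norm_num
    rw [Finset.sum_congr rfl fun i _ => e i, Finset.sum_add_distrib, Finset.sum_boole] at s1
    simp only [Finset.sum_const, Finset.card_univ, nsmul_eq_mul] at s1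
    have : ((Finset.univ.filter (fun i => dg G i = 3)).card : ℚ) = 2 := by linarith
    exact_mod_cast this
  obtain ⟨x, y, hxy, he⟩ := Finset.card_eq_two.1 hcard
  have hmem : ∀ z, dg G z = 3 ↔ z = x ∨ z = y := by
    intro z
    have : z ∈ Finset.univ.filter (fun i => dg G i = 3) ↔ z ∈ ({x, y} : Finset V) := by rw [he]
    simpa using this
  refine ⟨x, y, hxy, (hmem x).2 (Or.inl rfl), (hmem y).2 (Or.inr rfl), fun z h1 h2 => ?_⟩
  exact (hd z).resolve_right fun c => by rcases (hmem z).1 c with c | c <;> contradiction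

end Degrees

theorem exists_sort (a b c : ℕ) : ∃ a' b' c', a' ≤ b' ∧ b' ≤ c' ∧
    Sth (X : ℤ[X]) a b c = Sth X a' b' c' ∧
    ((a' = a ∧ b' = b ∧ c' = c) ∨ (a' = a ∧ b' = c ∧ c' = b) ∨ (a' = b ∧ b' = a ∧ c' = c) ∨
      (a' = b ∧ b' = c ∧ c' = a) ∨ (a' = c ∧ b' = a ∧ c' = b) ∨ (a' = c ∧ b' = b ∧ c' = a)) := by
  have s1 : ∀ a b c, Sth (X : ℤ[X]) a b c = Sth X b a c := by
    intro a b c; simp only [Sth, add_comm b a]; ring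
  have s2 : ∀ a b c, Sth (X : ℤ[X]) a b c = Sth X a c b := by
    intro a b c; simp only [Sth, add_comm c b]; ring
  rcases le_total a b with h1 | h1 <;> rcases le_total b c with h2 | h2 <;> rcases le_total a c with h3 | h3
  · exact ⟨a, b, c, h1, h2, rfl, by simp⟩
  · exact ⟨a, b, c, h1, h2, rfl, by simp⟩
  · exact ⟨a, c, b, h3, h2, s2 _ _ _, by simp⟩
  · exact ⟨c, a, b, h3, h1, by rw [s2, s1], by simp⟩
  · exact ⟨b, a, c, h1, h3, s1 _ _ _, by simp⟩
  · exact ⟨b, c, a, h2, h3, by rw [s1, s2], by simp⟩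
  · exact ⟨c, b, a, h2, h1, by rw [s1, s2, s1], by simp⟩
  · exact ⟨c, b, a, h2, h1, by rw [s1, s2, s1], by simp⟩

theorem mat_deg {V : Type*} [Fintype V] {G : SimpleGraph V} {u v : V} (hu : dg G u = 3) (hv : dg G v = 3)
    (hz : ∀ z, z ≠ u → z ≠ v → dg G z = 2) :
    aeval (YF + 2) (lapPermPoly G) = pr (mat G (fun z => if z = u ∨ z = v then YF - 1 else YF)) := by
  rw [lap_eval]
  congr 2
  funext z
  by_cases h1 : z = u
  · subst h1; rw [hu, if_pos (Or.inl rfl)]; push_cast; ring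
  by_cases h2 : z = v
  · subst h2; rw [hv, if_pos (Or.inr rfl)]; push_cast; ring
  rw [hz z h1 h2, if_neg (by tauto)]; push_cast; ring

theorem sort_facts {a b c p q r : ℕ} (h : ((a = p + 1 ∧ b = q + 1 ∧ c = r + 1) ∨ (a = p + 1 ∧ b = r + 1 ∧ c = q + 1) ∨
      (a = q + 1 ∧ b = p + 1 ∧ c = r + 1) ∨ (a = q + 1 ∧ b = r + 1 ∧ c = p + 1) ∨
      (a = r + 1 ∧ b = p + 1 ∧ c = q + 1) ∨ (a = r + 1 ∧ b = q + 1 ∧ c = p + 1)))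
    (c12 : 0 < p ∨ 0 < q) (c13 : 0 < p ∨ 0 < r) (c23 : 0 < q ∨ 0 < r) :
    1 ≤ a ∧ 3 ≤ a + b ∧ a + b + c = p + q + r + 3 := by
  rcases h with ⟨x1, x2, x3⟩ | ⟨x1, x2, x3⟩ | ⟨x1, x2, x3⟩ | ⟨x1, x2, x3⟩ | ⟨x1, x2, x3⟩ | ⟨x1, x2, x3⟩ <;> (refine ⟨?_, ?_, ?_⟩ <;> omega)

theorem sort_match {a b c p q r l m n : ℕ} (h : ((a = p + 1 ∧ b = q + 1 ∧ c = r + 1) ∨ (a = p + 1 ∧ b = r + 1 ∧ c = q + 1) ∨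
      (a = q + 1 ∧ b = p + 1 ∧ c = r + 1) ∨ (a = q + 1 ∧ b = r + 1 ∧ c = p + 1) ∨
      (a = r + 1 ∧ b = p + 1 ∧ c = q + 1) ∨ (a = r + 1 ∧ b = q + 1 ∧ c = p + 1)))
    (h' : ((a = l + 1 ∧ b = m + 1 ∧ c = n + 1) ∨ (a = l + 1 ∧ b = n + 1 ∧ c = m + 1) ∨
      (a = m + 1 ∧ b = l + 1 ∧ c = n + 1) ∨ (a = m + 1 ∧ b = n + 1 ∧ c = l + 1) ∨
      (a = n + 1 ∧ b = l + 1 ∧ c = m + 1) ∨ (a = n + 1 ∧ b = m + 1 ∧ c = l + 1))) :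
    (l = p ∧ m = q ∧ n = r) ∨ (l = p ∧ n = q ∧ m = r) ∨ (m = p ∧ l = q ∧ n = r) ∨
      (m = p ∧ n = q ∧ l = r) ∨ (n = p ∧ l = q ∧ m = r) ∨ (n = p ∧ m = q ∧ l = r) := by
  rcases h with ⟨x1, x2, x3⟩ | ⟨x1, x2, x3⟩ | ⟨x1, x2, x3⟩ | ⟨x1, x2, x3⟩ | ⟨x1, x2, x3⟩ | ⟨x1, x2, x3⟩ <;>
  rcases h' with ⟨y1, y2, y3⟩ | ⟨y1, y2, y3⟩ | ⟨y1, y2, y3⟩ | ⟨y1, y2, y3⟩ | ⟨y1, y2, y3⟩ | ⟨y1, y2, y3⟩ <;>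
  subst_vars <;> simp_all

theorem main_aux (p q r : ℕ) (h0 : (0 < p ∧ 0 < q) ∨ (0 < p ∧ 0 < r) ∨ (0 < q ∧ 0 < r))
    {V : Type*} [Fintype V] (G : SimpleGraph V)
    (h : lapPermPoly G = lapPermPoly (thetaGraph p q r)) :
    Nonempty (G ≃g thetaGraph p q r) := by
  obtain ⟨u, v, huv, hu, hv, hz⟩ := degrees_of_theta h0 G h
  obtain ⟨u', v', huv', hu', hv', hz', hpr⟩ := theta_data p q r h0 YF (YF - 1)
  have hcard := (lap_invariants G _ h).1
  rw [Fintype.card_fin] at hcard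
  have e1 : pr (mat G (fun z => if z = u ∨ z = v then YF - 1 else YF)) = thF YF (YF - 1) p q r := by
    rw [← mat_deg hu hv hz, h, mat_deg hu' hv' hz', ← hpr]
    congr 2
    funext z
    by_cases c : z = u' ∨ z = v'
    · rw [if_pos c, if_pos c]
    · rw [if_neg c, if_neg c]
  obtain ⟨a, b, c, hab, hbc, hS, hperm⟩ := exists_sort (p + 1) (q + 1) (r + 1)
  obtain ⟨hA, hB, hs1⟩ := sort_facts hperm (by tauto) (by tauto) (by tauto)
  rcases struct_thm YF (YF - 1) G huv hu hv hz with
    ⟨l1, l2, l3, H, K, hnd, hiso, c12, c13, c23, hG, hK, hp⟩ | ⟨k, b', c', K, hb', hc', hK, hp⟩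
  · obtain ⟨t1, t2⟩ := transfer_theta hK (e1.symm.trans hp)
    obtain ⟨a', b', c', hab', hbc', hS', hperm'⟩ := exists_sort (l1.length + 1) (l2.length + 1) (l3.length + 1)
    rw [hS, hS'] at t2
    rw [← List.length_pos_iff, ← List.length_pos_iff] at c12 c13 c23
    obtain ⟨hA', hB', hs2⟩ := sort_facts hperm' c12 c13 c23
    have hs3 : a + b + c = a' + b' + c' + K.sum := by linarith
    obtain ⟨ea, eb, ec⟩ := arith_theta hA hab hbc hB hA' hab' hbc' hB' hK hs3 t2
    subst ea eb ec
    refine iso_of_lists_perm hnd hiso hG ?_ (sort_match hperm hperm')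
    linarith
  · obtain ⟨t1, t2⟩ := transfer_db hb' hc' hK (e1.symm.trans hp)
    rw [hS] at t2
    exact (arith_db hA hab hbc hB (Nat.le_add_left 1 k) hb' hc' hK (by linarith) t2).elim

/-- **Theorem 1.2.** The graph `θ(p,q,r)` is determined by its Laplacian permanental
polynomial: any simple graph with the same Laplacian permanental polynomial as `θ(p,q,r)`
is isomorphic to `θ(p,q,r)`. -/
theorem thetaGraph_determined_by_lapPermPoly
    (p q r : ℕ) (h0 : (0 < p ∧ 0 < q) ∨ (0 < p ∧ 0 < r) ∨ (0 < q ∧ 0 < r))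
    {V : Type*} [Fintype V] (G : SimpleGraph V)
    (h : lapPermPoly G = lapPermPoly (thetaGraph p q r)) :
    Nonempty (G ≃g thetaGraph p q r) := by
  exact main_aux p q r h0 G h
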